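/- Let T > 0, ξ₁(t) < ξ₂(t) be continuous on [0,T], and u a classical solution of u_t = a(x,t) u_xx + b(x,t) u_x + c(x,t) u on Ω = {(x,t) : ξ₁(t) < x < ξ₂(t), t ∈ (0,T]} with coefficients satisfying (1.2), u(·,t) ≢ 0 for every t ∈ [0,T], and (H1) holding for both i = 1,2. Then there exists a sequence {τ_j} ⊂ (0,T) decreasing to 0 such that the number of zeros of u(·,τ_j) in [ξ₁(τ_j), ξ₂(τ_j)] is finite for every j. -/

import Mathlib

open Set

/-- spatial partial derivative `u_x` -/
noncomputable def pdx (u : ℝ → ℝ → ℝ) (x t : ℝ) : ℝ := deriv (fun y => u y t) x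

/-- second spatial partial derivative `u_xx` -/
noncomputable def pdxx (u : ℝ → ℝ → ℝ) (x t : ℝ) : ℝ := deriv (fun y => pdx u y t) x

/-- time partial derivative `u_t` -/
noncomputable def pdt (u : ℝ → ℝ → ℝ) (x t : ℝ) : ℝ := deriv (fun s => u x s) t

/-- the closure of the space-time domain `Ω` -/
def domCl (xi1 xi2 : ℝ → ℝ) (T : ℝ) : Set (ℝ × ℝ) :=
  {p : ℝ × ℝ | p.2 ∈ Icc (0:ℝ) T ∧ p.1 ∈ Icc (xi1 p.2) (xi2 p.2)}

/-- the domain together with its lateral boundaries -/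
def domLat (xi1 xi2 : ℝ → ℝ) (T : ℝ) : Set (ℝ × ℝ) :=
  {p : ℝ × ℝ | p.2 ∈ Ioc (0:ℝ) T ∧ p.1 ∈ Icc (xi1 p.2) (xi2 p.2)}

/-- `u` is a classical solution of `u_t = a u_xx + b u_x + c u` on
`Ω = {(x,t) : ξ₁(t) < x < ξ₂(t), 0 < t ≤ T}`: it is continuous on the closure, its
partial derivatives `u_t, u_x, u_xx` exist and are continuous up to the lateral
boundaries, and the equation holds. -/
structure IsClassicalSolution (a b c : ℝ → ℝ → ℝ) (xi1 xi2 : ℝ → ℝ) (T : ℝ)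
    (u : ℝ → ℝ → ℝ) : Prop where
  cont : ContinuousOn (fun p : ℝ × ℝ => u p.1 p.2) (domCl xi1 xi2 T)
  diff_x : ∀ p ∈ domLat xi1 xi2 T, DifferentiableAt ℝ (fun y => u y p.2) p.1
  diff_xx : ∀ p ∈ domLat xi1 xi2 T, DifferentiableAt ℝ (fun y => pdx u y p.2) p.1
  diff_t : ∀ p ∈ domLat xi1 xi2 T, DifferentiableAt ℝ (fun s => u p.1 s) p.2
  cont_x : ContinuousOn (fun p : ℝ × ℝ => pdx u p.1 p.2) (domLat xi1 xi2 T)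
  cont_xx : ContinuousOn (fun p : ℝ × ℝ => pdxx u p.1 p.2) (domLat xi1 xi2 T)
  cont_t : ContinuousOn (fun p : ℝ × ℝ => pdt u p.1 p.2) (domLat xi1 xi2 T)
  eqn : ∀ p ∈ domLat xi1 xi2 T,
    pdt u p.1 p.2 =
      a p.1 p.2 * pdxx u p.1 p.2 + b p.1 p.2 * pdx u p.1 p.2 + c p.1 p.2 * u p.1 p.2

/-- the regularity assumption (1.2): `a, a⁻¹, a_t, a_x, a_xx, b, b_t, b_x, c ∈ L^∞`,
with `a > 0` -/
def Reg12 (a b c : ℝ → ℝ → ℝ) (xi1 xi2 : ℝ → ℝ) (T : ℝ) : Prop :=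
  ∃ M : ℝ, ∀ p ∈ domLat xi1 xi2 T,
    0 < a p.1 p.2 ∧
    DifferentiableAt ℝ (fun y => a y p.2) p.1 ∧
    DifferentiableAt ℝ (fun y => pdx a y p.2) p.1 ∧
    DifferentiableAt ℝ (fun s => a p.1 s) p.2 ∧
    DifferentiableAt ℝ (fun y => b y p.2) p.1 ∧
    DifferentiableAt ℝ (fun s => b p.1 s) p.2 ∧
    |a p.1 p.2| ≤ M ∧ |(a p.1 p.2)⁻¹| ≤ M ∧ |pdt a p.1 p.2| ≤ M ∧ |pdx a p.1 p.2| ≤ M ∧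
    |pdxx a p.1 p.2| ≤ M ∧ |b p.1 p.2| ≤ M ∧ |pdt b p.1 p.2| ≤ M ∧ |pdx b p.1 p.2| ≤ M ∧
    |c p.1 p.2| ≤ M

/-- the set of zeroes of `u(·,t)` in `I(t) = [ξ₁(t), ξ₂(t)]` -/
def zeroSet (u : ℝ → ℝ → ℝ) (xi1 xi2 : ℝ → ℝ) (t : ℝ) : Set ℝ :=
  {x ∈ Icc (xi1 t) (xi2 t) | u x t = 0}

/-- `Z(t)`: the (extended-natural) number of zeroes of `u(·,t)` in `I(t)` -/
noncomputable def Znum (u : ℝ → ℝ → ℝ) (xi1 xi2 : ℝ → ℝ) (t : ℝ) : ℕ∞ :=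
  (zeroSet u xi1 xi2 t).encard

/-- `u(·,s)` has a multiple (degenerate) zero in `I(s)` -/
def HasMultipleZero (u : ℝ → ℝ → ℝ) (xi1 xi2 : ℝ → ℝ) (s : ℝ) : Prop :=
  ∃ x₀ ∈ Icc (xi1 s) (xi2 s), u x₀ s = 0 ∧ pdx u x₀ s = 0

/-- the boundary trace `wᵢ(t) := u(ξᵢ(t), t)` -/
def bdryTrace (u : ℝ → ℝ → ℝ) (xi : ℝ → ℝ) : ℝ → ℝ := fun t => u (xi t) t

/-- some left neighborhood of `s` consists entirely of N-moments -/
def leftN (w : ℝ → ℝ) (s : ℝ) : Prop := ∃ ε > 0, ∀ t ∈ Ioo (s - ε) s, w t ≠ 0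

/-- some left neighborhood of `s` consists entirely of Z-moments -/
def leftZ (w : ℝ → ℝ) (s : ℝ) : Prop := ∃ ε > 0, ∀ t ∈ Ioo (s - ε) s, w t = 0

/-- some right neighborhood of `s` consists entirely of N-moments -/
def rightN (w : ℝ → ℝ) (s : ℝ) : Prop := ∃ ε > 0, ∀ t ∈ Ioo s (s + ε), w t ≠ 0

/-- some right neighborhood of `s` consists entirely of Z-moments -/
def rightZ (w : ℝ → ℝ) (s : ℝ) : Prop := ∃ ε > 0, ∀ t ∈ Ioo s (s + ε), w t = 0

/-- `s` is an NZN-moment of `w` -/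
def IsNZN (w : ℝ → ℝ) (s : ℝ) : Prop := w s = 0 ∧ leftN w s ∧ rightN w s

/-- `s` is a ZZZ-moment of `w` -/
def IsZZZ (w : ℝ → ℝ) (s : ℝ) : Prop := w s = 0 ∧ leftZ w s ∧ rightZ w s

/-- `s` is an NZZ-moment of `w` -/
def IsNZZ (w : ℝ → ℝ) (s : ℝ) : Prop := w s = 0 ∧ leftN w s ∧ rightZ w s

/-- `s` is a ZZN-moment of `w` -/
def IsZZN (w : ℝ → ℝ) (s : ℝ) : Prop := w s = 0 ∧ leftZ w s ∧ rightN w s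

/-- `s` is an NZ*-moment of `w` -/
def IsNZstar (w : ℝ → ℝ) (s : ℝ) : Prop := w s = 0 ∧ leftN w s

/-- (H1): on every nondegenerate closed interval of Z-moments of the boundary trace `w`,
the boundary curve `ξ` is `C¹` -/
def H1cond (w xi : ℝ → ℝ) (T : ℝ) : Prop :=
  ∀ p q : ℝ, 0 ≤ p → p < q → q ≤ T → (∀ t ∈ Icc p q, w t = 0) → ContDiffOn ℝ 1 xi (Icc p q)

/-- (H2) at an NZ*-moment `s` of `u(ξ(·),·)`, with sign `σ = (-1)^i`:
`ξ'(s-0)` exists, and `σ · u_x(ξ(s),s) ≥ 0` (resp. `≤ 0`) if `u(ξ(t),t) > 0`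
(resp. `< 0`) shortly before `s`. -/
def H2at (u : ℝ → ℝ → ℝ) (xi : ℝ → ℝ) (σ s : ℝ) : Prop :=
  (∃ L : ℝ, HasDerivWithinAt xi L (Iio s) s) ∧
  ((∃ ε > 0, ∀ t ∈ Ioo (s - ε) s, 0 < u (xi t) t) → 0 ≤ σ * pdx u (xi s) s) ∧
  ((∃ ε > 0, ∀ t ∈ Ioo (s - ε) s, u (xi t) t < 0) → σ * pdx u (xi s) s ≤ 0)

/-- (H3) at a Z-moment `s` of `u(ξ(·),·)`, with sign `σ = (-1)^i`:
`σ · u(ξ(t),t) · u(x,s) ≤ 0` for `t` slightly after `s` and `x ∈ I(s)` near (but not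
equal to) `ξ(s)`. -/
def H3at (u : ℝ → ℝ → ℝ) (xi1 xi2 xi : ℝ → ℝ) (σ s : ℝ) : Prop :=
  ∃ ε > 0, ∃ δ > 0, ∀ t ∈ Ioo s (s + ε), ∀ x ∈ Icc (xi1 s) (xi2 s),
    x ≠ xi s → |x - xi s| < δ → σ * (u (xi t) t * u x s) ≤ 0

/-- (H3) at a Z-moment `s` for the left boundary (`i = 1`, one-boundary setting):
`-u(ξ₁(t),t) · u(x,s) ≤ 0` for `t` slightly after `s` and `x` slightly to the right
of `ξ₁(s)`. -/
def H3one (u : ℝ → ℝ → ℝ) (xi : ℝ → ℝ) (s : ℝ) : Prop :=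
  ∃ ε > 0, ∃ δ > 0, ∀ t ∈ Ioo s (s + ε), ∀ x : ℝ,
    xi s < x → x - xi s < δ → -(u (xi t) t) * u x s ≤ 0

section Aux

open Set MeasureTheory Filter Topology

set_option linter.unusedVariables false


/-- bounded measurable on the unit interval -/
def Gd (F : ℝ → ℝ) : Prop :=
  AEStronglyMeasurable F (volume.restrict (Ioo (0:ℝ) 1)) ∧ ∃ M, ∀ x ∈ Ioo (0:ℝ) 1, |F x| ≤ M

/-- integral over the unit interval -/
noncomputable def JJ (F : ℝ → ℝ) : ℝ := ∫ x in Ioo (0:ℝ) 1, F x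

namespace Gd
variable {F K : ℝ → ℝ}

theorem integrable (hF : Gd F) : Integrable F (volume.restrict (Ioo (0:ℝ) 1)) := by
  obtain ⟨h1, M, hM⟩ := hF
  refine Integrable.of_bound h1 M ?_
  filter_upwards [ae_restrict_mem measurableSet_Ioo] with x hx using by simpa using hM x hx

theorem add (hF : Gd F) (hK : Gd K) : Gd (fun x => F x + K x) := by
  obtain ⟨h1, M, hM⟩ := hF
  obtain ⟨h2, M', hM'⟩ := hK
  exact ⟨h1.add h2, M + M', fun x hx => (abs_add_le _ _).trans (add_le_add (hM x hx) (hM' x hx))⟩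

theorem neg (hF : Gd F) : Gd (fun x => - F x) := by
  obtain ⟨h1, M, hM⟩ := hF
  exact ⟨h1.neg, M, fun x hx => by simpa using hM x hx⟩

theorem sub (hF : Gd F) (hK : Gd K) : Gd (fun x => F x - K x) := by
  simpa [sub_eq_add_neg] using hF.add hK.neg

theorem mul (hF : Gd F) (hK : Gd K) : Gd (fun x => F x * K x) := by
  obtain ⟨h1, M, hM⟩ := hF
  obtain ⟨h2, M', hM'⟩ := hK
  refine ⟨h1.mul h2, M * M', fun x hx => ?_⟩
  rw [abs_mul]
  exact mul_le_mul (hM x hx) (hM' x hx) (abs_nonneg _) ((abs_nonneg _).trans (hM x hx))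

theorem const (c : ℝ) : Gd (fun _ => c) :=
  ⟨aestronglyMeasurable_const, |c|, fun _ _ => le_rfl⟩

theorem cmul (c : ℝ) (hF : Gd F) : Gd (fun x => c * F x) := (const c).mul hF

theorem of_cont (hF : ContinuousOn F (Icc 0 1)) : Gd F := by
  obtain ⟨M, hM⟩ := isCompact_Icc.exists_bound_of_continuousOn hF
  exact ⟨(hF.mono Ioo_subset_Icc_self).aestronglyMeasurable measurableSet_Ioo, M,
    fun x hx => by simpa using hM x (Ioo_subset_Icc_self hx)⟩

theorem of_contIoo (hF : ContinuousOn F (Ioo 0 1)) (M : ℝ) (hM : ∀ x ∈ Ioo (0:ℝ) 1, |F x| ≤ M) :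
    Gd F := ⟨hF.aestronglyMeasurable measurableSet_Ioo, M, hM⟩

theorem congr (hF : Gd F) (h : ∀ x ∈ Ioo (0:ℝ) 1, F x = K x) : Gd K := by
  obtain ⟨h1, M, hM⟩ := hF
  refine ⟨h1.congr ?_, M, fun x hx => by rw [← h x hx]; exact hM x hx⟩
  filter_upwards [ae_restrict_mem measurableSet_Ioo] with x hx using h x hx

end Gd

theorem JJ_add {F K : ℝ → ℝ} (hF : Gd F) (hK : Gd K) : JJ (fun x => F x + K x) = JJ F + JJ K :=
  integral_add hF.integrable hK.integrable

theorem JJ_sub {F K : ℝ → ℝ} (hF : Gd F) (hK : Gd K) : JJ (fun x => F x - K x) = JJ F - JJ K :=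
  integral_sub hF.integrable hK.integrable

theorem JJ_cmul (c : ℝ) (F : ℝ → ℝ) : JJ (fun x => c * F x) = c * JJ F :=
  integral_const_mul c _

theorem JJ_congr {F K : ℝ → ℝ} (h : ∀ x ∈ Ioo (0:ℝ) 1, F x = K x) : JJ F = JJ K :=
  setIntegral_congr_fun measurableSet_Ioo h

theorem JJ_mono {F K : ℝ → ℝ} (hF : Gd F) (hK : Gd K) (h : ∀ x ∈ Ioo (0:ℝ) 1, F x ≤ K x) :
    JJ F ≤ JJ K :=
  setIntegral_mono_on hF.integrable hK.integrable measurableSet_Ioo h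

theorem JJ_nonneg {F : ℝ → ℝ} (h : ∀ x ∈ Ioo (0:ℝ) 1, 0 ≤ F x) : 0 ≤ JJ F :=
  setIntegral_nonneg measurableSet_Ioo h

theorem JJ_const (c : ℝ) : JJ (fun _ => c) = c := by
  simp [JJ]

theorem JJ_pos {F : ℝ → ℝ} (hF : ContinuousOn F (Icc 0 1)) (h : ∀ x ∈ Ioo (0:ℝ) 1, 0 ≤ F x)
    (hp : ∃ x ∈ Ioo (0:ℝ) 1, 0 < F x) : 0 < JJ F := by
  obtain ⟨x, hx, hpx⟩ := hp
  have hi := (Gd.of_cont hF).integrable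
  unfold JJ
  rw [integral_pos_iff_support_of_nonneg_ae]
  · have hc : ContinuousAt F x := (hF.mono Ioo_subset_Icc_self).continuousAt (isOpen_Ioo.mem_nhds hx)
    have hn : {y | 0 < F y} ∩ Ioo 0 1 ∈ 𝓝 x :=
      inter_mem (hc.eventually (lt_mem_nhds hpx)) (isOpen_Ioo.mem_nhds hx)
    have h0 : 0 < volume ({y | 0 < F y} ∩ Ioo (0:ℝ) 1) := Measure.measure_pos_of_mem_nhds _ hn
    refine h0.trans_le ?_
    refine le_trans ?_ (Measure.le_restrict_apply _ _)
    refine measure_mono ?_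
    rintro y ⟨hy, hy'⟩
    exact ⟨ne_of_gt hy, hy'⟩
  · filter_upwards [ae_restrict_mem measurableSet_Ioo] with y hy using h y hy
  · exact hi

theorem JJ_ftc {F F' : ℝ → ℝ} (hF : ContinuousOn F (Icc 0 1))
    (hd : ∀ x ∈ Ioo (0:ℝ) 1, HasDerivAt F (F' x) x) (hF' : Gd F') : JJ F' = F 1 - F 0 := by
  have hi : IntervalIntegrable F' volume 0 1 := by
    rw [intervalIntegrable_iff_integrableOn_Ioo_of_le zero_le_one]
    exact hF'.integrable
  rw [← intervalIntegral.integral_eq_sub_of_hasDerivAt_of_le zero_le_one hF hd hi]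
  rw [intervalIntegral.integral_of_le zero_le_one, JJ, integral_Ioc_eq_integral_Ioo]

/-- measurability of a pointwise time derivative -/
theorem Gd.of_deriv {F : ℝ → ℝ → ℝ} {F' : ℝ → ℝ} {t M : ℝ}
    (hF : ∀ᶠ s in 𝓝 t, AEStronglyMeasurable (fun x => F x s) (volume.restrict (Ioo (0:ℝ) 1)))
    (hd : ∀ x ∈ Ioo (0:ℝ) 1, HasDerivAt (fun s => F x s) (F' x) t)
    (hM : ∀ x ∈ Ioo (0:ℝ) 1, |F' x| ≤ M) : Gd F' := by
  refine ⟨?_, M, hM⟩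
  obtain ⟨w, hw, hw0⟩ : ∃ w : ℕ → ℝ, Tendsto w atTop (𝓝[≠] t) ∧
      ∀ n, AEStronglyMeasurable (fun x => F x (w n)) (volume.restrict (Ioo (0:ℝ) 1)) := by
    have : ∃ᶠ s in 𝓝[≠] t, AEStronglyMeasurable (fun x => F x s) (volume.restrict (Ioo (0:ℝ) 1)) :=
      (hF.filter_mono nhdsWithin_le_nhds).frequently
    exact exists_seq_forall_of_frequently this
  refine aestronglyMeasurable_of_tendsto_ae (u := atTop)
    (f := fun n x => slope (fun s => F x s) t (w n)) (fun n => ?_) ?_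
  · simp only [slope_def_field, div_eq_mul_inv]
    exact ((hw0 n).sub hF.self_of_nhds).mul_const _
  · filter_upwards [ae_restrict_mem measurableSet_Ioo] with x hx
    exact (hasDerivAt_iff_tendsto_slope.1 (hd x hx)).comp hw

theorem JJ_hasDerivAt {F F' : ℝ → ℝ → ℝ} {t M : ℝ} {s : Set ℝ} (hs : s ∈ 𝓝 t)
    (hF : ∀ r ∈ s, Gd (fun x => F x r))
    (hd : ∀ x ∈ Ioo (0:ℝ) 1, ∀ r ∈ s, HasDerivAt (fun r => F x r) (F' x r) r)
    (hM : ∀ x ∈ Ioo (0:ℝ) 1, ∀ r ∈ s, |F' x r| ≤ M) :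
    HasDerivAt (fun r => JJ (fun x => F x r)) (JJ (fun x => F' x t)) t := by
  have ht := mem_of_mem_nhds hs
  have h0 : Gd (fun x => F' x t) := Gd.of_deriv (F := F) (t := t) (M := M)
    (by filter_upwards [hs] with r hr using (hF r hr).1) (fun x hx => hd x hx t ht)
    (fun x hx => hM x hx t ht)
  refine (hasDerivAt_integral_of_dominated_loc_of_deriv_le (μ := volume.restrict (Ioo (0:ℝ) 1))
    (F := fun r x => F x r) (F' := fun r x => F' x r) (bound := fun _ => M) hs
    ?_ (hF t ht).integrable h0.1 ?_ (Gd.const M).integrable ?_).2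
  · filter_upwards [hs] with r hr using (hF r hr).1
  · filter_upwards [ae_restrict_mem measurableSet_Ioo] with x hx r hr using by simpa using hM x hx r hr
  · filter_upwards [ae_restrict_mem measurableSet_Ioo] with x hx r hr using hd x hx r hr


/-- Gaussian weight -/
noncomputable def gw (x0 τ x : ℝ) : ℝ := Real.exp (-(x - x0) ^ 2 / (4 * τ))

/-- weighted inner product -/
noncomputable def ip (G f g : ℝ → ℝ) : ℝ := JJ (fun x => f x * g x * G x)

theorem gw_pos (x0 τ x : ℝ) : 0 < gw x0 τ x := Real.exp_pos _

theorem gw_le_one {x0 τ x : ℝ} (hτ : 0 ≤ τ) : gw x0 τ x ≤ 1 := by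
  unfold gw
  rw [Real.exp_le_one_iff]
  apply div_nonpos_of_nonpos_of_nonneg
  · nlinarith [sq_nonneg (x - x0)]
  · linarith

theorem gw_cont (x0 τ : ℝ) : Continuous (gw x0 τ) := by
  unfold gw; fun_prop

theorem gw_gd (x0 τ : ℝ) : Gd (gw x0 τ) := Gd.of_cont (gw_cont x0 τ).continuousOn

theorem gw_dx (x0 τ x : ℝ) :
    HasDerivAt (gw x0 τ) (-((x - x0) / (2 * τ)) * gw x0 τ x) x := by
  unfold gw
  have h : HasDerivAt (fun x => -(x - x0) ^ 2 / (4 * τ)) (-(2 * (x - x0)) / (4 * τ)) x := by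
    have := ((((hasDerivAt_id x).sub_const x0).pow 2).neg).div_const (4 * τ)
    simpa using this
  convert h.exp using 1
  rw [mul_comm]
  congr 1
  by_cases hτ : τ = 0
  · simp [hτ]
  · field_simp; ring

theorem gw_dt (x0 tp x t : ℝ) (h : tp - t ≠ 0) :
    HasDerivAt (fun s => gw x0 (tp - s) x)
      (-((x - x0) / (2 * (tp - t))) ^ 2 * gw x0 (tp - t) x) t := by
  unfold gw
  have h1 : HasDerivAt (fun s => 4 * (tp - s)) (4 * (-1)) t :=
    (((hasDerivAt_id t).const_sub tp)).const_mul 4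
  have h2 := ((hasDerivAt_const t (-(x - x0) ^ 2)).div h1 (by positivity)).exp
  refine h2.congr_deriv ?_
  rw [mul_comm]
  simp only [Pi.div_apply]
  congr 1
  field_simp
  ring

section ip
variable {G f g k : ℝ → ℝ}

theorem ip_comm : ip G f g = ip G g f := by
  unfold ip; congr 1; ext x; ring

theorem ip_add_right (hG : Gd G) (hf : Gd f) (hg : Gd g) (hk : Gd k) :
    ip G f (fun x => g x + k x) = ip G f g + ip G f k := by
  unfold ip
  rw [← JJ_add ((hf.mul hg).mul hG) ((hf.mul hk).mul hG)]
  congr 1; ext x; ring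

theorem ip_sub_right (hG : Gd G) (hf : Gd f) (hg : Gd g) (hk : Gd k) :
    ip G f (fun x => g x - k x) = ip G f g - ip G f k := by
  unfold ip
  rw [← JJ_sub ((hf.mul hg).mul hG) ((hf.mul hk).mul hG)]
  congr 1; ext x; ring

theorem ip_cmul_right (c : ℝ) :
    ip G f (fun x => c * g x) = c * ip G f g := by
  unfold ip
  rw [← JJ_cmul]
  congr 1; ext x; ring

theorem ip_add_left (hG : Gd G) (hf : Gd f) (hg : Gd g) (hk : Gd k) :
    ip G (fun x => g x + k x) f = ip G g f + ip G k f := by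
  rw [ip_comm, ip_add_right hG hf hg hk, ip_comm, ip_comm (f := f)]

theorem ip_sub_left (hG : Gd G) (hf : Gd f) (hg : Gd g) (hk : Gd k) :
    ip G (fun x => g x - k x) f = ip G g f - ip G k f := by
  rw [ip_comm, ip_sub_right hG hf hg hk, ip_comm, ip_comm (f := f)]

theorem ip_cmul_left (c : ℝ) :
    ip G (fun x => c * g x) f = c * ip G g f := by
  rw [ip_comm, ip_cmul_right, ip_comm]

theorem ip_self_nonneg (hG : ∀ x, 0 ≤ G x) : 0 ≤ ip G f f :=
  JJ_nonneg fun x _ => mul_nonneg (mul_self_nonneg _) (hG x)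

/-- Young: `2⟨f,g⟩ ≤ c⟨f,f⟩ + c⁻¹⟨g,g⟩` -/
theorem ip_young (hG : Gd G) (hG0 : ∀ x, 0 ≤ G x) (hf : Gd f) (hg : Gd g) {c : ℝ} (hc : 0 < c) :
    2 * ip G f g ≤ c * ip G f f + c⁻¹ * ip G g g := by
  have h1 := hf.cmul c
  have h := ip_self_nonneg (f := fun x => c * f x - g x) hG0
  rw [ip_sub_left hG (h1.sub hg) h1 hg, ip_sub_right hG h1 h1 hg, ip_sub_right hG hg h1 hg,
    ip_cmul_left, ip_cmul_left, ip_cmul_right, ip_cmul_right, ip_comm (f := g) (g := f)] at h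
  have : 0 ≤ c⁻¹ * (c * (c * ip G f f) - c * ip G f g - (c * ip G f g - ip G g g)) :=
    mul_nonneg (by positivity) h
  have e : c⁻¹ * (c * (c * ip G f f) - c * ip G f g - (c * ip G f g - ip G g g)) =
    c * ip G f f - 2 * ip G f g + c⁻¹ * ip G g g := by field_simp; ring
  linarith

theorem ip_young' (hG : Gd G) (hG0 : ∀ x, 0 ≤ G x) (hf : Gd f) (hg : Gd g) {c : ℝ} (hc : 0 < c) :
    -(2 * ip G f g) ≤ c * ip G f f + c⁻¹ * ip G g g := by
  have h := ip_young hG hG0 (hf.cmul (-1)) hg hc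
  rw [ip_cmul_left, ip_cmul_left, ip_cmul_right] at h
  linarith

end ip

/-- a spatial slice: a `C²` function on the unit interval with zero boundary values -/
structure Slice (V V1 V2 : ℝ → ℝ) : Prop where
  c0 : ContinuousOn V (Icc 0 1)
  c1 : ContinuousOn V1 (Icc 0 1)
  g2 : Gd V2
  d1 : ∀ x ∈ Ioo (0:ℝ) 1, HasDerivAt V (V1 x) x
  d2 : ∀ x ∈ Ioo (0:ℝ) 1, HasDerivAt V1 (V2 x) x
  z0 : V 0 = 0
  z1 : V 1 = 0

theorem qc_cont (x0 τ : ℝ) : Continuous (fun x : ℝ => (x - x0) / (2 * τ)) := by fun_prop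

theorem qc_gd (x0 τ : ℝ) : Gd (fun x : ℝ => (x - x0) / (2 * τ)) :=
  Gd.of_cont (qc_cont x0 τ).continuousOn

theorem qc_dx (x0 τ x : ℝ) : HasDerivAt (fun x : ℝ => (x - x0) / (2 * τ)) (1 / (2 * τ)) x := by
  simpa using ((hasDerivAt_id x).sub_const x0).div_const (2 * τ)

section
variable {V V1 V2 : ℝ → ℝ}

theorem Slice.I1 (h : Slice V V1 V2) (x0 τ : ℝ) :
    ip (gw x0 τ) V (fun x => V2 x - (x - x0) / (2 * τ) * V1 x) = - ip (gw x0 τ) V1 V1 := by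
  have g0 := Gd.of_cont h.c0
  have g1 := Gd.of_cont h.c1
  have gq := (qc_gd x0 τ).mul g1
  have gG := gw_gd x0 τ
  have key : JJ (fun x => V1 x * V1 x * gw x0 τ x +
      V x * (V2 x - (x - x0) / (2 * τ) * V1 x) * gw x0 τ x) = 0 := by
    rw [JJ_ftc (F := fun x => V x * V1 x * gw x0 τ x)
      ((h.c0.mul h.c1).mul (gw_cont x0 τ).continuousOn) ?_
      (((g1.mul g1).mul gG).add ((g0.mul (h.g2.sub gq)).mul gG))]
    · simp [h.z0, h.z1]
    · intro x hx
      refine HasDerivAt.congr_deriv (((h.d1 x hx).mul (h.d2 x hx)).mul (gw_dx x0 τ x)) ?_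
      simp only [Pi.mul_apply]
      ring
  rw [JJ_add ((g1.mul g1).mul gG) ((g0.mul (h.g2.sub gq)).mul gG)] at key
  unfold ip
  linarith

theorem Slice.I2 (h : Slice V V1 V2) (x0 τ : ℝ) :
    ip (gw x0 τ) (fun x => (x - x0) / (2 * τ) * V x) (fun x => (x - x0) / (2 * τ) * V x) =
      1 / (2 * τ) * ip (gw x0 τ) V V
      + 2 * ip (gw x0 τ) V (fun x => (x - x0) / (2 * τ) * V1 x) := by
  have g0 := Gd.of_cont h.c0
  have g1 := Gd.of_cont h.c1
  have gc := qc_gd x0 τ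
  have gq := (qc_gd x0 τ).mul g1
  have gG := gw_gd x0 τ
  have a1 := ((g0.mul g0).mul gG).cmul (1 / (2 * τ))
  have a2 := ((g0.mul gq).mul gG).cmul 2
  have a3 := ((gc.mul g0).mul (gc.mul g0)).mul gG
  have key : JJ (fun x => 1 / (2 * τ) * (V x * V x * gw x0 τ x) +
      2 * (V x * ((x - x0) / (2 * τ) * V1 x) * gw x0 τ x) -
      ((x - x0) / (2 * τ) * V x) * ((x - x0) / (2 * τ) * V x) * gw x0 τ x) = 0 := by
    rw [JJ_ftc (F := fun x => V x * V x * ((x - x0) / (2 * τ)) * gw x0 τ x)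
      (((h.c0.mul h.c0).mul (qc_cont x0 τ).continuousOn).mul (gw_cont x0 τ).continuousOn) ?_
      ((a1.add a2).sub a3)]
    · simp [h.z0, h.z1]
    · intro x hx
      refine HasDerivAt.congr_deriv ((((h.d1 x hx).mul (h.d1 x hx)).mul (qc_dx x0 τ x)).mul (gw_dx x0 τ x)) ?_
      simp only [Pi.mul_apply]
      ring
  rw [JJ_sub (a1.add a2) a3, JJ_add a1 a2, JJ_cmul, JJ_cmul] at key
  unfold ip
  linarith

theorem Slice.I3 (h : Slice V V1 V2) (x0 τ : ℝ) (hx0 : x0 ∈ Icc (0:ℝ) 1) (hτ : 0 < τ) :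
    ip (gw x0 τ) (fun x => (x - x0) / (2 * τ) * V1 x) (fun x => (x - x0) / (2 * τ) * V1 x) ≤
      1 / (2 * τ) * ip (gw x0 τ) V1 V1
      + 2 * ip (gw x0 τ) V2 (fun x => (x - x0) / (2 * τ) * V1 x) := by
  have g1 := Gd.of_cont h.c1
  have gc := qc_gd x0 τ
  have gq := (qc_gd x0 τ).mul g1
  have gG := gw_gd x0 τ
  have a1 := ((g1.mul g1).mul gG).cmul (1 / (2 * τ))
  have a2 := ((h.g2.mul gq).mul gG).cmul 2
  have a3 := (gq.mul gq).mul gG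
  have key : 0 ≤ JJ (fun x => 1 / (2 * τ) * (V1 x * V1 x * gw x0 τ x) +
      2 * (V2 x * ((x - x0) / (2 * τ) * V1 x) * gw x0 τ x) -
      ((x - x0) / (2 * τ) * V1 x) * ((x - x0) / (2 * τ) * V1 x) * gw x0 τ x) := by
    rw [JJ_ftc (F := fun x => V1 x * V1 x * ((x - x0) / (2 * τ)) * gw x0 τ x)
      (((h.c1.mul h.c1).mul (qc_cont x0 τ).continuousOn).mul (gw_cont x0 τ).continuousOn) ?_
      ((a1.add a2).sub a3)]
    · have e1 : 0 ≤ V1 1 * V1 1 * ((1 - x0) / (2 * τ)) * gw x0 τ 1 := by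
        have := hx0.2
        have h1 : 0 ≤ (1 - x0) / (2 * τ) := div_nonneg (by linarith) (by linarith)
        exact mul_nonneg (mul_nonneg (mul_self_nonneg _) h1) (gw_pos _ _ _).le
      have e2 : 0 ≤ V1 0 * V1 0 * (-((0 - x0) / (2 * τ))) * gw x0 τ 0 := by
        have := hx0.1
        have h1 : 0 ≤ -((0 - x0) / (2 * τ)) := by
          rw [← neg_div]; exact div_nonneg (by linarith) (by linarith)
        exact mul_nonneg (mul_nonneg (mul_self_nonneg _) h1) (gw_pos _ _ _).le
      linarith
    · intro x hx
      refine HasDerivAt.congr_deriv ((((h.d2 x hx).mul (h.d2 x hx)).mul (qc_dx x0 τ x)).mul (gw_dx x0 τ x)) ?_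
      simp only [Pi.mul_apply]
      ring
  rw [JJ_sub (a1.add a2) a3, JJ_add a1 a2, JJ_cmul, JJ_cmul] at key
  unfold ip
  linarith
end


/-- the normal form -/
structure NF (v vx vxx vt : ℝ → ℝ → ℝ) (S C : ℝ) : Prop where
  S0 : 0 < S
  C1 : 1 ≤ C
  c0 : ∀ t ∈ Ioo 0 S, ContinuousOn (fun x => v x t) (Icc 0 1)
  c1 : ∀ t ∈ Ioo 0 S, ContinuousOn (fun x => vx x t) (Icc 0 1)
  c2 : ∀ t ∈ Ioo 0 S, ContinuousOn (fun x => vxx x t) (Ioo 0 1)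
  d1 : ∀ t ∈ Ioo 0 S, ∀ x ∈ Ioo (0:ℝ) 1, HasDerivAt (fun x => v x t) (vx x t) x
  d2 : ∀ t ∈ Ioo 0 S, ∀ x ∈ Ioo (0:ℝ) 1, HasDerivAt (fun x => vx x t) (vxx x t) x
  dt : ∀ t ∈ Ioo 0 S, ∀ x ∈ Ioo (0:ℝ) 1, HasDerivAt (fun t => v x t) (vt x t) t
  e1 : ∀ t ∈ Ioo 0 S, ∀ x ∈ Ioo (0:ℝ) 1, ContinuousAt (fun t => vx x t) t
  e2 : ∀ t ∈ Ioo 0 S, ∀ x ∈ Ioo (0:ℝ) 1, ContinuousAt (fun t => vxx x t) t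
  b0 : ∀ t ∈ Ioo 0 S, ∀ x ∈ Icc (0:ℝ) 1, |v x t| ≤ C
  b1 : ∀ t ∈ Ioo 0 S, ∀ x ∈ Icc (0:ℝ) 1, |vx x t| ≤ C
  b2 : ∀ t ∈ Ioo 0 S, ∀ x ∈ Ioo (0:ℝ) 1, |vxx x t| ≤ C
  bt : ∀ t ∈ Ioo 0 S, ∀ x ∈ Ioo (0:ℝ) 1, |vt x t| ≤ C
  eq : ∀ t ∈ Ioo 0 S, ∀ x ∈ Ioo (0:ℝ) 1, |vt x t - vxx x t| ≤ C * (|v x t| + |vx x t|)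
  z0 : ∀ t ∈ Ioo 0 S, v 0 t = 0
  z1 : ∀ t ∈ Ioo 0 S, v 1 t = 0
  nz : ∀ t ∈ Ioo 0 S, ∃ x ∈ Ioo (0:ℝ) 1, v x t ≠ 0

section
variable {v vx vxx vt : ℝ → ℝ → ℝ} {S C : ℝ}

theorem NF.slice (h : NF v vx vxx vt S C) {t : ℝ} (ht : t ∈ Ioo 0 S) :
    Slice (fun x => v x t) (fun x => vx x t) (fun x => vxx x t) :=
  ⟨h.c0 t ht, h.c1 t ht, Gd.of_contIoo (h.c2 t ht) C (h.b2 t ht), h.d1 t ht, h.d2 t ht,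
    h.z0 t ht, h.z1 t ht⟩

theorem NF.g0 (h : NF v vx vxx vt S C) {t : ℝ} (ht : t ∈ Ioo 0 S) : Gd (fun x => v x t) :=
  Gd.of_cont (h.c0 t ht)
theorem NF.g1 (h : NF v vx vxx vt S C) {t : ℝ} (ht : t ∈ Ioo 0 S) : Gd (fun x => vx x t) :=
  Gd.of_cont (h.c1 t ht)
theorem NF.g2 (h : NF v vx vxx vt S C) {t : ℝ} (ht : t ∈ Ioo 0 S) : Gd (fun x => vxx x t) :=
  (h.slice ht).g2
theorem NF.gt (h : NF v vx vxx vt S C) {t : ℝ} (ht : t ∈ Ioo 0 S) : Gd (fun x => vt x t) :=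
  Gd.of_deriv (F := v) (t := t) (M := C)
    (by filter_upwards [isOpen_Ioo.mem_nhds ht] with s hs using (h.g0 hs).1)
    (h.dt t ht) (h.bt t ht)

/-- weighted mass -/
noncomputable def HH (v : ℝ → ℝ → ℝ) (x0 tp t : ℝ) : ℝ :=
  ip (gw x0 (tp - t)) (fun x => v x t) (fun x => v x t)

theorem abs_qc_le {x0 x τ d : ℝ} (hx0 : x0 ∈ Icc (0:ℝ) 1) (hx : x ∈ Ioo (0:ℝ) 1) (hd : 0 < d)
    (hτ : d ≤ 2 * τ) : |(x - x0) / (2 * τ)| ≤ 1 / d := by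
  rw [abs_div, abs_of_pos (show 0 < 2 * τ by linarith)]
  have : |x - x0| ≤ 1 := by
    rw [abs_le]; constructor <;> linarith [hx0.1, hx0.2, hx.1, hx.2]
  exact div_le_div₀ zero_le_one this hd hτ

theorem abs_gw {x0 τ x : ℝ} (hτ : 0 ≤ τ) : |gw x0 τ x| ≤ 1 := by
  rw [abs_of_pos (gw_pos _ _ _)]; exact gw_le_one hτ

theorem NF.H_deriv0 (h : NF v vx vxx vt S C) {x0 tp t : ℝ} (ht : t ∈ Ioo 0 S)
    (hx0 : x0 ∈ Icc (0:ℝ) 1) (htp : t < tp) :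
    HasDerivAt (HH v x0 tp) (2 * ip (gw x0 (tp - t)) (fun x => v x t) (fun x => vt x t)
      - ip (gw x0 (tp - t)) (fun x => (x - x0) / (2 * (tp - t)) * v x t)
        (fun x => (x - x0) / (2 * (tp - t)) * v x t)) t := by
  have hC := h.C1
  have gG := gw_gd x0 (tp - t)
  have gq := (qc_gd x0 (tp - t)).mul (h.g0 ht)
  have key := JJ_hasDerivAt (F := fun x s => v x s * v x s * gw x0 (tp - s) x)
    (F' := fun x s => 2 * (v x s * vt x s * gw x0 (tp - s) x) -
      ((x - x0) / (2 * (tp - s)) * v x s) * ((x - x0) / (2 * (tp - s)) * v x s) *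
        gw x0 (tp - s) x)
    (M := 2 * (C * C * 1) + ((1 / (tp - t) * C) * (1 / (tp - t) * C)) * 1)
    (s := Ioo 0 (min S ((t + tp) / 2))) (t := t)
    (Ioo_mem_nhds ht.1 (lt_min ht.2 (by linarith))) ?_ ?_ ?_
  · rw [JJ_sub ((((h.g0 ht).mul (h.gt ht)).mul gG).cmul 2) ((gq.mul gq).mul gG), JJ_cmul] at key
    exact key
  · intro r hr
    have hr' : r ∈ Ioo 0 S := ⟨hr.1, hr.2.trans_le (min_le_left _ _)⟩
    exact ((h.g0 hr').mul (h.g0 hr')).mul (gw_gd _ _)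
  · intro x hx r hr
    have hr' : r ∈ Ioo 0 S := ⟨hr.1, hr.2.trans_le (min_le_left _ _)⟩
    have hr2 : r < (t + tp) / 2 := hr.2.trans_le (min_le_right _ _)
    have := h.dt r hr' x hx
    refine HasDerivAt.congr_deriv ((this.mul this).mul (gw_dt x0 tp x r (by linarith))) ?_
    simp only [Pi.mul_apply]; ring
  · intro x hx r hr
    have hr' : r ∈ Ioo 0 S := ⟨hr.1, hr.2.trans_le (min_le_left _ _)⟩
    have hr2 : r < (t + tp) / 2 := hr.2.trans_le (min_le_right _ _)
    have a0 := h.b0 r hr' x (Ioo_subset_Icc_self hx)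
    have at' := h.bt r hr' x hx
    have ag := abs_gw (x0 := x0) (x := x) (show 0 ≤ tp - r by linarith)
    have aq := abs_qc_le hx0 hx (show 0 < tp - t by linarith) (show tp - t ≤ 2 * (tp - r) by linarith)
    have hp : 0 ≤ 1 / (tp - t) := by
      have : 0 < tp - t := by linarith
      positivity
    refine (abs_sub _ _).trans (add_le_add ?_ ?_)
    · rw [abs_mul, abs_mul, abs_mul, abs_two]; gcongr
    · rw [abs_mul, abs_mul, abs_mul]; gcongr

theorem NF.H_deriv (h : NF v vx vxx vt S C) {x0 tp t : ℝ} (ht : t ∈ Ioo 0 S)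
    (hx0 : x0 ∈ Icc (0:ℝ) 1) (htp : t < tp) :
    HasDerivAt (HH v x0 tp) (-2 * HH vx x0 tp t
      + 2 * ip (gw x0 (tp - t)) (fun x => v x t) (fun x => vt x t - vxx x t)
      - 1 / (2 * (tp - t)) * HH v x0 tp t) t := by
  have gG := gw_gd x0 (tp - t)
  have gq := (qc_gd x0 (tp - t)).mul (h.g1 ht)
  refine (h.H_deriv0 ht hx0 htp).congr_deriv ?_
  have i1 := (h.slice ht).I1 x0 (tp - t)
  have i2 := (h.slice ht).I2 x0 (tp - t)
  rw [ip_sub_right gG (h.g0 ht) (h.g2 ht) gq] at i1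
  rw [i2, ip_sub_right gG (h.g0 ht) (h.gt ht) (h.g2 ht)]
  unfold HH
  linarith

theorem NF.D_deriv (h : NF v vx vxx vt S C) {x0 tp t : ℝ} (ht : t ∈ Ioo 0 S)
    (hx0 : x0 ∈ Icc (0:ℝ) 1) (htp : t < tp) :
    HasDerivAt (HH vx x0 tp) (-2 * ip (gw x0 (tp - t)) (fun x => vt x t)
        (fun x => vxx x t - (x - x0) / (2 * (tp - t)) * vx x t)
      - ip (gw x0 (tp - t)) (fun x => (x - x0) / (2 * (tp - t)) * vx x t)
        (fun x => (x - x0) / (2 * (tp - t)) * vx x t)) t := by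
  have hC := h.C1
  have gG := gw_gd x0 (tp - t)
  have gq := (qc_gd x0 (tp - t)).mul (h.g1 ht)
  have htt : 0 < tp - t := by linarith
  have hp : 0 ≤ 1 / (tp - t) := by positivity
  set s0 : Set ℝ := Ioo 0 (min S ((t + tp) / 2)) with hs0
  have hsn : s0 ∈ 𝓝 t := Ioo_mem_nhds ht.1 (lt_min ht.2 (by linarith))
  have hsS : ∀ r ∈ s0, r ∈ Ioo 0 S := fun r hr => ⟨hr.1, hr.2.trans_le (min_le_left _ _)⟩
  have hs2 : ∀ r ∈ s0, r < (t + tp) / 2 := fun r hr => hr.2.trans_le (min_le_right _ _)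
  -- first part
  have k1 := JJ_hasDerivAt (F := fun x s => vx x t * vx x t * gw x0 (tp - s) x)
    (F' := fun x s => -
      (((x - x0) / (2 * (tp - s)) * vx x t) * ((x - x0) / (2 * (tp - s)) * vx x t) *
        gw x0 (tp - s) x))
    (M := ((1 / (tp - t) * C) * (1 / (tp - t) * C)) * 1) (s := s0) (t := t) hsn
    (fun r hr => ((h.g1 ht).mul (h.g1 ht)).mul (gw_gd _ _))
    (by
      intro x hx r hr
      refine HasDerivAt.congr_deriv ((gw_dt x0 tp x r (by linarith [hs2 r hr])).const_mul
        (vx x t * vx x t)) ?_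
      ring)
    (by
      intro x hx r hr
      have a1 := h.b1 t ht x (Ioo_subset_Icc_self hx)
      have hr2 := hs2 r hr
      have ag := abs_gw (x0 := x0) (x := x) (show 0 ≤ tp - r by linarith)
      have aq := abs_qc_le hx0 hx (show 0 < tp - t by linarith)
        (show tp - t ≤ 2 * (tp - r) by linarith)
      rw [abs_neg, abs_mul, abs_mul, abs_mul]; gcongr)
  -- second part
  set R : ℝ → ℝ → ℝ := fun x s => (vxx x s + vxx x t) * gw x0 (tp - s) x -
    (vx x s + vx x t) * ((x - x0) / (2 * (tp - s))) * gw x0 (tp - s) x with hR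
  have gR : ∀ s ∈ s0, Gd (fun x => R x s) := fun s hs =>
    (((h.g2 (hsS s hs)).add (h.g2 ht)).mul (gw_gd _ _)).sub
      ((((h.g1 (hsS s hs)).add (h.g1 ht)).mul (qc_gd _ _)).mul (gw_gd _ _))
  have gd : ∀ s ∈ s0, Gd (fun x => v x s - v x t) := fun s hs => (h.g0 (hsS s hs)).sub (h.g0 ht)
  have e : ∀ s ∈ s0, HH vx x0 tp s = JJ (fun x => vx x t * vx x t * gw x0 (tp - s) x) -
      JJ (fun x => (v x s - v x t) * R x s) := by
    intro s hs
    have hsS' := hsS s hs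
    have A1 := ((h.g1 hsS').mul (h.g1 hsS')).mul (gw_gd x0 (tp - s))
    have A2 := ((h.g1 ht).mul (h.g1 ht)).mul (gw_gd x0 (tp - s))
    have A3 := (gd s hs).mul (gR s hs)
    have key : JJ (fun x => vx x s * vx x s * gw x0 (tp - s) x -
        vx x t * vx x t * gw x0 (tp - s) x + (v x s - v x t) * R x s) = 0 := by
      rw [JJ_ftc (F := fun x => (v x s - v x t) * (vx x s + vx x t) * gw x0 (tp - s) x)
        (((((h.c0 s hsS').sub (h.c0 t ht)).mul ((h.c1 s hsS').add (h.c1 t ht)))).mul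
          (gw_cont x0 _).continuousOn) ?_ ((A1.sub A2).add A3)]
      · simp [h.z0 s hsS', h.z0 t ht, h.z1 s hsS', h.z1 t ht]
      · intro x hx
        refine HasDerivAt.congr_deriv ((((h.d1 s hsS' x hx).sub (h.d1 t ht x hx)).mul
          ((h.d2 s hsS' x hx).add (h.d2 t ht x hx))).mul (gw_dx x0 (tp - s) x)) ?_
        simp only [Pi.mul_apply, Pi.add_apply, Pi.sub_apply, hR]; ring
    rw [JJ_add (A1.sub A2) A3, JJ_sub A1 A2] at key
    unfold HH ip
    linarith
  have k2 : HasDerivAt (fun s => JJ (fun x => (v x s - v x t) * R x s))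
      (JJ (fun x => vt x t * R x t)) t := by
    rw [hasDerivAt_iff_tendsto_slope]
    have hs' : ∀ s, slope (fun s => JJ (fun x => (v x s - v x t) * R x s)) t s =
        JJ (fun x => ((s - t)⁻¹ * (v x s - v x t)) * R x s) := by
      intro s
      rw [slope_def_field]
      have : JJ (fun x => (v x t - v x t) * R x t) = 0 := by simp [JJ]
      rw [this, sub_zero, div_eq_inv_mul, ← JJ_cmul]
      congr 1; ext x; ring
    refine Tendsto.congr (fun s => (hs' s).symm) ?_
    refine tendsto_integral_filter_of_dominated_convergence
      (fun _ => C * ((C + C) * 1 + (C + C) * (1 / (tp - t)) * 1)) ?_ ?_ ?_ ?_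
    · filter_upwards [mem_nhdsWithin_of_mem_nhds hsn] with s hs
      exact (((gd s hs).cmul _).mul (gR s hs)).1
    · filter_upwards [mem_nhdsWithin_of_mem_nhds hsn] with s hs
      filter_upwards [ae_restrict_mem measurableSet_Ioo] with x hx
      have hsS' := hsS s hs
      have a1 := h.b1 t ht x (Ioo_subset_Icc_self hx)
      have a1' := h.b1 s hsS' x (Ioo_subset_Icc_self hx)
      have a2 := h.b2 t ht x hx
      have a2' := h.b2 s hsS' x hx
      have hr2 := hs2 s hs
      have ag := abs_gw (x0 := x0) (x := x) (show 0 ≤ tp - s by linarith)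
      have aq := abs_qc_le hx0 hx (show 0 < tp - t by linarith)
        (show tp - t ≤ 2 * (tp - s) by linarith)
      rw [Real.norm_eq_abs, abs_mul]
      have m : |(s - t)⁻¹ * (v x s - v x t)| ≤ C := by
        have := (convex_Ioo (0:ℝ) S).norm_image_sub_le_of_norm_hasDerivWithin_le
          (f := fun s => v x s) (f' := fun s => vt x s) (C := C) (x := t) (y := s)
          (fun r hr => (h.dt r hr x hx).hasDerivWithinAt) (fun r hr => h.bt r hr x hx) ht hsS'
        simp only [Real.norm_eq_abs] at this
        rw [abs_mul, abs_inv]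
        by_cases hst : s = t
        · subst hst; simp; linarith
        · have : 0 < |s - t| := abs_pos.2 (sub_ne_zero.2 hst)
          rw [inv_mul_le_iff₀ this]; linarith
      have m2 : |R x s| ≤ (C + C) * 1 + (C + C) * (1 / (tp - t)) * 1 := by
        simp only [hR]
        refine (abs_sub _ _).trans (add_le_add ?_ ?_)
        · rw [abs_mul]
          have := (abs_add_le (vxx x s) (vxx x t)).trans (add_le_add a2' a2)
          gcongr
        · rw [abs_mul, abs_mul]
          have := (abs_add_le (vx x s) (vx x t)).trans (add_le_add a1' a1)
          gcongr
      gcongr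
    · exact (Gd.const _).integrable
    · filter_upwards [ae_restrict_mem measurableSet_Ioo] with x hx
      refine Tendsto.mul ?_ ?_
      · have := hasDerivAt_iff_tendsto_slope.1 (h.dt t ht x hx)
        refine this.congr fun s => ?_
        rw [slope_def_field, div_eq_inv_mul]
      · have cg : ContinuousAt (fun s => gw x0 (tp - s) x) t :=
          (gw_dt x0 tp x t (by linarith)).continuousAt
        have cq : ContinuousAt (fun s => (x - x0) / (2 * (tp - s))) t := by
          refine continuousAt_const.div (by fun_prop) (by positivity)
        have : ContinuousAt (R x) t :=
          (((h.e2 t ht x hx).add continuousAt_const).mul cg).sub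
            ((((h.e1 t ht x hx).add continuousAt_const).mul cq).mul cg)
        exact this.tendsto.mono_left nhdsWithin_le_nhds
  have k := (k1.sub k2).congr_of_eventuallyEq (f₁ := HH vx x0 tp)
    (by filter_upwards [hsn] with s hs using e s hs)
  refine k.congr_deriv ?_
  have n1 : JJ (fun x => -
      (((x - x0) / (2 * (tp - t)) * vx x t) * ((x - x0) / (2 * (tp - t)) * vx x t) *
        gw x0 (tp - t) x)) = - ip (gw x0 (tp - t)) (fun x => (x - x0) / (2 * (tp - t)) * vx x t)
        (fun x => (x - x0) / (2 * (tp - t)) * vx x t) := by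
    unfold ip
    rw [← neg_one_mul, ← JJ_cmul]; congr 1; ext x; ring
  have n2 : JJ (fun x => vt x t * R x t) = 2 * ip (gw x0 (tp - t)) (fun x => vt x t)
        (fun x => vxx x t - (x - x0) / (2 * (tp - t)) * vx x t) := by
    unfold ip
    rw [← JJ_cmul]; congr 1; ext x; simp only [hR]; ring
  rw [n1, n2]; ring
end


section
variable {v vx vxx vt : ℝ → ℝ → ℝ} {S C : ℝ}

theorem NF.Hpos (h : NF v vx vxx vt S C) {t : ℝ} (x0 tp : ℝ) (ht : t ∈ Ioo 0 S) :
    0 < HH v x0 tp t := by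
  obtain ⟨x, hx, hv⟩ := h.nz t ht
  refine JJ_pos (((h.c0 t ht).mul (h.c0 t ht)).mul (gw_cont x0 _).continuousOn)
    (fun x _ => mul_nonneg (mul_self_nonneg _) (gw_pos _ _ _).le) ⟨x, hx, ?_⟩
  exact mul_pos (mul_self_pos.2 hv) (gw_pos _ _ _)

theorem HH_nonneg (v : ℝ → ℝ → ℝ) (x0 tp t : ℝ) : 0 ≤ HH v x0 tp t :=
  ip_self_nonneg fun x => (gw_pos _ _ _).le

/-- frequency -/
noncomputable def NN (v vx : ℝ → ℝ → ℝ) (x0 tp t : ℝ) : ℝ :=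
  (tp - t) * HH vx x0 tp t / HH v x0 tp t

/-- the eigenvalue defect -/
noncomputable def ee (v vx vxx : ℝ → ℝ → ℝ) (x0 tp t x : ℝ) : ℝ :=
  vxx x t - (x - x0) / (2 * (tp - t)) * vx x t + HH vx x0 tp t / HH v x0 tp t * v x t

/-- monotone quantity -/
noncomputable def PS (v vx : ℝ → ℝ → ℝ) (S C x0 tp t : ℝ) : ℝ :=
  Real.exp (2 * C ^ 2 * (tp - t)) * (NN v vx x0 tp t + S)

noncomputable def EE (v vx vxx : ℝ → ℝ → ℝ) (x0 tp t : ℝ) : ℝ :=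
  ip (gw x0 (tp - t)) (ee v vx vxx x0 tp t) (ee v vx vxx x0 tp t)

theorem NF.gee (h : NF v vx vxx vt S C) {t : ℝ} (x0 tp : ℝ) (ht : t ∈ Ioo 0 S) :
    Gd (ee v vx vxx x0 tp t) :=
  ((h.g2 ht).sub ((qc_gd x0 _).mul (h.g1 ht))).add ((h.g0 ht).cmul _)

theorem NF.NN_nonneg (h : NF v vx vxx vt S C) {t : ℝ} (x0 tp : ℝ) (ht : t ∈ Ioo 0 S)
    (htp : t < tp) : 0 ≤ NN v vx x0 tp t :=
  div_nonneg (mul_nonneg (by linarith) (HH_nonneg _ _ _ _)) (HH_nonneg _ _ _ _)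

theorem NF.F_le (h : NF v vx vxx vt S C) {t : ℝ} (x0 tp : ℝ) (ht : t ∈ Ioo 0 S) :
    ip (gw x0 (tp - t)) (fun x => vt x t - vxx x t) (fun x => vt x t - vxx x t) ≤
      2 * C ^ 2 * (HH v x0 tp t + HH vx x0 tp t) := by
  have gG := gw_gd x0 (tp - t)
  have A0 := ((h.g0 ht).mul (h.g0 ht)).mul gG
  have A1 := ((h.g1 ht).mul (h.g1 ht)).mul gG
  have gf := (h.gt ht).sub (h.g2 ht)
  have hC := h.C1
  unfold HH ip
  rw [← JJ_add A0 A1, ← JJ_cmul]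
  refine JJ_mono ((gf.mul gf).mul gG) ((A0.add A1).cmul _) ?_
  intro x hx
  have hh := h.eq t ht x hx
  have hG := gw_pos x0 (tp - t) x
  have e1 : (vt x t - vxx x t) * (vt x t - vxx x t) ≤ (C * (|v x t| + |vx x t|)) ^ 2 := by
    rw [← sq, ← sq_abs]; gcongr
  have e2 : (C * (|v x t| + |vx x t|)) ^ 2 ≤ 2 * C ^ 2 * (v x t * v x t + vx x t * vx x t) := by
    have a1 := sq_abs (v x t)
    have a2 := sq_abs (vx x t)
    have : (|v x t| + |vx x t|) ^ 2 ≤ 2 * (v x t * v x t + vx x t * vx x t) := by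
      nlinarith [sq_nonneg (|v x t| - |vx x t|)]
    rw [mul_pow]
    nlinarith [sq_nonneg C]
  calc _ ≤ (2 * C ^ 2 * (v x t * v x t + vx x t * vx x t)) * gw x0 (tp - t) x := by
        exact mul_le_mul_of_nonneg_right (e1.trans e2) hG.le
    _ = _ := by ring

theorem NF.PS_deriv (h : NF v vx vxx vt S C) {x0 tp t : ℝ} (ht : t ∈ Ioo 0 S)
    (hx0 : x0 ∈ Icc (0:ℝ) 1) (htp : t < tp) (htS : tp ≤ S) :
    ∃ P', HasDerivAt (PS v vx S C x0 tp) P' t ∧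
      P' ≤ - ((tp - t) * EE v vx vxx x0 tp t / HH v x0 tp t) := by
  have hH := h.Hpos x0 tp ht
  have hD := HH_nonneg vx x0 tp t
  have dH := h.H_deriv ht hx0 htp
  have dD := h.D_deriv ht hx0 htp
  have dτ : HasDerivAt (fun s => tp - s) (-1) t := by
    simpa using (hasDerivAt_id t).const_sub tp
  have dN := (dτ.mul dD).div dH hH.ne'
  have dE : HasDerivAt (fun s => Real.exp (2 * C ^ 2 * (tp - s)))
    (Real.exp (2 * C ^ 2 * (tp - t)) * (2 * C ^ 2 * (-1))) t := (dτ.const_mul (2 * C ^ 2)).exp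
  have dP := dE.mul (dN.add_const S)
  refine ⟨_, dP, ?_⟩
  have gG := gw_gd x0 (tp - t)
  have gG0 : ∀ x, 0 ≤ gw x0 (tp - t) x := fun x => (gw_pos _ _ _).le
  have gq := (qc_gd x0 (tp - t)).mul (h.g1 ht)
  have gL := (h.g2 ht).sub gq
  have gf := (h.gt ht).sub (h.g2 ht)
  have i1 := (h.slice ht).I1 x0 (tp - t)
  have i3 := (h.slice ht).I3 x0 (tp - t) hx0 (by linarith)
  have hE : EE v vx vxx x0 tp t = ip (gw x0 (tp - t))
      (fun x => vxx x t - (x - x0) / (2 * (tp - t)) * vx x t)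
      (fun x => vxx x t - (x - x0) / (2 * (tp - t)) * vx x t) -
      (HH vx x0 tp t) ^ 2 / HH v x0 tp t := by
    have gv := (h.g0 ht).cmul (HH vx x0 tp t / HH v x0 tp t)
    unfold EE
    unfold ee
    rw [ip_add_left gG (gL.add gv) gL gv, ip_add_right gG gL gL gv, ip_add_right gG gv gL gv,
      ip_cmul_left, ip_cmul_left, ip_cmul_right, ip_cmul_right, i1,
      ip_comm (g := fun x => v x t), i1]
    change _ + _ * - HH vx x0 tp t + (_ * - HH vx x0 tp t + _ * (_ * HH v x0 tp t)) = _
    generalize ip (gw x0 (tp - t)) (fun x => vxx x t - (x - x0) / (2 * (tp - t)) * vx x t)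
        (fun x => vxx x t - (x - x0) / (2 * (tp - t)) * vx x t) = LL
    field_simp; ring
  have hfe : ip (gw x0 (tp - t)) (fun x => vt x t - vxx x t) (ee v vx vxx x0 tp t) =
      ip (gw x0 (tp - t)) (fun x => vt x t - vxx x t)
        (fun x => vxx x t - (x - x0) / (2 * (tp - t)) * vx x t) +
      HH vx x0 tp t / HH v x0 tp t *
        ip (gw x0 (tp - t)) (fun x => v x t) (fun x => vt x t - vxx x t) := by
    have gv := (h.g0 ht).cmul (HH vx x0 tp t / HH v x0 tp t)
    unfold ee
    rw [ip_add_right gG gf gL gv, ip_cmul_right, ip_comm (f := fun x => v x t)]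
  have yo := ip_young' gG gG0 gf (h.gee x0 tp ht) one_pos
  have hF := h.F_le x0 tp ht
  have hvt : ip (gw x0 (tp - t)) (fun x => vt x t)
        (fun x => vxx x t - (x - x0) / (2 * (tp - t)) * vx x t) =
      ip (gw x0 (tp - t)) (fun x => vt x t - vxx x t)
        (fun x => vxx x t - (x - x0) / (2 * (tp - t)) * vx x t) +
      ip (gw x0 (tp - t)) (fun x => vxx x t - (x - x0) / (2 * (tp - t)) * vx x t)
        (fun x => vxx x t - (x - x0) / (2 * (tp - t)) * vx x t) +
      (ip (gw x0 (tp - t)) (fun x => vxx x t) (fun x => (x - x0) / (2 * (tp - t)) * vx x t) -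
      ip (gw x0 (tp - t)) (fun x => (x - x0) / (2 * (tp - t)) * vx x t)
        (fun x => (x - x0) / (2 * (tp - t)) * vx x t)) := by
    rw [← ip_sub_left gG gq (h.g2 ht) gq,
      ip_comm (g := fun x => (x - x0) / (2 * (tp - t)) * vx x t), ← ip_add_left gG gL gf gL,
      ← ip_add_left gG gL (gf.add gL) gq]
    congr 1; ext x; ring
  have i3' : ip (gw x0 (tp - t)) (fun x => vx x t) (fun x => vx x t) = HH vx x0 tp t := rfl
  have hEdef : EE v vx vxx x0 tp t =
    ip (gw x0 (tp - t)) (ee v vx vxx x0 tp t) (ee v vx vxx x0 tp t) := rfl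
  rw [i3'] at i3
  rw [← hEdef] at yo
  rw [hvt]
  simp only [Pi.mul_apply, Pi.div_apply]
  rw [hfe] at yo
  generalize ip (gw x0 (tp - t)) (fun x => vt x t - vxx x t) (fun x => vt x t - vxx x t) = F at *
  generalize ip (gw x0 (tp - t)) (fun x => vt x t - vxx x t)
        (fun x => vxx x t - (x - x0) / (2 * (tp - t)) * vx x t) = fL at *
  generalize ip (gw x0 (tp - t)) (fun x => v x t) (fun x => vt x t - vxx x t) = vf at *
  generalize ip (gw x0 (tp - t)) (fun x => vxx x t)
    (fun x => (x - x0) / (2 * (tp - t)) * vx x t) = wq at *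
  generalize ip (gw x0 (tp - t)) (fun x => (x - x0) / (2 * (tp - t)) * vx x t)
        (fun x => (x - x0) / (2 * (tp - t)) * vx x t) = qq at *
  generalize ip (gw x0 (tp - t)) (fun x => vxx x t - (x - x0) / (2 * (tp - t)) * vx x t)
        (fun x => vxx x t - (x - x0) / (2 * (tp - t)) * vx x t) = LL at *
  have hE0 : 0 ≤ EE v vx vxx x0 tp t := ip_self_nonneg gG0
  generalize EE v vx vxx x0 tp t = E at *
  clear dH dD dN dP i3' hEdef hfe hvt i1
  generalize HH v x0 tp t = H at *
  generalize HH vx x0 tp t = D at *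
  have hτ : 0 < tp - t := by linarith
  have hτS : tp - t ≤ S := by linarith [ht.1]
  have hx1 : 1 ≤ Real.exp (2 * C ^ 2 * (tp - t)) := Real.one_le_exp (by positivity)
  generalize Real.exp (2 * C ^ 2 * (tp - t)) = X at *
  generalize tp - t = τ at *
  have hr : D = (D / H) * H := by field_simp
  have hτr : τ * D / H = τ * (D / H) := by ring
  have key : (((-1 * D + τ * (-2 * (fL + LL + (wq - qq)) - qq)) * H -
      τ * D * (-2 * D + 2 * vf - 1 / (2 * τ) * H)) / H ^ 2) ≤
      -(τ * E / H) + 2 * C ^ 2 * (τ * (D / H) + S) := by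
    have e0 : (((-1 * D + τ * (-2 * (fL + LL + (wq - qq)) - qq)) * H -
      τ * D * (-2 * D + 2 * vf - 1 / (2 * τ) * H)) / H ^ 2) =
      ((-D / 2 + τ * (qq - 2 * wq)) - 2 * τ * (fL + D / H * vf) - 2 * τ * (LL - D ^ 2 / H)) / H := by
      field_simp; ring
    have e1 : -(τ * E / H) + 2 * C ^ 2 * (τ * (D / H) + S) =
      (-(τ * E) + 2 * C ^ 2 * (τ * D + S * H)) / H := by field_simp
    rw [e0, e1, ← hE]
    apply div_le_div_of_nonneg_right _ hH.le
    have i3' : τ * qq ≤ τ * (1 / (2 * τ) * D + 2 * wq) := mul_le_mul_of_nonneg_left i3 hτ.le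
    have i3'' : τ * (1 / (2 * τ) * D + 2 * wq) = D / 2 + 2 * τ * wq := by field_simp
    have y2 : τ * (-(2 * (fL + D / H * vf))) ≤ τ * (1 * F + 1⁻¹ * E) :=
      mul_le_mul_of_nonneg_left yo hτ.le
    have y3 : τ * F ≤ τ * (2 * C ^ 2 * (H + D)) := mul_le_mul_of_nonneg_left hF hτ.le
    have y4 : 2 * C ^ 2 * H * τ ≤ 2 * C ^ 2 * H * S :=
      mul_le_mul_of_nonneg_left hτS (by positivity)
    rw [inv_one] at y2
    nlinarith
  have hτE : 0 ≤ τ * E / H := by positivity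
  rw [hτr]
  calc _ = X * ((((-1 * D + τ * (-2 * (fL + LL + (wq - qq)) - qq)) * H -
      τ * D * (-2 * D + 2 * vf - 1 / (2 * τ) * H)) / H ^ 2) - 2 * C ^ 2 * (τ * (D / H) + S)) := by
        ring
    _ ≤ X * (-(τ * E / H)) := by
        apply mul_le_mul_of_nonneg_left _ (by linarith)
        linarith
    _ ≤ _ := by nlinarith
end


section
variable {v vx vxx vt : ℝ → ℝ → ℝ} {S C : ℝ}

theorem NF.EE_nonneg (v vx vxx : ℝ → ℝ → ℝ) (x0 tp t : ℝ) : 0 ≤ EE v vx vxx x0 tp t :=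
  ip_self_nonneg fun x => (gw_pos _ _ _).le

theorem NF.PS_anti (h : NF v vx vxx vt S C) {x0 tp : ℝ}
    (hx0 : x0 ∈ Icc (0:ℝ) 1) (htS : tp < S) : AntitoneOn (PS v vx S C x0 tp) (Ioo 0 tp) := by
  have key : ∀ t ∈ Ioo 0 tp, ∃ P', HasDerivAt (PS v vx S C x0 tp) P' t ∧ P' ≤ 0 := by
    intro t ht
    have ht' : t ∈ Ioo 0 S := ⟨ht.1, ht.2.trans htS⟩
    obtain ⟨P', h1, h2⟩ := h.PS_deriv ht' hx0 ht.2 htS.le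
    refine ⟨P', h1, h2.trans ?_⟩
    have a1 := NF.EE_nonneg v vx vxx x0 tp t
    have a2 := h.Hpos x0 tp ht'
    have a3 : 0 ≤ tp - t := by linarith [ht.2]
    rw [neg_nonpos]; positivity
  refine antitoneOn_of_deriv_nonpos (convex_Ioo _ _) ?_ ?_ ?_
  · intro t ht
    obtain ⟨P', h1, _⟩ := key t ht
    exact h1.continuousAt.continuousWithinAt
  · rw [interior_Ioo]; intro t ht
    obtain ⟨P', h1, _⟩ := key t ht
    exact h1.differentiableAt.differentiableWithinAt
  · rw [interior_Ioo]; intro t ht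
    obtain ⟨P', h1, h2⟩ := key t ht
    rw [h1.deriv]; exact h2

/-- MVT up to the boundary -/
theorem mvt_abs {f f' : ℝ → ℝ} {B x y : ℝ} (hc : ContinuousOn f (Icc 0 1))
    (hd : ∀ x ∈ Ioo (0:ℝ) 1, HasDerivAt f (f' x) x)
    (hx : x ∈ Icc (0:ℝ) 1) (hy : y ∈ Icc (0:ℝ) 1)
    (hB : ∀ z ∈ Ioo (0:ℝ) 1, z ∈ uIcc x y → |f' z| ≤ B) : |f y - f x| ≤ B * |y - x| := by
  wlog hxy : x ≤ y generalizing x y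
  · have := this hy hx (fun z hz hz' => hB z hz (uIcc_comm x y ▸ hz')) (le_of_not_ge hxy)
    rwa [abs_sub_comm, abs_sub_comm y]
  rcases hxy.eq_or_lt with rfl | hlt
  · simp
  have hsub : Ioo x y ⊆ Ioo 0 1 := fun z hz => ⟨hx.1.trans_lt hz.1, hz.2.trans_le hy.2⟩
  obtain ⟨z, hz, hz2⟩ := exists_hasDerivAt_eq_slope f f' hlt
    (hc.mono (Icc_subset_Icc hx.1 hy.2)) (fun z hz => hd z (hsub hz))
  have hp : 0 < y - x := by linarith
  have e : f y - f x = f' z * (y - x) := by rw [hz2]; field_simp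
  rw [e, abs_mul]
  have := hB z (hsub hz) (by rw [uIcc_of_le hxy]; exact Ioo_subset_Icc_self hz)
  gcongr

theorem NF.quad (h : NF v vx vxx vt S C) {x0 tp t x : ℝ} (hx0 : x0 ∈ Icc (0:ℝ) 1)
    (htp : tp ∈ Ioo 0 S) (h0 : v x0 tp = 0) (h1 : vx x0 tp = 0) (ht : t ∈ Ioo 0 S) (htt : t < tp)
    (hx : x ∈ Ioo (0:ℝ) 1) : |v x t| ≤ C * ((x - x0) ^ 2 + (tp - t)) := by
  have hC := h.C1
  have a1 : ∀ y ∈ Icc (0:ℝ) 1, |vx y tp| ≤ C * |y - x0| := by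
    intro y hy
    have := mvt_abs (h.c1 tp htp) (h.d2 tp htp) hx0 hy (fun z hz _ => h.b2 tp htp z hz)
    simpa [h1] using this
  have a0 : |v x tp| ≤ (C * |x - x0|) * |x - x0| := by
    have := mvt_abs (B := C * |x - x0|) (h.c0 tp htp) (h.d1 tp htp) hx0 (Ioo_subset_Icc_self hx)
      (fun z hz hz' => (a1 z (Ioo_subset_Icc_self hz)).trans (by
        have := abs_sub_left_of_mem_uIcc hz'
        gcongr))
    simpa [h0] using this
  have a2 : |v x t - v x tp| ≤ C * (tp - t) := by
    have := (convex_Ioo (0:ℝ) S).norm_image_sub_le_of_norm_hasDerivWithin_le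
          (f := fun s => v x s) (f' := fun s => vt x s) (C := C) (x := tp) (y := t)
          (fun r hr => (h.dt r hr x hx).hasDerivWithinAt) (fun r hr => h.bt r hr x hx) htp ht
    simp only [Real.norm_eq_abs] at this
    rwa [abs_sub_comm t tp, abs_of_pos (show 0 < tp - t by linarith)] at this
  have a3 : |v x t| ≤ |v x t - v x tp| + |v x tp| := by
    have := abs_add_le (v x t - v x tp) (v x tp)
    simpa using this
  have a4 : C * |x - x0| * |x - x0| = C * (x - x0) ^ 2 := by rw [mul_assoc, ← sq, sq_abs]
  nlinarith

theorem NF.H_upper (h : NF v vx vxx vt S C) {x0 tp t : ℝ} (hx0 : x0 ∈ Icc (0:ℝ) 1)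
    (htp : tp ∈ Ioo 0 S) (h0 : v x0 tp = 0) (h1 : vx x0 tp = 0) (ht : t ∈ Ioo 0 S) (htt : t < tp) :
    HH v x0 tp t ≤ 64 * C ^ 2 * (tp - t) ^ 2 := by
  have hC := h.C1
  have hτ : 0 < tp - t := by linarith
  rw [← JJ_const (64 * C ^ 2 * (tp - t) ^ 2)]
  refine JJ_mono (((h.g0 ht).mul (h.g0 ht)).mul (gw_gd _ _)) (Gd.const _) ?_
  intro x hx
  have q := h.quad hx0 htp h0 h1 ht htt hx
  set τ := tp - t with hτd
  have e1 : v x t * v x t ≤ (C * ((x - x0) ^ 2 + τ)) ^ 2 := by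
    rw [← sq, ← sq_abs]; gcongr
  set y := (x - x0) ^ 2 / τ with hy
  have hy0 : 0 ≤ y := by positivity
  have e2 : (x - x0) ^ 2 = y * τ := by rw [hy]; field_simp
  have e3 : gw x0 τ x = (Real.exp (y / 8) ^ 2)⁻¹ := by
    rw [← Real.exp_nat_mul, ← Real.exp_neg]
    unfold gw
    congr 1
    rw [e2]; field_simp; norm_num; ring
  have e4 : 1 + y / 8 ≤ Real.exp (y / 8) := by linarith [Real.add_one_le_exp (y / 8)]
  have e5 : (1 + y) ^ 2 ≤ 64 * Real.exp (y / 8) ^ 2 := by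
    have : 1 + y ≤ 8 * Real.exp (y / 8) := by linarith
    calc (1 + y) ^ 2 ≤ (8 * Real.exp (y / 8)) ^ 2 := by gcongr
      _ = _ := by ring
  have e6 : (C * ((x - x0) ^ 2 + τ)) ^ 2 = C ^ 2 * τ ^ 2 * (1 + y) ^ 2 := by rw [e2]; ring
  rw [e6] at e1
  change v x t * v x t * gw x0 τ x ≤ _
  rw [e3]
  have hp : 0 < Real.exp (y / 8) ^ 2 := by positivity
  rw [mul_inv_le_iff₀ hp]
  refine e1.trans ?_
  have : C ^ 2 * τ ^ 2 * (1 + y) ^ 2 ≤ C ^ 2 * τ ^ 2 * (64 * Real.exp (y / 8) ^ 2) := by gcongr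
  linarith

theorem NF.N_lower (h : NF v vx vxx vt S C) {x0 tp : ℝ} (hx0 : x0 ∈ Icc (0:ℝ) 1)
    (htp : tp ∈ Ioo 0 S) (h0 : v x0 tp = 0) (h1 : vx x0 tp = 0) :
    ∃ t0 ∈ Ioo 0 tp, ∀ t ∈ Ioo t0 tp, 7/10 ≤ NN v vx x0 tp t := by
  have hC := h.C1
  have hS := h.S0
  -- small interval
  obtain ⟨t1, ht1, hexp⟩ : ∃ t1 ∈ Ioo 0 tp, ∀ t ∈ Ioo t1 tp,
      Real.exp (2 * C ^ 2 * (tp - t)) * (7/10 + S) < 72/100 + S := by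
    have hc : ContinuousAt (fun t => Real.exp (2 * C ^ 2 * (tp - t)) * (7/10 + S)) tp := by fun_prop
    have := hc.eventually (gt_mem_nhds (show Real.exp (2 * C ^ 2 * (tp - tp)) * (7/10 + S) <
      72/100 + S by simp; linarith))
    obtain ⟨l, hl, hl2⟩ := (mem_nhdsLE_iff_exists_mem_Ico_Ioc_subset (a := tp) htp.1).1
        (mem_nhdsWithin_of_mem_nhds this)
    refine ⟨(l + tp) / 2, ⟨by linarith [hl.1, htp.1], by linarith [hl.2]⟩, fun t ht => hl2
      ⟨?_, ht.2.le⟩⟩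
    linarith [ht.1, hl.2]
  by_contra hcon
  push Not at hcon
  obtain ⟨t2, ht2, hN2⟩ := hcon t1 ht1
  have ht2' : t2 ∈ Ioo 0 tp := ⟨ht1.1.trans ht2.1, ht2.2⟩
  have hN : ∀ s ∈ Ico t2 tp, NN v vx x0 tp s ≤ 72/100 := by
    intro s hs
    have a := h.PS_anti hx0 htp.2 ht2' ⟨ht2'.1.trans_le hs.1, hs.2⟩ hs.1
    have b := hexp t2 ht2
    unfold PS at a
    have n0 := h.NN_nonneg x0 tp (t := s) ⟨ht2'.1.trans_le hs.1, hs.2.trans htp.2⟩ hs.2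
    have x1 : 1 ≤ Real.exp (2 * C ^ 2 * (tp - s)) :=
      Real.one_le_exp (mul_nonneg (by positivity) (by linarith [hs.2]))
    have x2 := Real.exp_pos (2 * C ^ 2 * (tp - t2))
    nlinarith
  set B := 200 * C ^ 2 + 1/100 with hB
  set ψ : ℝ → ℝ := fun s => Real.log (HH v x0 tp s) - 195/100 * Real.log (tp - s) + B * s with hψ
  have hd : ∀ s ∈ Ico t2 tp, ∃ P, HasDerivAt ψ P s ∧ 0 ≤ P := by
    intro s hs
    have hs' : s ∈ Ioo 0 S := ⟨ht2'.1.trans_le hs.1, hs.2.trans htp.2⟩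
    have hH := h.Hpos x0 tp hs'
    have hτ : 0 < tp - s := by linarith [hs.2]
    have dH := (h.H_deriv hs' hx0 hs.2).log hH.ne'
    have dτ : HasDerivAt (fun s => tp - s) (-1) s := by
      simpa using (hasDerivAt_id s).const_sub tp
    have dl := (dτ.log hτ.ne').const_mul (195/100)
    refine ⟨_, (dH.sub dl).add ((hasDerivAt_id s).const_mul B), ?_⟩
    have yo := ip_young' (gw_gd x0 (tp - s)) (fun x => (gw_pos _ _ _).le) (h.g0 hs')
      ((h.gt hs').sub (h.g2 hs')) (c := 200 * C ^ 2) (by positivity)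
    have hF := h.F_le x0 tp hs'
    have hn := hN s hs
    unfold NN at hn
    rw [div_le_iff₀ hH] at hn
    have hHH : ip (gw x0 (tp - s)) (fun x => v x s) (fun x => v x s) = HH v x0 tp s := rfl
    rw [hHH] at yo
    generalize ip (gw x0 (tp - s)) (fun x => v x s) (fun x => vt x s - vxx x s) = vf at *
    generalize ip (gw x0 (tp - s)) (fun x => vt x s - vxx x s) (fun x => vt x s - vxx x s) = F at *
    clear dH dl dτ hHH
    generalize HH v x0 tp s = H at *
    generalize HH vx x0 tp s = D at *
    generalize tp - s = τ at *
    have e1 : (200 * C ^ 2)⁻¹ * F ≤ 1/100 * (H + D) := by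
      rw [inv_mul_le_iff₀ (by positivity)]; linarith
    have e2 : (-2 * D + 2 * vf - 1 / (2 * τ) * H) / H - 195 / 100 * (-1 / τ) + B * 1 =
      (τ * (-2 * D + 2 * vf) - 1 / 2 * H + 195/100 * H + B * τ * H) / (τ * H) := by
      field_simp; ring
    rw [e2]
    apply div_nonneg _ (by positivity)
    have e3 : τ * (-(2 * vf)) ≤ τ * (200 * C ^ 2 * H + 1/100 * (H + D)) :=
      mul_le_mul_of_nonneg_left (by linarith) hτ.le
    rw [hB]
    nlinarith
  have hmono : ∀ s ∈ Ico t2 tp, ψ t2 ≤ ψ s := by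
    have : MonotoneOn ψ (Ico t2 tp) := by
      refine monotoneOn_of_deriv_nonneg (convex_Ico _ _) ?_ ?_ ?_
      · intro t ht
        obtain ⟨P', h1, _⟩ := hd t ht
        exact h1.continuousAt.continuousWithinAt
      · rw [interior_Ico]; intro t ht
        obtain ⟨P', h1, _⟩ := hd t (Ioo_subset_Ico_self ht)
        exact h1.differentiableAt.differentiableWithinAt
      · rw [interior_Ico]; intro t ht
        obtain ⟨P', h1, h2⟩ := hd t (Ioo_subset_Ico_self ht)
        rw [h1.deriv]; exact h2
    intro s hs
    exact this ⟨le_rfl, ht2'.2⟩ hs hs.1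
  -- contradiction
  have hbd : ∀ s ∈ Ico t2 tp, ψ t2 - Real.log (64 * C ^ 2) - |B * tp| ≤ 5/100 * Real.log (tp - s) := by
    intro s hs
    have hs' : s ∈ Ioo 0 S := ⟨ht2'.1.trans_le hs.1, hs.2.trans htp.2⟩
    have hH := h.Hpos x0 tp hs'
    have hτ : 0 < tp - s := by linarith [hs.2]
    have u := h.H_upper hx0 htp h0 h1 hs' hs.2
    have l := Real.log_le_log hH u
    rw [Real.log_mul (by positivity) (by positivity), Real.log_pow] at l
    push_cast at l
    have m := hmono s hs
    have hb : B * s ≤ |B * tp| := by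
      refine le_trans ?_ (le_abs_self _)
      have : 0 ≤ B := by positivity
      exact mul_le_mul_of_nonneg_left hs.2.le this
    have m' : ψ t2 ≤ Real.log (HH v x0 tp s) - 195/100 * Real.log (tp - s) + B * s := m
    linarith
  have hlim : Tendsto (fun s => 5/100 * Real.log (tp - s)) (𝓝[<] tp) atBot := by
    refine Tendsto.const_mul_atBot (by norm_num) ?_
    refine Real.tendsto_log_nhdsGT_zero.comp ?_
    refine tendsto_nhdsWithin_iff.2 ⟨?_, ?_⟩
    · have : Tendsto (fun s => tp - s) (𝓝 tp) (𝓝 (tp - tp)) := by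
        apply Continuous.tendsto; fun_prop
      rw [sub_self] at this
      exact this.mono_left nhdsWithin_le_nhds
    · filter_upwards [self_mem_nhdsWithin] with s hs using by simpa using hs
  have h3 := hlim.eventually (eventually_lt_atBot (ψ t2 - Real.log (64 * C ^ 2) - |B * tp|))
  have h4 : ∀ᶠ s in 𝓝[<] tp, s ∈ Ico t2 tp := Ico_mem_nhdsLT ht2'.2
  obtain ⟨s, hs1, hs2⟩ := (h3.and h4).exists
  exact absurd (hbd s hs2) (not_le.2 hs1)
end


section
variable {v vx vxx vt : ℝ → ℝ → ℝ} {S C : ℝ}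

theorem NF.pinch_alg (h : NF v vx vxx vt S C) {x0 tp t : ℝ} (hx0 : x0 ∈ Icc (0:ℝ) 1)
    (ht : t ∈ Ioo 0 S) (htp : t < tp) (hN : 7/10 ≤ NN v vx x0 tp t)
    (hb : (tp - t) ^ 2 * HH vxx x0 tp t ≤ 9/10000 * HH v x0 tp t) : False := by
  have hH := h.Hpos x0 tp ht
  have gG := gw_gd x0 (tp - t)
  have gG0 : ∀ x, 0 ≤ gw x0 (tp - t) x := fun x => (gw_pos _ _ _).le
  have gq := (qc_gd x0 (tp - t)).mul (h.g1 ht)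
  have hτ : 0 < tp - t := by linarith
  have hN0 : 0 < NN v vx x0 tp t := by linarith
  have i1 := (h.slice ht).I1 x0 (tp - t)
  have i3 := (h.slice ht).I3 x0 (tp - t) hx0 hτ
  rw [ip_sub_right gG (h.g0 ht) (h.g2 ht) gq] at i1
  have y1 := ip_young gG gG0 (h.g0 ht) gq (c := NN v vx x0 tp t / (tp - t)) (by positivity)
  have y2 := ip_young' gG gG0 (h.g0 ht) (h.g2 ht) (c := 3/100 / (tp - t)) (by positivity)
  have y3 := ip_young gG gG0 (h.g2 ht) gq (c := 10) (by positivity)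
  have r0 : ip (gw x0 (tp - t)) (fun x => v x t) (fun x => v x t) = HH v x0 tp t := rfl
  have r1 : ip (gw x0 (tp - t)) (fun x => vx x t) (fun x => vx x t) = HH vx x0 tp t := rfl
  have r2 : ip (gw x0 (tp - t)) (fun x => vxx x t) (fun x => vxx x t) = HH vxx x0 tp t := rfl
  rw [r0] at y1 y2
  rw [r1] at i1 i3
  rw [r2] at y2 y3
  have hNd : NN v vx x0 tp t * HH v x0 tp t = (tp - t) * HH vx x0 tp t := by
    unfold NN; field_simp
  generalize NN v vx x0 tp t = N at *
  generalize HH v x0 tp t = H at *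
  generalize HH vx x0 tp t = D at *
  generalize HH vxx x0 tp t = A at *
  generalize ip (gw x0 (tp - t)) (fun x => vxx x t)
    (fun x => (x - x0) / (2 * (tp - t)) * vx x t) = wq at *
  generalize ip (gw x0 (tp - t)) (fun x => (x - x0) / (2 * (tp - t)) * vx x t)
        (fun x => (x - x0) / (2 * (tp - t)) * vx x t) = qq at *
  generalize ip (gw x0 (tp - t)) (fun x => v x t)
        (fun x => (x - x0) / (2 * (tp - t)) * vx x t) = vq at *
  generalize ip (gw x0 (tp - t)) (fun x => v x t) (fun x => vxx x t) = vw at *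
  generalize tp - t = τ at *
  -- scale
  have s1 : N * τ * (2 * vq) ≤ N ^ 2 * H + τ ^ 2 * qq := by
    have := mul_le_mul_of_nonneg_left y1 (show 0 ≤ N * τ by positivity)
    have e : N * τ * (N / τ * H + (N / τ)⁻¹ * qq) = N ^ 2 * H + τ ^ 2 * qq := by field_simp
    linarith
  have s2 : τ * (-(2 * vw)) ≤ 3/100 * H + 100/3 * (τ ^ 2 * A) := by
    have := mul_le_mul_of_nonneg_left y2 hτ.le
    have e : τ * (3/100 / τ * H + (3/100 / τ)⁻¹ * A) = 3/100 * H + 100/3 * (τ ^ 2 * A) := by field_simp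
    linarith
  have s3 : τ ^ 2 * qq ≤ N * H / 2 + 10 * (τ ^ 2 * A) + 1/10 * (τ ^ 2 * qq) := by
    have i4 : qq ≤ 1 / (2 * τ) * D + (10 * A + 10⁻¹ * qq) := by linarith
    have := mul_le_mul_of_nonneg_left i4 (show 0 ≤ τ ^ 2 by positivity)
    have e : τ ^ 2 * (1 / (2 * τ) * D + (10 * A + 10⁻¹ * qq)) =
      τ * D / 2 + 10 * (τ ^ 2 * A) + 1/10 * (τ ^ 2 * qq) := by field_simp; ring
    rw [hNd]; linarith
  have s4 : 2 * (N * H) = 2 * τ * vq - 2 * τ * vw := by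
    rw [hNd]; linear_combination (2 * τ) * i1
  have s5 : N * (2 * (N * H)) ≤ N ^ 2 * H + τ ^ 2 * qq + N * (6/100 * H) := by
    rw [s4]
    have : N * (τ * (-(2 * vw))) ≤ N * (6/100 * H) :=
      mul_le_mul_of_nonneg_left (by linarith) hN0.le
    nlinarith
  have s6 : (9/10 * (N ^ 2 - 6/100 * N) - N/2 - 9/1000) * H ≤ 0 := by nlinarith
  have s7 : 0 < (9/10 * (N ^ 2 - 6/100 * N) - N/2 - 9/1000) := by nlinarith
  have := mul_pos s7 hH
  linarith

theorem gw_comp {x0 x1 τ h x : ℝ} (hτ : 0 < τ) (hh : 0 < h) :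
    gw x0 τ x ≤ Real.exp ((x0 - x1) ^ 2 / (4 * h)) * gw x1 (τ + h) x := by
  unfold gw
  rw [← Real.exp_add, Real.exp_le_exp]
  have : (x - x1) ^ 2 / (4 * (τ + h)) ≤ (x - x0) ^ 2 / (4 * τ) + (x0 - x1) ^ 2 / (4 * h) := by
    rw [div_add_div _ _ (by positivity) (by positivity), div_le_div_iff₀ (by positivity) (by positivity)]
    nlinarith [sq_nonneg (h * (x - x0) - τ * (x0 - x1))]
  rw [neg_div, neg_div]
  linarith

/-- moment bound -/
theorem NF.moment (h : NF v vx vxx vt S C) {x0 tp t : ℝ}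
    (ht : t ∈ Ioo 0 S) (htp : t < tp) :
    ip (gw x0 (tp - t)) (fun x => (x - x0) * v x t) (fun x => (x - x0) * v x t) ≤
      4 * (tp - t) * (1 + 4 * NN v vx x0 tp t) * HH v x0 tp t := by
  have hH := h.Hpos x0 tp ht
  have gG := gw_gd x0 (tp - t)
  have gG0 : ∀ x, 0 ≤ gw x0 (tp - t) x := fun x => (gw_pos _ _ _).le
  have hτ : 0 < tp - t := by linarith
  have i2 := (h.slice ht).I2 x0 (tp - t)
  have y := ip_young gG gG0 ((qc_gd x0 (tp - t)).mul (h.g0 ht)) (h.g1 ht) (c := 1/2) (by norm_num)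
  have e1 : ip (gw x0 (tp - t)) (fun x => (x - x0) / (2 * (tp - t)) * v x t) (fun x => vx x t) =
      ip (gw x0 (tp - t)) (fun x => v x t) (fun x => (x - x0) / (2 * (tp - t)) * vx x t) := by
    unfold ip; congr 1; ext x; ring
  have e2 : ip (gw x0 (tp - t)) (fun x => (x - x0) / (2 * (tp - t)) * v x t)
      (fun x => (x - x0) / (2 * (tp - t)) * v x t) = 1 / (4 * (tp - t) ^ 2) *
      ip (gw x0 (tp - t)) (fun x => (x - x0) * v x t) (fun x => (x - x0) * v x t) := by
    unfold ip; rw [← JJ_cmul]; congr 1; ext x; field_simp; ring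
  rw [e1] at y
  have r0 : ip (gw x0 (tp - t)) (fun x => v x t) (fun x => v x t) = HH v x0 tp t := rfl
  have r1 : ip (gw x0 (tp - t)) (fun x => vx x t) (fun x => vx x t) = HH vx x0 tp t := rfl
  rw [r0] at i2
  rw [r1] at y
  have k : ip (gw x0 (tp - t)) (fun x => (x - x0) / (2 * (tp - t)) * v x t)
      (fun x => (x - x0) / (2 * (tp - t)) * v x t) ≤
      1 / (tp - t) * HH v x0 tp t + 4 * HH vx x0 tp t := by
    have : 1 / (2 * (tp - t)) * HH v x0 tp t = 1 / 2 * (1 / (tp - t) * HH v x0 tp t) := by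
      field_simp
    rw [this] at i2
    norm_num at y
    linarith
  rw [e2] at k
  have hNd : NN v vx x0 tp t * HH v x0 tp t = (tp - t) * HH vx x0 tp t := by
    unfold NN; field_simp
  have k2 := mul_le_mul_of_nonneg_left k (show 0 ≤ 4 * (tp - t) ^ 2 by positivity)
  generalize ip (gw x0 (tp - t)) (fun x => (x - x0) * v x t) (fun x => (x - x0) * v x t) = m at *
  generalize HH v x0 tp t = H at *
  generalize HH vx x0 tp t = D at *
  generalize NN v vx x0 tp t = N at *
  generalize tp - t = τ at *
  have e3 : 4 * τ ^ 2 * (1 / (4 * τ ^ 2) * m) = m := by field_simp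
  have e4 : 4 * τ ^ 2 * (1 / τ * H + 4 * D) = 4 * τ * (H + 4 * (τ * D)) := by field_simp
  rw [e3, e4, ← hNd] at k2
  linarith

theorem NF.Hcomp (h : NF v vx vxx vt S C) {x0 t0 x1 t1 t Λ : ℝ} (ht : t ∈ Ioo 0 S)
    (h01 : t0 < t1) (hτ1 : t1 - t0 ≤ t0 - t) (hτ2 : t0 - t ≤ 2 * (t1 - t0))
    (hδ : (x0 - x1) ^ 2 ≤ t1 - t0) (hN0 : 0 ≤ Λ) (hN : NN v vx x1 t1 t ≤ Λ) :
    HH v x1 t1 t ≤ 2 * Real.exp (12 * (1 + 4 * Λ) + 1) * HH v x0 t0 t := by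
  set k := t1 - t0 with hk
  have hk0 : 0 < k := by linarith
  set c := Real.exp (12 * (1 + 4 * Λ) + 1) with hc
  have mom := h.moment (x0 := x1) (tp := t1) ht (by linarith)
  have hH := h.Hpos x1 t1 ht
  set τ := t1 - t with hτ
  have hτ3 : τ ≤ 3 * k := by linarith
  have hτp : 0 < τ := by linarith
  set R := 8 * τ * (1 + 4 * Λ) with hR
  have hRp : 0 < R := by positivity
  have pw : ∀ x, gw x1 τ x ≤ c * gw x0 (t0 - t) x + (x - x1) ^ 2 / R * gw x1 τ x := by
    intro x
    have g0 := gw_pos x0 (t0 - t) x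
    have g1 := gw_pos x1 τ x
    have hc0 : 0 < c := Real.exp_pos _
    by_cases hx : R ≤ (x - x1) ^ 2
    · have : 1 ≤ (x - x1) ^ 2 / R := by rwa [one_le_div hRp]
      nlinarith [mul_pos hc0 g0]
    · push Not at hx
      have : 1 ≤ c * gw x0 (t0 - t) x := by
        rw [hc]; unfold gw
        rw [← Real.exp_add]
        apply Real.one_le_exp
        rw [neg_div, ← sub_eq_add_neg, sub_nonneg, div_le_iff₀ (by linarith)]
        have a : (x - x0) ^ 2 ≤ 2 * (x - x1) ^ 2 + 2 * (x0 - x1) ^ 2 := by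
          nlinarith [sq_nonneg ((x - x1) + (x0 - x1))]
        have b : R ≤ 24 * k * (1 + 4 * Λ) := by
          rw [hR]; nlinarith
        have d : 4 * k * (12 * (1 + 4 * Λ) + 1) ≤ 4 * (t0 - t) * (12 * (1 + 4 * Λ) + 1) := by gcongr
        nlinarith
      have g2 := gw_le_one (x0 := x1) (x := x) hτp.le
      have : 0 ≤ (x - x1) ^ 2 / R * gw x1 τ x := by positivity
      linarith
  have gz : Gd (fun x => (x - x1) * v x t) :=
    (Gd.of_cont (by fun_prop : Continuous fun x : ℝ => x - x1).continuousOn).mul (h.g0 ht)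
  have A0 := ((h.g0 ht).mul (h.g0 ht)).mul (gw_gd x1 τ)
  have A1 := (((h.g0 ht).mul (h.g0 ht)).mul (gw_gd x0 (t0 - t))).cmul c
  have A2 := ((gz.mul gz).mul (gw_gd x1 τ)).cmul (1 / R)
  have key : HH v x1 t1 t ≤ c * HH v x0 t0 t +
      1 / R * ip (gw x1 τ) (fun x => (x - x1) * v x t) (fun x => (x - x1) * v x t) := by
    unfold HH ip
    rw [← JJ_cmul, ← JJ_cmul, ← JJ_add A1 A2]
    refine JJ_mono A0 (A1.add A2) ?_
    intro x hx
    have := mul_le_mul_of_nonneg_left (pw x) (mul_self_nonneg (v x t))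
    refine this.trans (le_of_eq ?_)
    ring
  have e : 1 / R * ip (gw x1 τ) (fun x => (x - x1) * v x t) (fun x => (x - x1) * v x t) ≤
      1 / 2 * HH v x1 t1 t := by
    have : 4 * τ * (1 + 4 * NN v vx x1 t1 t) * HH v x1 t1 t ≤ R / 2 * HH v x1 t1 t := by
      apply mul_le_mul_of_nonneg_right _ hH.le
      rw [hR]; nlinarith
    rw [one_div, inv_mul_le_iff₀ hRp]
    linarith
  linarith
end


section
variable {v vx vxx vt : ℝ → ℝ → ℝ} {S C : ℝ}

set_option maxHeartbeats 1000000 in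
theorem NF.vxx_bound (h : NF v vx vxx vt S C) {x0 t0 x1 t1 t Λ ε η : ℝ} (ht : t ∈ Ioo 0 S)
    (h01 : t0 < t1) (hτ1 : t1 - t0 ≤ t0 - t) (hτ2 : t0 - t ≤ 2 * (t1 - t0))
    (hη0 : 0 ≤ η) (hη1 : η ≤ 1) (hε : 0 < ε)
    (hδ : (x0 - x1) ^ 2 ≤ η * (t1 - t0)) (hΛ : 0 ≤ Λ)
    (hN0 : NN v vx x0 t0 t ≤ Λ) (hN1 : NN v vx x1 t1 t ≤ Λ)
    (hNN : |NN v vx x1 t1 t - NN v vx x0 t0 t| ≤ 3 * ε)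
    (hE0 : (t0 - t) * EE v vx vxx x0 t0 t / HH v x0 t0 t ≤ 4 * ε / (t1 - t0))
    (hE1 : (t1 - t) * EE v vx vxx x1 t1 t / HH v x1 t1 t ≤ 4 * ε / (t1 - t0)) :
    (t1 - t0) ^ 2 * HH vxx x0 t0 t ≤
      4 * (48 * ε * Real.exp (12 * (1 + 4 * Λ) + 1) + 8 * ε + η * Λ / 4 + 9 * ε ^ 2) *
        HH v x0 t0 t := by
  have hk : 0 < t1 - t0 := by linarith
  have hτ' : 0 < t0 - t := by linarith
  have hτ : 0 < t1 - t := by linarith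
  have hH0 := h.Hpos x0 t0 ht
  have hH1 := h.Hpos x1 t1 ht
  have gG := gw_gd x0 (t0 - t)
  have gG0 : ∀ x, 0 ≤ gw x0 (t0 - t) x := fun x => (gw_pos _ _ _).le
  have hc := h.Hcomp (x0 := x0) ht h01 hτ1 hτ2
    (hδ.trans (by nlinarith)) hΛ hN1
  set c := Real.exp (12 * (1 + 4 * Λ) + 1) with hcd
  have hc0 : 0 < c := Real.exp_pos _
  have ge0 := h.gee x0 t0 ht
  have ge1 := h.gee x1 t1 ht
  set N0 := NN v vx x0 t0 t with hN0d
  set N1 := NN v vx x1 t1 t with hN1d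
  have A0 := (ge1.mul ge1).mul gG
  have A1 := (ge0.mul ge0).mul gG
  have A2 := ((h.g1 ht).mul (h.g1 ht)).mul gG
  have A3 := ((h.g0 ht).mul (h.g0 ht)).mul gG
  have B0 := A0.cmul ((t1 - t) ^ 2)
  have B1 := A1.cmul ((t0 - t) ^ 2)
  have B2 := A2.cmul ((x0 - x1) ^ 2 / 4)
  have B3 := A3.cmul ((N1 - N0) ^ 2)
  have id1 : ∀ x, (t1 - t0) * vxx x t = (t1 - t) * ee v vx vxx x1 t1 t x -
      (t0 - t) * ee v vx vxx x0 t0 t x + (x0 - x1) / 2 * vx x t - (N1 - N0) * v x t := by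
    intro x
    simp only [ee, hN0d, hN1d, NN]
    field_simp
    ring
  have step1 : (t1 - t0) ^ 2 * HH vxx x0 t0 t ≤ 4 * ((t1 - t) ^ 2 *
      ip (gw x0 (t0 - t)) (ee v vx vxx x1 t1 t) (ee v vx vxx x1 t1 t) +
      (t0 - t) ^ 2 * EE v vx vxx x0 t0 t + (x0 - x1) ^ 2 / 4 * HH vx x0 t0 t +
      (N1 - N0) ^ 2 * HH v x0 t0 t) := by
    unfold HH EE ip
    rw [← JJ_cmul, ← JJ_cmul, ← JJ_cmul, ← JJ_cmul, ← JJ_cmul, ← JJ_add B0 B1,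
      ← JJ_add (B0.add B1) B2, ← JJ_add ((B0.add B1).add B2) B3, ← JJ_cmul]
    refine JJ_mono ((((h.g2 ht).mul (h.g2 ht)).mul gG).cmul _)
      ((((B0.add B1).add B2).add B3).cmul 4) ?_
    intro x hx
    have e := id1 x
    have hg := gG0 x
    have e' : ((t1 - t0) * vxx x t) ^ 2 ≤ 4 * (((t1 - t) * ee v vx vxx x1 t1 t x) ^ 2 +
      ((t0 - t) * ee v vx vxx x0 t0 t x) ^ 2 + ((x0 - x1) / 2 * vx x t) ^ 2 +
      ((N1 - N0) * v x t) ^ 2) := by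
      rw [e]
      generalize (t1 - t) * ee v vx vxx x1 t1 t x = p1
      generalize (t0 - t) * ee v vx vxx x0 t0 t x = p2
      generalize (x0 - x1) / 2 * vx x t = p3
      generalize (N1 - N0) * v x t = p4
      nlinarith [sq_nonneg (p1 + p2), sq_nonneg (p1 - p3), sq_nonneg (p1 + p4), sq_nonneg (p2 + p3),
        sq_nonneg (p2 - p4), sq_nonneg (p3 + p4)]
    have := mul_le_mul_of_nonneg_right e' hg
    calc _ = ((t1 - t0) * vxx x t) ^ 2 * gw x0 (t0 - t) x := by ring
      _ ≤ _ := this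
      _ = _ := by ring
  have step2 : ip (gw x0 (t0 - t)) (ee v vx vxx x1 t1 t) (ee v vx vxx x1 t1 t) ≤
      2 * EE v vx vxx x1 t1 t := by
    unfold EE ip
    rw [← JJ_cmul]
    refine JJ_mono A0 (((ge1.mul ge1).mul (gw_gd _ _)).cmul 2) ?_
    intro x hx
    have g := gw_comp (x0 := x0) (x1 := x1) (x := x) hτ' hk
    have e1 : t0 - t + (t1 - t0) = t1 - t := by ring
    rw [e1] at g
    have e2 : Real.exp ((x0 - x1) ^ 2 / (4 * (t1 - t0))) ≤ 2 := by
      have : (x0 - x1) ^ 2 / (4 * (t1 - t0)) ≤ 1/4 := by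
        rw [div_le_iff₀ (by positivity)]; nlinarith
      have h3 : Real.exp ((x0 - x1) ^ 2 / (4 * (t1 - t0))) ≤ Real.exp (1/4) := Real.exp_le_exp.2 this
      have h4 : Real.exp (1/4) ≤ 2 := by
        rw [← Real.le_log_iff_exp_le (by norm_num)]
        linarith [Real.log_two_gt_d9]
      linarith
    have e3 : gw x0 (t0 - t) x ≤ 2 * gw x1 (t1 - t) x :=
      g.trans (mul_le_mul_of_nonneg_right e2 (gw_pos _ _ _).le)
    have := mul_le_mul_of_nonneg_left e3 (mul_self_nonneg (ee v vx vxx x1 t1 t x))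
    linarith
  have hE0n := NF.EE_nonneg v vx vxx x0 t0 t
  have hE1n := NF.EE_nonneg v vx vxx x1 t1 t
  have b1 : (t1 - t) ^ 2 * EE v vx vxx x1 t1 t ≤ 12 * ε * HH v x1 t1 t := by
    rw [div_le_iff₀ hH1] at hE1
    have := mul_le_mul_of_nonneg_left hE1 hτ.le
    have e : (t1 - t) * (4 * ε / (t1 - t0) * HH v x1 t1 t) ≤ 12 * ε * HH v x1 t1 t := by
      have : (t1 - t) * (4 * ε / (t1 - t0) * HH v x1 t1 t) =
        ((t1 - t) / (t1 - t0)) * (4 * ε * HH v x1 t1 t) := by field_simp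
      rw [this]
      have h3 : (t1 - t) / (t1 - t0) ≤ 3 := by rw [div_le_iff₀ hk]; linarith
      have h4 : 0 ≤ 4 * ε * HH v x1 t1 t := by positivity
      have h5 := mul_le_mul_of_nonneg_right h3 h4
      linarith
    have e6 : (t1 - t) ^ 2 * EE v vx vxx x1 t1 t = (t1 - t) * ((t1 - t) * EE v vx vxx x1 t1 t) := by ring
    rw [e6]
    exact this.trans e
  have b0 : (t0 - t) ^ 2 * EE v vx vxx x0 t0 t ≤ 8 * ε * HH v x0 t0 t := by
    rw [div_le_iff₀ hH0] at hE0
    have := mul_le_mul_of_nonneg_left hE0 hτ'.le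
    have e : (t0 - t) * (4 * ε / (t1 - t0) * HH v x0 t0 t) ≤ 8 * ε * HH v x0 t0 t := by
      have : (t0 - t) * (4 * ε / (t1 - t0) * HH v x0 t0 t) =
        ((t0 - t) / (t1 - t0)) * (4 * ε * HH v x0 t0 t) := by field_simp
      rw [this]
      have h3 : (t0 - t) / (t1 - t0) ≤ 2 := by rw [div_le_iff₀ hk]; linarith
      have h4 : 0 ≤ 4 * ε * HH v x0 t0 t := by positivity
      have h5 := mul_le_mul_of_nonneg_right h3 h4
      linarith
    have e6 : (t0 - t) ^ 2 * EE v vx vxx x0 t0 t = (t0 - t) * ((t0 - t) * EE v vx vxx x0 t0 t) := by ring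
    rw [e6]
    exact this.trans e
  have b2 : (x0 - x1) ^ 2 / 4 * HH vx x0 t0 t ≤ η * Λ / 4 * HH v x0 t0 t := by
    have hD := HH_nonneg vx x0 t0 t
    have hNd : N0 * HH v x0 t0 t = (t0 - t) * HH vx x0 t0 t := by
      rw [hN0d]; unfold NN; field_simp
    have c1 : (x0 - x1) ^ 2 ≤ η * (t0 - t) := hδ.trans (by gcongr)
    calc (x0 - x1) ^ 2 / 4 * HH vx x0 t0 t ≤ η * (t0 - t) / 4 * HH vx x0 t0 t := by gcongr
      _ = η / 4 * (N0 * HH v x0 t0 t) := by rw [hNd]; ring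
      _ ≤ η / 4 * (Λ * HH v x0 t0 t) := by gcongr
      _ = _ := by ring
  have b3 : (N1 - N0) ^ 2 * HH v x0 t0 t ≤ 9 * ε ^ 2 * HH v x0 t0 t := by
    have : (N1 - N0) ^ 2 ≤ 9 * ε ^ 2 := by
      rw [← sq_abs]
      calc |N1 - N0| ^ 2 ≤ (3 * ε) ^ 2 := by gcongr
        _ = _ := by ring
    gcongr
  have b4 : (t1 - t) ^ 2 * ip (gw x0 (t0 - t)) (ee v vx vxx x1 t1 t) (ee v vx vxx x1 t1 t) ≤
      48 * ε * c * HH v x0 t0 t := by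
    have := mul_le_mul_of_nonneg_left step2 (sq_nonneg (t1 - t))
    have h5 : 12 * ε * HH v x1 t1 t ≤ 12 * ε * (2 * c * HH v x0 t0 t) := by gcongr
    have e6 : (t1 - t) ^ 2 * (2 * EE v vx vxx x1 t1 t) = 2 * ((t1 - t) ^ 2 * EE v vx vxx x1 t1 t) := by ring
    rw [e6] at this
    linarith
  linarith

theorem NF.N_le_PS (h : NF v vx vxx vt S C) {x0 tp t : ℝ} (ht : t ∈ Ioo 0 S) (htp : t < tp) :
    NN v vx x0 tp t ≤ PS v vx S C x0 tp t := by
  have hS := h.S0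
  have x1 : 1 ≤ Real.exp (2 * C ^ 2 * (tp - t)) :=
      Real.one_le_exp (mul_nonneg (by positivity) (by linarith))
  have := h.NN_nonneg x0 tp ht htp
  unfold PS
  nlinarith

theorem pinch_NN {X Y N0 N1 S ε q Λ : ℝ} (y1 : 1 ≤ X) (y2 : 1 ≤ Y) (y3 : Y * (1 - q) ≤ 1)
    (p1 : 0 ≤ N1) (hS : 0 < S) (hΛ : 1 ≤ Λ) (hM0 : N0 + S ≤ Λ)
    (w1 : X * Y * (N1 + S) - X * (N0 + S) ≤ 2 * ε)
    (w2 : X * (N0 + S) - X * Y * (N1 + S) ≤ 2 * ε) (hq : 0 ≤ q) (hk : Λ * q ≤ ε) (e1 : ε ≤ 1) :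
    |N1 - N0| ≤ 3 * ε := by
  have hX : 0 < X := by linarith
  have hqε : q ≤ ε := by nlinarith
  have hε0 : 0 ≤ ε := hq.trans hqε
  have u1 : Y * (N1 + S) - (N0 + S) ≤ 2 * ε := by
    by_contra hcon; push Not at hcon
    have : X * (2 * ε) < X * (Y * (N1 + S) - (N0 + S)) := mul_lt_mul_of_pos_left hcon hX
    nlinarith
  have u2 : (N0 + S) - Y * (N1 + S) ≤ 2 * ε := by
    by_contra hcon; push Not at hcon
    have : X * (2 * ε) < X * ((N0 + S) - Y * (N1 + S)) := mul_lt_mul_of_pos_left hcon hX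
    nlinarith
  have y4 : N1 + S ≤ Y * (N1 + S) := by nlinarith
  have z1 : (1 - q) * ((N0 + S) - Y * (N1 + S)) ≤ 2 * ε := by
    have := mul_le_mul_of_nonneg_left u2 (show 0 ≤ 1 - q by linarith)
    have h2 : 0 ≤ q * ε := by positivity
    linarith
  have z2 : (Y * (1 - q)) * (N1 + S) ≤ 1 * (N1 + S) := by gcongr
  have z3 : q * (N0 + S) ≤ q * Λ := by gcongr
  rw [abs_le]
  constructor
  · linarith
  · linarith

set_option maxHeartbeats 1000000 in
theorem NF.pinch (h : NF v vx vxx vt S C) {x0 t0 x1 t1 κ ε Λ : ℝ} (hx0 : x0 ∈ Icc (0:ℝ) 1)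
    (hx1 : x1 ∈ Icc (0:ℝ) 1) (h01 : t0 < t1) (hpos : 0 < t0 - 2 * (t1 - t0)) (ht1 : t1 < S)
    (hΛ : 1 ≤ Λ) (hκ0 : 0 ≤ κ) (hκ : κ + 2 * ε ≤ Λ)
    (hε : ε = 1 / 10000000 / Real.exp (12 * (1 + 4 * Λ) + 1))
    (hδ : (x0 - x1) ^ 2 ≤ 1 / 10000 / Λ * (t1 - t0))
    (hk : Λ * (2 * C ^ 2) * (t1 - t0) ≤ ε)
    (hΨ : ∀ t ∈ Icc (t0 - 2 * (t1 - t0)) (t0 - (t1 - t0)),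
      PS v vx S C x0 t0 t ∈ Icc κ (κ + 2 * ε) ∧ PS v vx S C x1 t1 t ∈ Icc κ (κ + 2 * ε) ∧
      7/10 ≤ NN v vx x0 t0 t) : False := by
  have hk0 : 0 < t1 - t0 := by linarith
  set k := t1 - t0 with hkd
  set c := Real.exp (12 * (1 + 4 * Λ) + 1) with hc
  have hc1 : 1 ≤ c := Real.one_le_exp (by linarith)
  have hε0 : 0 < ε := by rw [hε]; positivity
  have hS := h.S0
  have hd : ∀ t ∈ Icc (t0 - 2 * k) (t0 - k), ∃ P, HasDerivAt (fun t => PS v vx S C x0 t0 t +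
      PS v vx S C x1 t1 t) P t ∧ P ≤ -((t0 - t) * EE v vx vxx x0 t0 t / HH v x0 t0 t) -
      ((t1 - t) * EE v vx vxx x1 t1 t / HH v x1 t1 t) := by
    intro t ht
    have htS : t ∈ Ioo 0 S := ⟨by linarith [ht.1], by linarith [ht.2]⟩
    obtain ⟨P0, a0, b0⟩ := h.PS_deriv htS hx0 (tp := t0) (by linarith [ht.2]) (by linarith)
    obtain ⟨P1, a1, b1⟩ := h.PS_deriv htS hx1 (tp := t1) (by linarith [ht.2]) (by linarith)
    exact ⟨P0 + P1, a0.add a1, by linarith⟩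
  obtain ⟨t, ht, hts⟩ := exists_deriv_eq_slope (fun t => PS v vx S C x0 t0 t +
      PS v vx S C x1 t1 t) (show t0 - 2 * k < t0 - k by linarith)
    (fun t ht => by obtain ⟨P, a, _⟩ := hd t ht; exact a.continuousAt.continuousWithinAt)
    (fun t ht => by
      obtain ⟨P, a, _⟩ := hd t (Ioo_subset_Icc_self ht)
      exact a.differentiableAt.differentiableWithinAt)
  have ht' := Ioo_subset_Icc_self ht
  obtain ⟨P, hP1, hP2⟩ := hd t ht'
  rw [hP1.deriv] at hts
  have htS : t ∈ Ioo 0 S := ⟨by linarith [ht.1], by linarith [ht.2]⟩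
  obtain ⟨⟨l1, l2⟩, ⟨l3, l4⟩, _⟩ := hΨ (t0 - 2 * k) ⟨le_rfl, by linarith⟩
  obtain ⟨⟨r1, r2⟩, ⟨r3, r4⟩, _⟩ := hΨ (t0 - k) ⟨by linarith, le_rfl⟩
  obtain ⟨⟨m1, m2⟩, ⟨m3, m4⟩, m5⟩ := hΨ t ht'
  have hPl : -(4 * ε / k) ≤ P := by
    rw [hts, ← neg_div]
    have : t0 - k - (t0 - 2 * k) = k := by ring
    rw [this]
    apply div_le_div_of_nonneg_right _ hk0.le
    linarith
  have hH0 := h.Hpos x0 t0 htS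
  have hH1 := h.Hpos x1 t1 htS
  have hE0n := NF.EE_nonneg v vx vxx x0 t0 t
  have hE1n := NF.EE_nonneg v vx vxx x1 t1 t
  have hτ0 : 0 < t0 - t := by linarith [ht.2]
  have hτ1 : 0 < t1 - t := by linarith [ht.2]
  have q0 : 0 ≤ (t0 - t) * EE v vx vxx x0 t0 t / HH v x0 t0 t := by positivity
  have q1 : 0 ≤ (t1 - t) * EE v vx vxx x1 t1 t / HH v x1 t1 t := by positivity
  have hn0 := (h.N_le_PS htS (x0 := x0) (tp := t0) (by linarith)).trans (m2.trans hκ)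
  have hn1 := (h.N_le_PS htS (x0 := x1) (tp := t1) (by linarith)).trans (m4.trans hκ)
  have hNN : |NN v vx x1 t1 t - NN v vx x0 t0 t| ≤ 3 * ε := by
    have p0 := h.NN_nonneg x0 t0 htS (by linarith)
    have p1 := h.NN_nonneg x1 t1 htS (by linarith)
    unfold PS at m1 m2 m3 m4
    have ex : Real.exp (2 * C ^ 2 * (t1 - t)) = Real.exp (2 * C ^ 2 * (t0 - t)) *
        Real.exp (2 * C ^ 2 * k) := by rw [← Real.exp_add]; congr 1; rw [hkd]; ring
    have y1 : 1 ≤ Real.exp (2 * C ^ 2 * (t0 - t)) := Real.one_le_exp (by positivity)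
    have y2 : 1 ≤ Real.exp (2 * C ^ 2 * k) := Real.one_le_exp (by positivity)
    have y3 : Real.exp (2 * C ^ 2 * k) * (1 - 2 * C ^ 2 * k) ≤ 1 := by
      have := Real.add_one_le_exp (-(2 * C ^ 2 * k))
      rw [Real.exp_neg] at this
      have hp := Real.exp_pos (2 * C ^ 2 * k)
      calc _ ≤ Real.exp (2 * C ^ 2 * k) * (Real.exp (2 * C ^ 2 * k))⁻¹ := by
            gcongr; linarith
        _ = 1 := by field_simp
    rw [ex] at m3 m4
    have hM0 : NN v vx x0 t0 t + S ≤ Λ := by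
      have : NN v vx x0 t0 t + S ≤ Real.exp (2 * C ^ 2 * (t0 - t)) * (NN v vx x0 t0 t + S) := by
        nlinarith
      linarith
    have e1 : ε ≤ 1 := by
      rw [hε]; rw [div_le_one (by linarith)]; linarith
    exact pinch_NN y1 y2 y3 p1 hS hΛ hM0 (by linarith) (by linarith) (by positivity)
      (by linarith) e1
  have ηle : 1 / 10000 / Λ ≤ 1 := by rw [div_le_one (by linarith)]; linarith
  have vb := h.vxx_bound htS h01 (x0 := x0) (x1 := x1) (Λ := Λ) (ε := ε) (η := 1 / 10000 / Λ)
    (by linarith [ht.2]) (by linarith [ht.1]) (by positivity) ηle hε0 hδ (by linarith) hn0 hn1 hNN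
    (by linarith) (by linarith)
  refine h.pinch_alg hx0 htS (by linarith) m5 ?_
  have hA := HH_nonneg vxx x0 t0 t
  have g1 : (t0 - t) ^ 2 * HH vxx x0 t0 t ≤ 4 * (k ^ 2 * HH vxx x0 t0 t) := by
    have : (t0 - t) ^ 2 ≤ 4 * k ^ 2 := by
      have : t0 - t ≤ 2 * k := by linarith [ht.1]
      calc (t0 - t) ^ 2 ≤ (2 * k) ^ 2 := by gcongr
        _ = _ := by ring
    have := mul_le_mul_of_nonneg_right this hA
    linarith
  have εc : ε * c = 1 / 10000000 := by rw [hε]; field_simp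
  have ηΛ : 1 / 10000 / Λ * Λ = 1 / 10000 := by field_simp
  have εs : ε ≤ 1 / 10000000 := by rw [← εc]; exact le_mul_of_one_le_right hε0.le hc1
  rw [← hc] at vb
  have fin : 4 * (48 * ε * c + 8 * ε + 1 / 10000 / Λ * Λ / 4 + 9 * ε ^ 2) ≤ 9 / 40000 := by
    rw [ηΛ]
    have : ε ^ 2 ≤ ε := by nlinarith only [εs, hε0]
    have e8 : 48 * ε * c = 48 * (1 / 10000000) := by rw [← εc]; ring
    rw [e8]
    linarith
  have := mul_le_mul_of_nonneg_right fin hH0.le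
  linarith
end


theorem null_of_sq0 (A : Set (ℝ × ℝ)) (K : ℝ)
    (hA : ∀ p ∈ A, ∀ q ∈ A, |p.2 - q.2| ≤ K * (p.1 - q.1) ^ 2) :
    volume (Prod.snd '' A) = 0 := by
  classical
  have hch : ∀ x, ∃ t, x ∈ Prod.fst '' A → (x, t) ∈ A := by
    intro x
    by_cases hx : x ∈ Prod.fst '' A
    · obtain ⟨p, hp, rfl⟩ := hx
      exact ⟨p.2, fun _ => hp⟩
    · exact ⟨0, fun h => absurd h hx⟩
  choose g hg using hch
  have hsub : Prod.snd '' A ⊆ g '' (Prod.fst '' A) := by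
    rintro _ ⟨p, hp, rfl⟩
    refine ⟨p.1, mem_image_of_mem _ hp, ?_⟩
    have h1 := hA _ (hg p.1 (mem_image_of_mem _ hp)) _ hp
    simp at h1
    linarith
  refine measure_mono_null hsub ?_
  refine addHaar_image_eq_zero_of_det_fderivWithin_eq_zero volume
    (f' := fun _ => (0 : ℝ →L[ℝ] ℝ)) ?_ ?_
  · intro x hx
    have h1 : (fun y => g y - g x) =O[𝓝[Prod.fst '' A] x] fun y => ‖y - x‖ ^ 2 := by
      apply Asymptotics.IsBigO.of_bound K
      filter_upwards [self_mem_nhdsWithin] with y hy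
      have := hA _ (hg y hy) _ (hg x hx)
      simpa using this
    have h2 : HasFDerivWithinAt (fun y => g y - g x + g x) (0 : ℝ →L[ℝ] ℝ) (Prod.fst '' A) x :=
      (h1.hasFDerivWithinAt (𝕜 := ℝ) hx (by norm_num)).add_const (g x)
    simpa using h2
  · intro x hx
    simp [ContinuousLinearMap.det]

theorem null_of_sq (A : Set (ℝ × ℝ)) (K h0 : ℝ) (h0p : 0 < h0)
    (hA : ∀ p ∈ A, ∀ q ∈ A, |p.2 - q.2| < h0 → |p.2 - q.2| ≤ K * (p.1 - q.1) ^ 2) :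
    volume (Prod.snd '' A) = 0 := by
  have hU : Prod.snd '' A ⊆ ⋃ n : ℤ, Prod.snd '' {p ∈ A | ⌊p.2 / h0⌋ = n} := by
    rintro _ ⟨p, hp, rfl⟩
    exact mem_iUnion.2 ⟨⌊p.2 / h0⌋, p, ⟨hp, rfl⟩, rfl⟩
  refine measure_mono_null hU (measure_iUnion_null fun n => ?_)
  refine null_of_sq0 _ K ?_
  rintro p ⟨hp, hpn⟩ q ⟨hq, hqn⟩
  apply hA p hp q hq
  have h1 := Int.abs_sub_lt_one_of_floor_eq_floor (hpn.trans hqn.symm)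
  rw [← sub_div, abs_div, abs_of_pos h0p, div_lt_one h0p] at h1
  exact h1

section
variable {v vx vxx vt : ℝ → ℝ → ℝ} {S C : ℝ}

noncomputable def eps (Λ : ℝ) : ℝ := 1 / 10000000 / Real.exp (12 * (1 + 4 * Λ) + 1)

theorem eps_pos (Λ : ℝ) : 0 < eps Λ := by unfold eps; positivity
theorem eps_le (Λ : ℝ) (h : 0 ≤ Λ) : eps Λ ≤ 1 := by
  unfold eps
  have : 1 ≤ Real.exp (12 * (1 + 4 * Λ) + 1) := Real.one_le_exp (by linarith)
  rw [div_le_one (by linarith)]; linarith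

def DD (v vx : ℝ → ℝ → ℝ) (S : ℝ) : Set (ℝ × ℝ) :=
  {p | p.2 ∈ Ioo 0 S ∧ p.1 ∈ Icc (0:ℝ) 1 ∧ v p.1 p.2 = 0 ∧ vx p.1 p.2 = 0}

def DP (v vx : ℝ → ℝ → ℝ) (S C : ℝ) (Λ k j : ℕ) : Set (ℝ × ℝ) :=
  {p ∈ DD v vx S | (1:ℝ) ≤ Λ ∧ k * eps Λ + 2 * eps Λ ≤ Λ ∧ 1 / ((j:ℝ) + 1) < p.2 ∧
    ∀ t ∈ Ico (p.2 - 1 / ((j:ℝ) + 1)) p.2,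
      PS v vx S C p.1 p.2 t ∈ Icc (k * eps Λ) (k * eps Λ + 2 * eps Λ) ∧
      7/10 ≤ NN v vx p.1 p.2 t}

theorem NF.DP_null (h : NF v vx vxx vt S C) (Λ k j : ℕ) :
    volume (Prod.snd '' DP v vx S C Λ k j) = 0 := by
  have hC := h.C1
  have hε := eps_pos Λ
  set δ : ℝ := 1 / ((j:ℝ) + 1) with hδ
  have hδ0 : 0 < δ := by positivity
  refine null_of_sq _ (10000 * Λ) (min (δ / 3) (eps Λ / (2 * C ^ 2 * (Λ + 1)))) ?_ ?_
  · positivity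
  have key : ∀ p ∈ DP v vx S C Λ k j, ∀ q ∈ DP v vx S C Λ k j, p.2 < q.2 →
      q.2 - p.2 < (min (δ / 3) (eps Λ / (2 * C ^ 2 * (Λ + 1)))) →
      q.2 - p.2 ≤ 10000 * Λ * (p.1 - q.1) ^ 2 := by
    rintro ⟨x0, t0⟩ ⟨⟨hp1, hp2, _⟩, hΛ, hkΛ, hp3, hp4⟩ ⟨x1, t1⟩
      ⟨⟨hq1, hq2, _⟩, _, _, hq3, hq4⟩ h01 hd
    simp only at *
    by_contra hcon
    push Not at hcon
    have hd1 := hd.trans_le (min_le_left _ _)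
    have hd2 := hd.trans_le (min_le_right _ _)
    have hΛ0 : (0:ℝ) < Λ := by linarith
    refine h.pinch hp2 hq2 h01 (by linarith) hq1.2 hΛ (κ := k * eps Λ) (ε := eps Λ)
      (by positivity) hkΛ rfl ?_ ?_ ?_
    · rw [div_div, div_mul_eq_mul_div, le_div_iff₀ (by positivity)]
      linarith
    · rw [lt_div_iff₀ (by positivity)] at hd2
      have : 0 < 2 * C ^ 2 * (t1 - t0) := mul_pos (by positivity) (by linarith)
      nlinarith only [this, hd2]
    · intro t ht
      have a1 := hp4 t ⟨by linarith [ht.1], by linarith [ht.2]⟩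
      have a2 := hq4 t ⟨by linarith [ht.1], by linarith [ht.2]⟩
      exact ⟨a1.1, a2.1, a1.2⟩
  intro p hp q hq hpq
  rcases lt_trichotomy p.2 q.2 with hl | he | hg
  · rw [abs_sub_comm, abs_of_pos (by linarith)] at hpq ⊢
    exact key p hp q hq hl hpq
  · rw [he]; simp; positivity
  · rw [abs_of_pos (by linarith)] at hpq ⊢
    have := key q hq p hp hg hpq
    rwa [← neg_sub p.1 q.1, neg_sq] at this

theorem NF.DD_sub (h : NF v vx vxx vt S C) :
    DD v vx S ⊆ ⋃ Λ : ℕ, ⋃ k : ℕ, ⋃ j : ℕ, DP v vx S C Λ k j := by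
  rintro ⟨x, tp⟩ hD
  obtain ⟨h1, h2, h3, h4⟩ := id hD
  simp only at h1 h2 h3 h4
  obtain ⟨t0, ht0, hN⟩ := h.N_lower h2 h1 h3 h4
  have hanti := h.PS_anti h2 h1.2
  have hS := h.S0
  have hPS0 : ∀ t ∈ Ioo 0 tp, 0 ≤ PS v vx S C x tp t := by
    intro t ht
    have := h.NN_nonneg x tp ⟨ht.1, ht.2.trans h1.2⟩ ht.2
    unfold PS; positivity
  set L := sInf (PS v vx S C x tp '' Ioo 0 tp) with hL
  have hne : (PS v vx S C x tp '' Ioo 0 tp).Nonempty := ⟨_, _, ht0, rfl⟩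
  have hbd : BddBelow (PS v vx S C x tp '' Ioo 0 tp) :=
    ⟨0, by rintro _ ⟨t, ht, rfl⟩; exact hPS0 t ht⟩
  have hL0 : 0 ≤ L := le_csInf hne (by rintro _ ⟨t, ht, rfl⟩; exact hPS0 t ht)
  set Λ := ⌈L + 2⌉₊ with hΛ
  have hΛL : L + 2 ≤ Λ := Nat.le_ceil _
  have hε := eps_pos Λ
  have hε1 := eps_le Λ (by linarith)
  set k := ⌊L / eps Λ⌋₊ with hk
  have k1 : k * eps Λ ≤ L := by
    have := Nat.floor_le (show 0 ≤ L / eps Λ by positivity)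
    rwa [le_div_iff₀ hε] at this
  have k2 : L < k * eps Λ + 2 * eps Λ := by
    have := Nat.lt_floor_add_one (L / eps Λ)
    rw [div_lt_iff₀ hε] at this
    linarith
  obtain ⟨_, ⟨t1, ht1, rfl⟩, hlt⟩ := exists_lt_of_csInf_lt hne k2
  obtain ⟨j, hj⟩ := exists_nat_one_div_lt (show 0 < tp - max t0 t1 by
    have := max_lt ht0.2 ht1.2; linarith)
  have m0 := le_max_left t0 t1
  have m1 := le_max_right t0 t1
  refine mem_iUnion.2 ⟨Λ, mem_iUnion.2 ⟨k, mem_iUnion.2 ⟨j, hD, by linarith, by linarith, ?_, ?_⟩⟩⟩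
  · show 1 / ((j:ℝ) + 1) < tp
    linarith [ht0.1]
  · intro t ht
    simp only at ht ⊢
    have htI : t ∈ Ioo 0 tp := ⟨by linarith [ht.1, ht0.1], ht.2⟩
    refine ⟨⟨k1.trans (csInf_le hbd ⟨t, htI, rfl⟩), ?_⟩, hN t ⟨by linarith [ht.1], ht.2⟩⟩
    exact (hanti ht1 htI (by linarith [ht.1])).trans hlt.le

theorem NF.exists_good (h : NF v vx vxx vt S C) :
    ∃ t ∈ Ioo 0 S, ∀ x ∈ Icc (0:ℝ) 1, v x t = 0 → vx x t ≠ 0 := by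
  have hnull : volume (Prod.snd '' DD v vx S) = 0 := by
    refine measure_mono_null (image_mono h.DD_sub) ?_
    simp only [image_iUnion]
    exact measure_iUnion_null fun _ => measure_iUnion_null fun _ => measure_iUnion_null fun _ =>
      h.DP_null _ _ _
  by_contra hcon
  push Not at hcon
  have hsub : Ioo 0 S ⊆ Prod.snd '' DD v vx S := by
    intro t ht
    obtain ⟨x, hx, h1, h2⟩ := hcon t ht
    exact ⟨(x, t), ⟨ht, hx, h1, h2⟩, rfl⟩
  have := measure_mono_null hsub hnull
  rw [Real.volume_Ioo] at this
  have hS := h.S0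
  simp at this
  linarith

theorem finite_zeros {f f' : ℝ → ℝ} (hf : ContinuousOn f (Icc 0 1)) (hf' : ContinuousOn f' (Icc 0 1))
    (hd : ∀ x ∈ Ioo (0:ℝ) 1, HasDerivAt f (f' x) x)
    (hz : ∀ x ∈ Icc (0:ℝ) 1, f x = 0 → f' x ≠ 0) : {x ∈ Icc (0:ℝ) 1 | f x = 0}.Finite := by
  by_contra hinf
  obtain ⟨x, hx, hacc⟩ := Set.Infinite.exists_accPt_of_subset_isCompact (K := Icc (0:ℝ) 1) hinf
    isCompact_Icc (fun x hx => hx.1)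
  rw [accPt_iff_frequently] at hacc
  have hfx : f x = 0 := by
    by_contra hne
    have := (hf x hx).eventually_ne hne
    rw [eventually_nhdsWithin_iff] at this
    obtain ⟨y, ⟨_, hy⟩, hy2⟩ := (hacc.and_eventually this).exists
    exact hy2 hy.1 hy.2
  have hne := hz x hx hfx
  have h1 := (hf' x hx).eventually_ne hne
  rw [eventually_nhdsWithin_iff, Metric.eventually_nhds_iff] at h1
  obtain ⟨δ, hδ, h1⟩ := h1
  obtain ⟨y, ⟨hyx, hy⟩, hyd⟩ := (hacc.and_eventually (Metric.ball_mem_nhds x hδ)).exists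
  have roll : ∀ p q, p < q → p ∈ Icc (0:ℝ) 1 → q ∈ Icc (0:ℝ) 1 → f p = 0 → f q = 0 →
      ∃ z ∈ Ioo p q, f' z = 0 := by
    intro p q hpq hp hq hfp hfq
    exact exists_hasDerivAt_eq_zero hpq (hf.mono (Icc_subset_Icc hp.1 hq.2)) (hfp.trans hfq.symm)
      (fun z hz => hd z ⟨hp.1.trans_lt hz.1, hz.2.trans_le hq.2⟩)
  rw [Real.dist_eq] at hyd
  rcases lt_or_gt_of_ne hyx with hl | hg
  · obtain ⟨z, hz, hz0⟩ := roll y x hl hy.1 hx hy.2 hfx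
    refine h1 ?_ ⟨hy.1.1.trans hz.1.le, hz.2.le.trans hx.2⟩ hz0
    rw [Real.dist_eq]
    rw [abs_lt] at hyd ⊢
    constructor <;> linarith [hz.1, hz.2]
  · obtain ⟨z, hz, hz0⟩ := roll x y hg hx hy.1 hfx hy.2
    refine h1 ?_ ⟨hx.1.trans hz.1.le, hz.2.le.trans hy.1.2⟩ hz0
    rw [Real.dist_eq]
    rw [abs_lt] at hyd ⊢
    constructor <;> linarith [hz.1, hz.2]

theorem NF.main (h : NF v vx vxx vt S C) :
    ∃ t ∈ Ioo 0 S, {x ∈ Icc (0:ℝ) 1 | v x t = 0}.Finite := by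
  obtain ⟨t, ht, hg⟩ := h.exists_good
  exact ⟨t, ht, finite_zeros (h.c0 t ht) (h.c1 t ht) (h.d1 t ht) hg⟩
end


theorem rect_of_ev {P : ℝ × ℝ → Prop} {x t : ℝ} (h : ∀ᶠ p in 𝓝 (x, t), P p) :
    ∃ δ > 0, ∀ y s, |y - x| < δ → |s - t| < δ → P (y, s) := by
  rw [Metric.eventually_nhds_iff] at h
  obtain ⟨δ, hδ, h⟩ := h
  refine ⟨δ, hδ, fun y s hy hs => h ?_⟩
  rw [Prod.dist_eq, max_lt_iff, Real.dist_eq, Real.dist_eq]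
  exact ⟨hy, hs⟩

theorem ev_of_rect {P : ℝ × ℝ → Prop} {x t δ : ℝ} (hδ : 0 < δ)
    (h : ∀ y s, |y - x| < δ → |s - t| < δ → P (y, s)) : ∀ᶠ p in 𝓝 (x, t), P p := by
  rw [Metric.eventually_nhds_iff]
  refine ⟨δ, hδ, ?_⟩
  rintro ⟨y, s⟩ hys
  rw [Prod.dist_eq, max_lt_iff, Real.dist_eq, Real.dist_eq] at hys
  exact h y s hys.1 hys.2

theorem mvt_slope {f fx : ℝ → ℝ → ℝ} {γ : ℝ → ℝ} {t : ℝ}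
    (hd : ∀ᶠ p in 𝓝 (γ t, t), HasDerivAt (fun x => f x p.2) (fx p.1 p.2) p.1)
    (hc : ContinuousAt (fun p : ℝ × ℝ => fx p.1 p.2) (γ t, t)) (hγ : ContinuousAt γ t) :
    ∃ ρ : ℝ → ℝ, Tendsto ρ (𝓝 t) (𝓝 (fx (γ t) t)) ∧
      ∀ s, f (γ s) s - f (γ t) s = ρ s * (γ s - γ t) := by
  classical
  refine ⟨fun s => if γ s = γ t then fx (γ t) t else (f (γ s) s - f (γ t) s) / (γ s - γ t),
    ?_, ?_⟩
  · rw [Metric.tendsto_nhds]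
    intro ε hε
    have h1 := Metric.tendsto_nhds.1 hc ε hε
    obtain ⟨δ, hδ, h2⟩ := rect_of_ev (hd.and h1)
    filter_upwards [Metric.tendsto_nhds.1 hγ δ hδ, Metric.ball_mem_nhds t hδ] with s hs1 hs2
    rw [Real.dist_eq] at hs1
    rw [Metric.mem_ball, Real.dist_eq] at hs2
    by_cases hs : γ s = γ t
    · simp [hs, hε]
    · simp only [if_neg hs]
      have key : ∃ z, |z - γ t| < δ ∧ (f (γ s) s - f (γ t) s) / (γ s - γ t) = fx z s := by
        rcases lt_or_gt_of_ne hs with hl | hl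
        · have hz : ∀ z ∈ Icc (γ s) (γ t), |z - γ t| < δ := by
            intro z hz
            rw [abs_lt] at hs1 ⊢
            constructor <;> linarith [hz.1, hz.2]
          obtain ⟨z, hz1, hz2⟩ := exists_hasDerivAt_eq_slope (fun x => f x s) (fun x => fx x s) hl
            (fun z hz' => (h2 z s (hz z hz') hs2).1.continuousAt.continuousWithinAt)
            (fun z hz' => (h2 z s (hz z (Ioo_subset_Icc_self hz')) hs2).1)
          refine ⟨z, hz z (Ioo_subset_Icc_self hz1), ?_⟩
          rw [hz2, ← neg_div_neg_eq, neg_sub, neg_sub]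
        · have hz : ∀ z ∈ Icc (γ t) (γ s), |z - γ t| < δ := by
            intro z hz
            rw [abs_lt] at hs1 ⊢
            constructor <;> linarith [hz.1, hz.2]
          obtain ⟨z, hz1, hz2⟩ := exists_hasDerivAt_eq_slope (fun x => f x s) (fun x => fx x s) hl
            (fun z hz' => (h2 z s (hz z hz') hs2).1.continuousAt.continuousWithinAt)
            (fun z hz' => (h2 z s (hz z (Ioo_subset_Icc_self hz')) hs2).1)
          exact ⟨z, hz z (Ioo_subset_Icc_self hz1), hz2.symm⟩
      obtain ⟨z, hz, e⟩ := key
      rw [e]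
      exact (h2 z s hz hs2).2
  · intro s
    by_cases hs : γ s = γ t
    · simp [hs]
    · simp only [if_neg hs]
      rw [div_mul_cancel₀]
      exact sub_ne_zero.2 hs

theorem chain2 {f fx : ℝ → ℝ → ℝ} {γ : ℝ → ℝ} {t g ft : ℝ}
    (hd : ∀ᶠ p in 𝓝 (γ t, t), HasDerivAt (fun x => f x p.2) (fx p.1 p.2) p.1)
    (hc : ContinuousAt (fun p : ℝ × ℝ => fx p.1 p.2) (γ t, t))
    (hft : HasDerivAt (fun s => f (γ t) s) ft t) (hγ : HasDerivAt γ g t) :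
    HasDerivAt (fun s => f (γ s) s) (ft + fx (γ t) t * g) t := by
  obtain ⟨ρ, hρ, e⟩ := mvt_slope hd hc hγ.continuousAt
  have hft' := hft
  rw [hasDerivAt_iff_tendsto_slope] at hft hγ ⊢
  have h1 := hft.add ((hρ.mono_left nhdsWithin_le_nhds).mul hγ)
  refine h1.congr fun s => ?_
  simp only [slope_def_field]
  have := e s
  rw [← mul_div_assoc, ← this]
  ring

theorem implicit2 {F g : ℝ → ℝ → ℝ} {φ : ℝ → ℝ} {t ft : ℝ}
    (hd : ∀ᶠ p in 𝓝 (φ t, t), HasDerivAt (fun x => F x p.2) (g p.1 p.2) p.1)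
    (hc : ContinuousAt (fun p : ℝ × ℝ => g p.1 p.2) (φ t, t)) (hg : g (φ t) t ≠ 0)
    (hφ : ContinuousAt φ t) (hft : HasDerivAt (fun s => F (φ t) s) ft t)
    (h0 : ∀ᶠ s in 𝓝 t, F (φ s) s = 0) :
    HasDerivAt φ (-ft / g (φ t) t) t := by
  obtain ⟨ρ, hρ, e⟩ := mvt_slope hd hc hφ
  rw [hasDerivAt_iff_tendsto_slope] at hft ⊢
  have h1 := hft.neg.div (hρ.mono_left nhdsWithin_le_nhds) hg
  refine h1.congr' ?_
  filter_upwards [(hρ.eventually_ne hg).filter_mono nhdsWithin_le_nhds,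
    h0.filter_mono nhdsWithin_le_nhds, self_mem_nhdsWithin] with s hs1 hs2 hs3
  have h00 : F (φ t) t = 0 := h0.self_of_nhds
  have := e s
  rw [hs2] at this
  simp only [slope_def_field, Pi.div_apply]
  rw [h00]
  have h3 : s - t ≠ 0 := sub_ne_zero.2 hs3
  field_simp
  linarith

/-- inverse of an increasing primitive -/
theorem inv_int (g : ℝ → ℝ) (hg : Continuous g) (c : ℝ) (hc : 0 < c) (hcg : ∀ x, c ≤ g x) :
    ∃ Z : ℝ → ℝ, (∀ y, (∫ x in (0:ℝ)..(Z y), g x) = y) ∧ (∀ z, Z (∫ x in (0:ℝ)..z, g x) = z) ∧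
      StrictMono Z ∧ ∀ y, HasDerivAt Z (1 / g (Z y)) y := by
  set G : ℝ → ℝ := fun z => ∫ x in (0:ℝ)..z, g x with hG
  have hGd : ∀ z, HasDerivAt G (g z) z := fun z =>
    intervalIntegral.integral_hasDerivAt_right (hg.intervalIntegrable _ _)
      (hg.stronglyMeasurableAtFilter _ _) hg.continuousAt
  have hmono : StrictMono G := by
    apply strictMono_of_deriv_pos
    intro z; rw [(hGd z).deriv]; linarith [hcg z]
  have hGc : Continuous G := continuous_iff_continuousAt.2 fun z => (hGd z).continuousAt
  have hm2 : Monotone (fun z => G z - c * z) := by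
    have hk : ∀ z, HasDerivAt (fun z => G z - c * z) (g z - c * 1) z := fun z =>
      (hGd z).sub ((hasDerivAt_id z).const_mul c)
    refine monotone_of_deriv_nonneg (fun z => (hk z).differentiableAt) ?_
    intro z
    rw [(hk z).deriv]
    linarith [hcg z]
  have hG0 : G 0 = 0 := by simp [hG]
  have hsurj : Function.Surjective G := by
    refine hGc.surjective ?_ ?_
    · refine tendsto_atTop_mono' _ ?_ (tendsto_id.const_mul_atTop hc)
      filter_upwards [eventually_ge_atTop (0:ℝ)] with z hz
      have := hm2 hz
      simp only [hG0] at this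
      simp only [id]
      linarith
    · refine tendsto_atBot_mono' _ ?_ (tendsto_id.const_mul_atBot hc)
      filter_upwards [eventually_le_atBot (0:ℝ)] with z hz
      have := hm2 hz
      simp only [hG0] at this
      simp only [id]
      linarith
  set Φ := hmono.orderIsoOfSurjective G hsurj
  have e1 : ∀ y, G (Φ.symm y) = y := fun y => Φ.apply_symm_apply y
  refine ⟨Φ.symm, e1, fun z => Φ.symm_apply_apply z, Φ.symm.strictMono, fun y => ?_⟩
  rw [one_div]
  refine HasDerivAt.of_local_left_inverse Φ.symm.continuous.continuousAt (hGd _) ?_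
    (Eventually.of_forall e1)
  linarith [hcg (Φ.symm y)]

/-- joint continuity of `a` and `a_x` by interpolation -/
theorem interp {a ax axx at' : ℝ → ℝ → ℝ} {x0 t0 ρ M : ℝ} (hρ : 0 < ρ)
    (h1 : ∀ x t, |x - x0| < ρ → |t - t0| < ρ → HasDerivAt (fun x => a x t) (ax x t) x)
    (h2 : ∀ x t, |x - x0| < ρ → |t - t0| < ρ → HasDerivAt (fun x => ax x t) (axx x t) x)
    (h3 : ∀ x t, |x - x0| < ρ → |t - t0| < ρ → HasDerivAt (fun t => a x t) (at' x t) t)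
    (b1 : ∀ x t, |x - x0| < ρ → |t - t0| < ρ → |ax x t| ≤ M)
    (b2 : ∀ x t, |x - x0| < ρ → |t - t0| < ρ → |axx x t| ≤ M)
    (b3 : ∀ x t, |x - x0| < ρ → |t - t0| < ρ → |at' x t| ≤ M) :
    ContinuousAt (fun p : ℝ × ℝ => a p.1 p.2) (x0, t0) ∧
    ContinuousAt (fun p : ℝ × ℝ => ax p.1 p.2) (x0, t0) := by
  have hM : 0 ≤ M := (abs_nonneg _).trans (b1 x0 t0 (by simpa) (by simpa))
  have conv : ∀ z, Convex ℝ {y : ℝ | |y - z| < ρ} := by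
    intro z
    have : {y : ℝ | |y - z| < ρ} = Metric.ball z ρ := by
      ext y; simp [Real.dist_eq]
    rw [this]; exact convex_ball _ _
  have L1 : ∀ x y t, |x - x0| < ρ → |y - x0| < ρ → |t - t0| < ρ → |a y t - a x t| ≤ M * |y - x| :=
    fun x y t hx hy ht => (conv x0).norm_image_sub_le_of_norm_hasDerivWithin_le
      (fun z hz => (h1 z t hz ht).hasDerivWithinAt) (fun z hz => b1 z t hz ht) hx hy
  have L2 : ∀ x y t, |x - x0| < ρ → |y - x0| < ρ → |t - t0| < ρ → |ax y t - ax x t| ≤ M * |y - x| :=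
    fun x y t hx hy ht => (conv x0).norm_image_sub_le_of_norm_hasDerivWithin_le
      (fun z hz => (h2 z t hz ht).hasDerivWithinAt) (fun z hz => b2 z t hz ht) hx hy
  have L3 : ∀ x t s, |x - x0| < ρ → |t - t0| < ρ → |s - t0| < ρ → |a x s - a x t| ≤ M * |s - t| :=
    fun x t s hx ht hs => (conv t0).norm_image_sub_le_of_norm_hasDerivWithin_le
      (fun z hz => (h3 x z hx hz).hasDerivWithinAt) (fun z hz => b3 x z hx hz) ht hs
  have z0 : |x0 - x0| < ρ := by simpa
  have w0 : |t0 - t0| < ρ := by simpa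
  constructor
  · rw [ContinuousAt, Metric.tendsto_nhds]
    intro ε hε
    refine ev_of_rect (δ := min ρ (ε / (2 * M + 1) / 2)) (by positivity) ?_
    intro x t hx ht
    obtain ⟨hx1, hx2⟩ := lt_min_iff.1 hx
    obtain ⟨ht1, ht2⟩ := lt_min_iff.1 ht
    rw [Real.dist_eq]
    have A := L1 x0 x t z0 hx1 ht1
    have B := L3 x0 t0 t z0 w0 ht1
    have := abs_sub_le (a x t) (a x0 t) (a x0 t0)
    have e : (2 * M + 1) * (ε / (2 * M + 1)) = ε := by field_simp
    have p : 0 < ε / (2 * M + 1) := by positivity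
    have A' : M * |x - x0| ≤ M * (ε / (2 * M + 1) / 2) := by gcongr
    have B' : M * |t - t0| ≤ M * (ε / (2 * M + 1) / 2) := by gcongr
    simp only
    nlinarith
  · rw [ContinuousAt, Metric.tendsto_nhds]
    intro ε hε
    set h := min (ρ / 2) (ε / (8 * (M + 1))) with hh
    have hh0 : 0 < h := by positivity
    have hhρ : h < ρ := (min_le_left _ _).trans_lt (by linarith)
    have hh2 : h * (8 * (M + 1)) ≤ ε := by
      rw [← le_div_iff₀ (by positivity)]; exact min_le_right _ _
    have zh : |x0 + h - x0| < ρ := by simpa [abs_of_pos hh0]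
    refine ev_of_rect (δ := min ρ (min h (h * h))) (by positivity) ?_
    intro x t hx ht
    obtain ⟨hx1, hx2⟩ := lt_min_iff.1 hx
    obtain ⟨ht1, ht2⟩ := lt_min_iff.1 ht
    obtain ⟨hx3, _⟩ := lt_min_iff.1 hx2
    obtain ⟨_, ht3⟩ := lt_min_iff.1 ht2
    have dq : ∀ s, |s - t0| < ρ → |a (x0 + h) s - a x0 s - h * ax x0 s| ≤ M * h * h := by
      intro s hs
      have : ∀ y ∈ Icc x0 (x0 + h), |y - x0| < ρ := by
        intro y hy; rw [abs_lt]; constructor <;> linarith [hy.1, hy.2]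
      obtain ⟨z, hz1, hz2⟩ := exists_hasDerivAt_eq_slope (fun x => a x s) (fun x => ax x s)
        (show x0 < x0 + h by linarith)
        (fun y hy => (h1 y s (this y hy) hs).continuousAt.continuousWithinAt)
        (fun y hy => h1 y s (this y (Ioo_subset_Icc_self hy)) hs)
      have e : a (x0 + h) s - a x0 s - h * ax x0 s = h * (ax z s - ax x0 s) := by
        rw [hz2, add_sub_cancel_left, mul_sub, mul_div_cancel₀ _ hh0.ne']
      rw [e, abs_mul, abs_of_pos hh0]
      have := L2 x0 z s z0 (this z (Ioo_subset_Icc_self hz1)) hs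
      have e2 : |z - x0| ≤ h := by rw [abs_le]; constructor <;> linarith [hz1.1, hz1.2]
      calc h * |ax z s - ax x0 s| ≤ h * (M * h) := by gcongr; exact this.trans (by gcongr)
        _ = _ := by ring
    have q1 := dq t ht1
    have q2 := dq t0 w0
    have q3 := L3 (x0 + h) t0 t zh w0 ht1
    have q4 := L3 x0 t0 t z0 w0 ht1
    have q5 := L2 x0 x t z0 hx1 ht1
    rw [Real.dist_eq]
    simp only
    have q6 : h * |ax x0 t - ax x0 t0| ≤ h * (4 * M * h) := by
      rw [← abs_of_pos hh0, ← abs_mul, abs_of_pos hh0]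
      have m3 : M * |t - t0| ≤ M * (h * h) := by gcongr
      rw [abs_le] at *
      constructor <;> nlinarith
    have q7 := le_of_mul_le_mul_left q6 hh0
    have m5 : M * |x - x0| ≤ M * h := by gcongr
    have := abs_sub_le (ax x t) (ax x0 t) (ax x0 t0)
    nlinarith


/-- rectangle form -/
structure RF (U Ux Uxx Ut β βx βt : ℝ → ℝ → ℝ) (p q C : ℝ) : Prop where
  pq : p < q
  C1 : 1 ≤ C
  c0 : ∀ t ∈ Ioo p q, ContinuousOn (fun x => U x t) (Icc 0 1)
  c1 : ∀ t ∈ Ioo p q, ContinuousOn (fun x => Ux x t) (Icc 0 1)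
  d1 : ∀ t ∈ Ioo p q, ∀ x ∈ Ioo (0:ℝ) 1, HasDerivAt (fun x => U x t) (Ux x t) x
  d2 : ∀ t ∈ Ioo p q, ∀ x ∈ Ioo (0:ℝ) 1, HasDerivAt (fun x => Ux x t) (Uxx x t) x
  dt : ∀ t ∈ Ioo p q, ∀ x ∈ Ioo (0:ℝ) 1, HasDerivAt (fun t => U x t) (Ut x t) t
  e1 : ∀ t ∈ Ioo p q, ∀ x ∈ Ioo (0:ℝ) 1, ContinuousAt (fun p : ℝ × ℝ => Ux p.1 p.2) (x, t)
  e2 : ∀ t ∈ Ioo p q, ∀ x ∈ Ioo (0:ℝ) 1, ContinuousAt (fun p : ℝ × ℝ => Uxx p.1 p.2) (x, t)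
  b0 : ∀ t ∈ Ioo p q, ∀ x ∈ Icc (0:ℝ) 1, |U x t| ≤ C
  b1 : ∀ t ∈ Ioo p q, ∀ x ∈ Icc (0:ℝ) 1, |Ux x t| ≤ C
  b2 : ∀ t ∈ Ioo p q, ∀ x ∈ Ioo (0:ℝ) 1, |Uxx x t| ≤ C
  bt : ∀ t ∈ Ioo p q, ∀ x ∈ Ioo (0:ℝ) 1, |Ut x t| ≤ C
  eq : ∀ t ∈ Ioo p q, ∀ x ∈ Ioo (0:ℝ) 1,
    |β x t ^ 2 * Ut x t - Uxx x t| ≤ C * (|U x t| + |Ux x t|)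
  nz : ∀ t ∈ Ioo p q, ∃ x ∈ Icc (0:ℝ) 1, U x t ≠ 0
  βc : ∀ t ∈ Ioo p q, ContinuousOn (fun x => β x t) (Icc 0 1)
  βl : ∀ t ∈ Ioo p q, ∀ x ∈ Icc (0:ℝ) 1, C⁻¹ ≤ β x t
  βu : ∀ t ∈ Ioo p q, ∀ x ∈ Icc (0:ℝ) 1, β x t ≤ C
  βd : ∀ t ∈ Ioo p q, ∀ x ∈ Ioo (0:ℝ) 1, HasDerivAt (fun x => β x t) (βx x t) x
  βdt : ∀ t ∈ Ioo p q, ∀ x ∈ Ioo (0:ℝ) 1, HasDerivAt (fun t => β x t) (βt x t) t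
  βe : ∀ t ∈ Ioo p q, ∀ x ∈ Ioo (0:ℝ) 1, ContinuousAt (fun p : ℝ × ℝ => β p.1 p.2) (x, t)
  βxe : ∀ t ∈ Ioo p q, ∀ x ∈ Ioo (0:ℝ) 1, ContinuousAt (fun p : ℝ × ℝ => βx p.1 p.2) (x, t)
  βxb : ∀ t ∈ Ioo p q, ∀ x ∈ Ioo (0:ℝ) 1, |βx x t| ≤ C
  βtb : ∀ t ∈ Ioo p q, ∀ x ∈ Ioo (0:ℝ) 1, |βt x t| ≤ C

/-- the spatial straightening -/
structure WF (β W Wt : ℝ → ℝ → ℝ) (L : ℝ → ℝ) (p q C : ℝ) : Prop where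
  Ll : ∀ t ∈ Ioo p q, C⁻¹ ≤ L t
  Lu : ∀ t ∈ Ioo p q, L t ≤ C
  Lc : ∀ t ∈ Ioo p q, ContinuousAt L t
  W0 : ∀ t ∈ Ioo p q, W 0 t = 0
  W1 : ∀ t ∈ Ioo p q, W 1 t = 1
  Wm : ∀ t ∈ Ioo p q, StrictMono (fun y => W y t)
  Wc : ∀ t ∈ Ioo p q, Continuous (fun y => W y t)
  Wd : ∀ t ∈ Ioo p q, ∀ y ∈ Ioo (0:ℝ) 1, HasDerivAt (fun y => W y t) (L t / β (W y t) t) y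
  Wdt : ∀ t ∈ Ioo p q, ∀ y ∈ Ioo (0:ℝ) 1, HasDerivAt (fun t => W y t) (Wt y t) t
  Wtb : ∀ t ∈ Ioo p q, ∀ y ∈ Ioo (0:ℝ) 1, |Wt y t| ≤ 2 * C ^ 2

theorem JJ_abs_le {F : ℝ → ℝ} {M : ℝ} (hM : 0 ≤ M) (h : ∀ x ∈ Ioo (0:ℝ) 1, |F x| ≤ M) : |JJ F| ≤ M := by
  have := norm_setIntegral_le_of_norm_le_const (μ := volume) (s := Ioo (0:ℝ) 1) (f := F) (C := M)
    (by simp) (fun x hx => h x hx)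
  simpa [JJ] using this

theorem exists_WF {β βt : ℝ → ℝ → ℝ} {p q C : ℝ} (C1 : 1 ≤ C)
  (βc : ∀ t ∈ Ioo p q, ContinuousOn (fun x => β x t) (Icc 0 1))
  (βl : ∀ t ∈ Ioo p q, ∀ x ∈ Icc (0:ℝ) 1, C⁻¹ ≤ β x t)
  (βu : ∀ t ∈ Ioo p q, ∀ x ∈ Icc (0:ℝ) 1, β x t ≤ C)
  (βdt : ∀ t ∈ Ioo p q, ∀ x ∈ Ioo (0:ℝ) 1, HasDerivAt (fun t => β x t) (βt x t) t)
  (βe : ∀ t ∈ Ioo p q, ∀ x ∈ Ioo (0:ℝ) 1, ContinuousAt (fun p : ℝ × ℝ => β p.1 p.2) (x, t))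
  (βtb : ∀ t ∈ Ioo p q, ∀ x ∈ Ioo (0:ℝ) 1, |βt x t| ≤ C) :
    ∃ W Wt L, WF β W Wt L p q C := by
  classical
  set g : ℝ → ℝ → ℝ := fun x t => β (max 0 (min x 1)) t with hg
  have hproj : ∀ x : ℝ, max 0 (min x 1) ∈ Icc (0:ℝ) 1 := fun x =>
    ⟨le_max_left _ _, max_le zero_le_one (min_le_right _ _)⟩
  have hgβ : ∀ x ∈ Icc (0:ℝ) 1, ∀ t, g x t = β x t := by
    intro x hx t
    simp only [hg]; rw [min_eq_left hx.2, max_eq_right hx.1]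
  have hgc : ∀ t ∈ Ioo p q, Continuous (fun x => g x t) := by
    intro t ht
    exact (βc t ht).comp_continuous (by fun_prop) hproj
  have hC0 : 0 < C := by linarith
  have hCi : 0 < C⁻¹ := by positivity
  have hgl : ∀ t ∈ Ioo p q, ∀ x, C⁻¹ ≤ g x t := fun t ht x => βl t ht _ (hproj x)
  have hgu : ∀ t ∈ Ioo p q, ∀ x, g x t ≤ C := fun t ht x => βu t ht _ (hproj x)
  have hex : ∀ t, ∃ Z : ℝ → ℝ, t ∈ Ioo p q → (∀ y, (∫ x in (0:ℝ)..(Z y), g x t) = y) ∧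
      (∀ z, Z (∫ x in (0:ℝ)..z, g x t) = z) ∧ StrictMono Z ∧
      ∀ y, HasDerivAt Z (1 / g (Z y) t) y := by
    intro t
    by_cases ht : t ∈ Ioo p q
    · obtain ⟨Z, h⟩ := inv_int (fun x => g x t) (hgc t ht) C⁻¹ hCi (hgl t ht)
      exact ⟨Z, fun _ => h⟩
    · exact ⟨id, fun h => absurd h ht⟩
  choose Z hZ using hex
  set G : ℝ → ℝ → ℝ := fun z t => ∫ x in (0:ℝ)..z, g x t with hG
  set L : ℝ → ℝ := fun t => G 1 t with hL
  set W : ℝ → ℝ → ℝ := fun y t => Z t (L t * y) with hW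
  have hGd : ∀ t ∈ Ioo p q, ∀ z, HasDerivAt (fun z => G z t) (g z t) z := fun t ht z =>
    intervalIntegral.integral_hasDerivAt_right ((hgc t ht).intervalIntegrable _ _)
      ((hgc t ht).stronglyMeasurableAtFilter _ _) (hgc t ht).continuousAt
  have hG0 : ∀ t, G 0 t = 0 := fun t => by simp [hG]
  have hGJ : ∀ z t, G z t = z * JJ (fun s => g (z * s) t) := by
    intro z t
    have := intervalIntegral.mul_integral_comp_mul_left (a := 0) (b := 1) (f := fun x => g x t) (c := z)
    simp only [mul_zero, mul_one] at this
    rw [hG]; simp only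
    rw [← this, intervalIntegral.integral_of_le zero_le_one, integral_Ioc_eq_integral_Ioo, JJ]
  have hLl : ∀ t ∈ Ioo p q, C⁻¹ ≤ L t := by
    intro t ht
    simp only [hL]; rw [hGJ, one_mul, ← JJ_const C⁻¹]
    refine JJ_mono (Gd.const _) ?_ (fun x hx => hgl t ht _)
    exact Gd.of_cont ((hgc t ht).comp (by fun_prop)).continuousOn
  have hLu : ∀ t ∈ Ioo p q, L t ≤ C := by
    intro t ht
    simp only [hL]; rw [hGJ, one_mul, ← JJ_const C]
    refine JJ_mono ?_ (Gd.const _) (fun x hx => hgu t ht _)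
    exact Gd.of_cont ((hgc t ht).comp (by fun_prop)).continuousOn
  have hGt : ∀ t ∈ Ioo p q, ∀ z ∈ Ioc (0:ℝ) 1, ∃ Γ, HasDerivAt (fun t => G z t) Γ t ∧ |Γ| ≤ C := by
    intro t ht z hz
    have hzs : ∀ s ∈ Ioo (0:ℝ) 1, z * s ∈ Ioo (0:ℝ) 1 := fun s hs =>
      ⟨mul_pos hz.1 hs.1, by nlinarith [hs.1, hs.2, hz.1, hz.2]⟩
    have h1 := JJ_hasDerivAt (F := fun s t => g (z * s) t) (F' := fun s t => βt (z * s) t) (M := C)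
      (isOpen_Ioo.mem_nhds ht)
      (fun r hr => Gd.of_cont ((hgc r hr).comp (by fun_prop : Continuous (fun s => z * s))).continuousOn)
      (fun s hs r hr => by
        have e : (fun r => g (z * s) r) = fun r => β (z * s) r :=
          funext fun r => hgβ _ (Ioo_subset_Icc_self (hzs s hs)) r
        simp only [e]
        exact βdt r hr _ (hzs s hs))
      (fun s hs r hr => βtb r hr _ (hzs s hs))
    refine ⟨z * JJ (fun s => βt (z * s) t), ?_, ?_⟩
    · have e : (fun t => G z t) = fun t => z * JJ (fun s => g (z * s) t) := funext fun t => hGJ z t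
      rw [e]
      exact h1.const_mul z
    · have h2 := JJ_abs_le hC0.le (fun s hs => βtb t ht _ (hzs s hs))
      rw [abs_mul, abs_of_pos hz.1]
      calc _ ≤ 1 * C := mul_le_mul hz.2 h2 (abs_nonneg _) zero_le_one
        _ = C := one_mul C
  have hGW : ∀ t ∈ Ioo p q, ∀ y, G (W y t) t = L t * y := fun t ht y => (hZ t ht).1 _
  have hW0 : ∀ t ∈ Ioo p q, W 0 t = 0 := by
    intro t ht
    have := (hZ t ht).2.1 0
    rw [intervalIntegral.integral_same] at this
    simp only [hW]; rw [mul_zero]; exact this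
  have hW1 : ∀ t ∈ Ioo p q, W 1 t = 1 := by
    intro t ht
    simp only [hW]; rw [mul_one]; exact (hZ t ht).2.1 1
  have hWm : ∀ t ∈ Ioo p q, StrictMono (fun y => W y t) := by
    intro t ht y y' hy
    exact (hZ t ht).2.2.1 (mul_lt_mul_of_pos_left hy (hCi.trans_le (hLl t ht)))
  have hWI : ∀ t ∈ Ioo p q, ∀ y ∈ Ioo (0:ℝ) 1, W y t ∈ Ioo (0:ℝ) 1 := by
    intro t ht y hy
    have a := hWm t ht hy.1
    have b := hWm t ht hy.2
    simp only [hW0 t ht, hW1 t ht] at a b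
    exact ⟨a, b⟩
  have hWd : ∀ t ∈ Ioo p q, ∀ y, HasDerivAt (fun y => W y t) (L t / g (W y t) t) y := by
    intro t ht y
    have h1 := (hZ t ht).2.2.2 (L t * y)
    have h2 := h1.comp y ((hasDerivAt_id y).const_mul (L t))
    have e : 1 / g (Z t (L t * y)) t * (L t * 1) = L t / g (W y t) t := by ring
    rw [← e]; exact h2
  have hWt : ∀ t ∈ Ioo p q, ∀ y ∈ Ioo (0:ℝ) 1, ∃ D, HasDerivAt (fun t => W y t) D t ∧
      |D| ≤ 2 * C ^ 2 := by
    intro t ht y hy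
    have hw := hWI t ht y hy
    obtain ⟨Γ, hΓ, hΓb⟩ := hGt t ht (W y t) ⟨hw.1, hw.2.le⟩
    obtain ⟨Γ1, hΓ1, hΓ1b⟩ := hGt t ht 1 ⟨one_pos, le_rfl⟩
    have hF : HasDerivAt (fun s => G (W y t) s - L s * y) (Γ - Γ1 * y) t := hΓ.sub (hΓ1.mul_const y)
    have hev : ∀ᶠ s in 𝓝 t, s ∈ Ioo p q := isOpen_Ioo.mem_nhds ht
    have hcont : ContinuousAt (fun s => W y s) t := by
      have h1 : Tendsto (fun s => C * |G (W y t) s - L s * y|) (𝓝 t) (𝓝 0) := by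
        have := (hF.continuousAt.abs).const_mul C
        simp only [ContinuousAt] at this
        rw [hGW t ht y] at this
        simpa using this
      rw [ContinuousAt, tendsto_iff_dist_tendsto_zero]
      refine squeeze_zero' (Eventually.of_forall fun s => dist_nonneg) ?_ h1
      filter_upwards [hev] with s hs
      rw [Real.dist_eq]
      have hm : Monotone (fun z => G z s - C⁻¹ * z) := by
        have hk : ∀ z, HasDerivAt (fun z => G z s - C⁻¹ * z) (g z s - C⁻¹ * 1) z := fun z =>
          (hGd s hs z).sub ((hasDerivAt_id z).const_mul _)
        refine monotone_of_deriv_nonneg (fun z => (hk z).differentiableAt) ?_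
        intro z
        rw [(hk z).deriv]
        linarith [hgl s hs z]
      have key : C⁻¹ * |W y s - W y t| ≤ |G (W y t) s - L s * y| := by
        rw [← hGW s hs y]
        rcases le_total (W y s) (W y t) with hle | hle
        · have := hm hle
          simp only at this
          rw [abs_of_nonpos (by linarith)]
          refine le_trans ?_ (le_abs_self _)
          linarith
        · have := hm hle
          simp only at this
          rw [abs_of_nonneg (by linarith)]
          refine le_trans ?_ (neg_le_abs _)
          linarith
      calc |W y s - W y t| = C * (C⁻¹ * |W y s - W y t|) := by field_simp
        _ ≤ _ := by gcongr
    have hgp : g (W y t) t = β (W y t) t := hgβ _ (Ioo_subset_Icc_self hw) t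
    have hgpos : 0 < g (W y t) t := hCi.trans_le (hgl t ht _)
    have him := implicit2 (F := fun z s => G z s - L s * y) (g := g) (φ := fun s => W y s) (t := t)
      (by
        have : ∀ᶠ z : ℝ × ℝ in 𝓝 (W y t, t), z.2 ∈ Ioo p q :=
          continuousAt_snd.eventually hev
        filter_upwards [this] with z hz
        exact (hGd z.2 hz z.1).sub_const _)
      (by
        refine (βe t ht _ hw).congr ?_
        have : ∀ᶠ z : ℝ × ℝ in 𝓝 (W y t, t), z.1 ∈ Ioo (0:ℝ) 1 :=
          continuousAt_fst.eventually (isOpen_Ioo.mem_nhds hw)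
        filter_upwards [this] with z hz
        exact (hgβ _ (Ioo_subset_Icc_self hz) _).symm)
      hgpos.ne' hcont hF (by filter_upwards [hev] with s hs; rw [hGW s hs y]; ring)
    refine ⟨_, him, ?_⟩
    rw [abs_div, abs_neg, abs_of_pos hgpos, div_le_iff₀ hgpos]
    have h1 : |Γ - Γ1 * y| ≤ 2 * C := by
      have hy1 : |Γ1 * y| ≤ C := by
        rw [abs_mul, abs_of_pos hy.1]
        calc _ ≤ C * 1 := mul_le_mul hΓ1b hy.2.le hy.1.le hC0.le
          _ = C := mul_one C
      have := abs_sub Γ (Γ1 * y)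
      linarith
    have h2 := hgl t ht (W y t)
    calc |Γ - Γ1 * y| ≤ 2 * C := h1
      _ = 2 * C ^ 2 * C⁻¹ := by field_simp
      _ ≤ _ := by gcongr
  have hex2 : ∀ y t, ∃ D, t ∈ Ioo p q → y ∈ Ioo (0:ℝ) 1 → HasDerivAt (fun t => W y t) D t ∧
      |D| ≤ 2 * C ^ 2 := by
    intro y t
    by_cases ht : t ∈ Ioo p q
    · by_cases hy : y ∈ Ioo (0:ℝ) 1
      · obtain ⟨D, hD⟩ := hWt t ht y hy
        exact ⟨D, fun _ _ => hD⟩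
      · exact ⟨0, fun _ h => absurd h hy⟩
    · exact ⟨0, fun h => absurd h ht⟩
  choose Wt hWt2 using hex2
  refine ⟨W, Wt, L, hLl, hLu, ?_, hW0, hW1, hWm, ?_, ?_, ?_, ?_⟩
  · intro t ht
    obtain ⟨Γ1, hΓ1, hΓ1b⟩ := hGt t ht 1 ⟨one_pos, le_rfl⟩
    exact hΓ1.continuousAt
  · intro t ht
    exact continuous_iff_continuousAt.2 fun y => (hWd t ht y).continuousAt
  · intro t ht y hy
    have := hWd t ht y
    rwa [hgβ _ (Ioo_subset_Icc_self (hWI t ht y hy))] at this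
  · exact fun t ht y hy => (hWt2 y t ht hy).1
  · exact fun t ht y hy => (hWt2 y t ht hy).2


/-- time change -/
theorem exists_theta {L : ℝ → ℝ} {p q C : ℝ} (C1 : 1 ≤ C) (hpq : p < q)
    (Ll : ∀ t ∈ Ioo p q, C⁻¹ ≤ L t) (Lu : ∀ t ∈ Ioo p q, L t ≤ C)
    (Lc : ∀ t ∈ Ioo p q, ContinuousAt L t) :
    ∃ θ : ℝ → ℝ, ∃ S, 0 < S ∧ ∀ s ∈ Ioo 0 S, θ s ∈ Ioo p q ∧ HasDerivAt θ (L (θ s) ^ 2) s := by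
  obtain ⟨p', hp⟩ := exists_between hpq
  obtain ⟨q', hq⟩ := exists_between hp.2
  have hC0 : 0 < C := by linarith
  have hpr : ∀ t, max p' (min t q') ∈ Ioo p q := fun t =>
    ⟨hp.1.trans_le (le_max_left _ _), (max_le hq.1.le (min_le_right _ _)).trans_lt hq.2⟩
  set h : ℝ → ℝ := fun t => 1 / L (max p' (min t q')) ^ 2 with hh
  have hLp : ∀ t, 0 < L (max p' (min t q')) := fun t =>
    (inv_pos.2 hC0).trans_le (Ll _ (hpr t))
  have hc : Continuous h := by
    have h1 : Continuous (fun t => L (max p' (min t q'))) := by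
      refine ContinuousOn.comp_continuous (s := Ioo p q)
        (fun t ht => (Lc t ht).continuousWithinAt) (by fun_prop) hpr
    have h2 : ∀ t, L (max p' (min t q')) ^ 2 ≠ 0 := fun t => (pow_pos (hLp t) 2).ne'
    exact continuous_const.div (h1.pow 2) h2
  obtain ⟨Z, h1, h2, h3, h4⟩ := inv_int h hc (1 / C ^ 2) (by positivity) (by
    intro t
    simp only [hh]
    have := hLp t
    have := Lu _ (hpr t)
    gcongr)
  set a := ∫ x in (0:ℝ)..p', h x with ha
  set b := ∫ x in (0:ℝ)..q', h x with hb
  have hab : a < b := by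
    rw [← h3.lt_iff_lt, h2, h2]; exact hq.1
  refine ⟨fun s => Z (s + a), b - a, by linarith, ?_⟩
  intro s hs
  have i1 : p' < Z (s + a) := by
    rw [← h2 p']; exact h3 (by linarith [hs.1])
  have i2 : Z (s + a) < q' := by
    rw [← h2 q']; exact h3 (by linarith [hs.2])
  refine ⟨⟨hp.1.trans i1, i2.trans hq.2⟩, ?_⟩
  have := (h4 (s + a)).comp s ((hasDerivAt_id s).add_const a)
  have e : L (Z (s + a)) ^ 2 = 1 / h (Z (s + a)) * 1 := by
    simp only [hh]
    rw [min_eq_left i2.le, max_eq_right i1.le]; simp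
  simp only
  rw [e]; exact this

section
variable {U Ux Uxx Ut β βx βt W Wt : ℝ → ℝ → ℝ} {L : ℝ → ℝ} {p q C : ℝ}

theorem WF.int (w : WF β W Wt L p q C) {t y : ℝ} (ht : t ∈ Ioo p q) (hy : y ∈ Ioo (0:ℝ) 1) :
    W y t ∈ Ioo (0:ℝ) 1 := by
  have a := w.Wm t ht hy.1
  have b := w.Wm t ht hy.2
  simp only [w.W0 t ht, w.W1 t ht] at a b
  exact ⟨a, b⟩

theorem WF.icc (w : WF β W Wt L p q C) {t y : ℝ} (ht : t ∈ Ioo p q) (hy : y ∈ Icc (0:ℝ) 1) :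
    W y t ∈ Icc (0:ℝ) 1 := by
  have a := (w.Wm t ht).monotone hy.1
  have b := (w.Wm t ht).monotone hy.2
  simp only [w.W0 t ht, w.W1 t ht] at a b
  exact ⟨a, b⟩

/-- algebra of the bounds -/
theorem nf_bounds {C u ux uxx ut b bx l wt : ℝ} (C1 : 1 ≤ C) (h0 : |u| ≤ C) (h1 : |ux| ≤ C)
    (h2 : |uxx| ≤ C) (h3 : |ut| ≤ C) (hb : C⁻¹ ≤ b) (hbx : |bx| ≤ C) (hl : C⁻¹ ≤ l) (hlu : l ≤ C)
    (hbu : b ≤ C) (hw : |wt| ≤ 2 * C ^ 2) (he : |b ^ 2 * ut - uxx| ≤ C * (|u| + |ux|)) :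
    |uxx * (l / b) ^ 2 - ux * (l ^ 2 * bx / b ^ 3)| ≤ 10 * C ^ 10 ∧
    |(ut + ux * wt) * l ^ 2| ≤ 10 * C ^ 10 ∧
    |(ut + ux * wt) * l ^ 2 - (uxx * (l / b) ^ 2 - ux * (l ^ 2 * bx / b ^ 3))| ≤
      10 * C ^ 10 * (|u| + |ux * (l / b)|) := by
  have hC0 : 0 < C := by linarith
  have hCi : 0 < C⁻¹ := by positivity
  have hb0 : 0 < b := hCi.trans_le hb
  have hl0 : 0 < l := hCi.trans_le hl
  have hbi : b⁻¹ ≤ C := by rw [inv_le_comm₀ hb0 hC0]; exact hb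
  have hli : l⁻¹ ≤ C := by rw [inv_le_comm₀ hl0 hC0]; exact hl
  have hbi0 : 0 < b⁻¹ := by positivity
  have hli0 : 0 < l⁻¹ := by positivity
  have pw : ∀ n, n ≤ 10 → C ^ n ≤ C ^ 10 := fun n hn => pow_le_pow_right₀ C1 hn
  have r1 : |l ^ 2 * bx / b ^ 3| ≤ C ^ 6 := by
    have : l ^ 2 * bx / b ^ 3 = l ^ 2 * (b⁻¹) ^ 3 * bx := by field_simp
    rw [this, abs_mul, abs_of_pos (by positivity)]
    calc _ ≤ C ^ 2 * C ^ 3 * C := by gcongr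
      _ = _ := by ring
  have r2 : (l / b) ^ 2 ≤ C ^ 4 := by
    rw [div_eq_mul_inv]
    calc (l * b⁻¹) ^ 2 ≤ (C * C) ^ 2 := by gcongr
      _ = _ := by ring
  have r3 : |ux| ≤ C ^ 2 * |ux * (l / b)| := by
    have : ux = (b * l⁻¹) * (ux * (l / b)) := by field_simp
    calc |ux| = |(b * l⁻¹) * (ux * (l / b))| := by rw [← this]
      _ = (b * l⁻¹) * |ux * (l / b)| := by rw [abs_mul, abs_of_pos (by positivity)]
      _ ≤ (C * C) * |ux * (l / b)| := by gcongr
      _ = _ := by ring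
  have r4 : |wt * l ^ 2| ≤ 2 * C ^ 4 := by
    rw [abs_mul, abs_of_pos (by positivity : 0 < l ^ 2)]
    calc _ ≤ 2 * C ^ 2 * C ^ 2 := by gcongr
      _ = _ := by ring
  refine ⟨?_, ?_, ?_⟩
  · have a1 : |uxx * (l / b) ^ 2| ≤ C * C ^ 4 := by
      rw [abs_mul, abs_of_pos (by positivity : 0 < (l / b) ^ 2)]; gcongr
    have a2 : |ux * (l ^ 2 * bx / b ^ 3)| ≤ C * C ^ 6 := by
      rw [abs_mul]; gcongr
    have := abs_sub (uxx * (l / b) ^ 2) (ux * (l ^ 2 * bx / b ^ 3))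
    have p5 := pw 5 (by norm_num)
    have p7 := pw 7 (by norm_num)
    have e1 : C * C ^ 4 = C ^ 5 := by ring
    have e2 : C * C ^ 6 = C ^ 7 := by ring
    have : 0 < C ^ 10 := by positivity
    linarith
  · have e : (ut + ux * wt) * l ^ 2 = ut * l ^ 2 + ux * (wt * l ^ 2) := by ring
    have a1 : |ut * l ^ 2| ≤ C * C ^ 2 := by
      rw [abs_mul, abs_of_pos (by positivity : 0 < l ^ 2)]; gcongr
    have a2 : |ux * (wt * l ^ 2)| ≤ C * (2 * C ^ 4) := by
      rw [abs_mul]; gcongr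
    rw [e]
    have := abs_add_le (ut * l ^ 2) (ux * (wt * l ^ 2))
    have p5 := pw 5 (by norm_num)
    have p7 := pw 3 (by norm_num)
    have e1 : C * (2 * C ^ 4) = 2 * C ^ 5 := by ring
    have e2 : C * C ^ 2 = C ^ 3 := by ring
    have : 0 < C ^ 10 := by positivity
    linarith
  · have e : (ut + ux * wt) * l ^ 2 - (uxx * (l / b) ^ 2 - ux * (l ^ 2 * bx / b ^ 3)) =
      (l / b) ^ 2 * (b ^ 2 * ut - uxx) + ux * (wt * l ^ 2 + l ^ 2 * bx / b ^ 3) := by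
      field_simp; ring
    rw [e]
    have a1 : |(l / b) ^ 2 * (b ^ 2 * ut - uxx)| ≤ C ^ 4 * (C * (|u| + |ux|)) := by
      rw [abs_mul, abs_of_pos (by positivity : 0 < (l / b) ^ 2)]; gcongr
    have a2 : |ux * (wt * l ^ 2 + l ^ 2 * bx / b ^ 3)| ≤ |ux| * (2 * C ^ 4 + C ^ 6) := by
      rw [abs_mul]; gcongr; exact (abs_add_le _ _).trans (by linarith)
    have a3 := abs_add_le ((l / b) ^ 2 * (b ^ 2 * ut - uxx)) (ux * (wt * l ^ 2 + l ^ 2 * bx / b ^ 3))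
    have a4 : C ^ 4 * (C * (|u| + |ux|)) + |ux| * (2 * C ^ 4 + C ^ 6) =
      C ^ 5 * |u| + (C ^ 5 + 2 * C ^ 4 + C ^ 6) * |ux| := by ring
    have a5 : (C ^ 5 + 2 * C ^ 4 + C ^ 6) * |ux| ≤ (C ^ 5 + 2 * C ^ 4 + C ^ 6) *
      (C ^ 2 * |ux * (l / b)|) := by gcongr
    have a6 : (C ^ 5 + 2 * C ^ 4 + C ^ 6) * (C ^ 2 * |ux * (l / b)|) =
      (C ^ 7 + 2 * C ^ 6 + C ^ 8) * |ux * (l / b)| := by ring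
    have p5 := pw 5 (by norm_num)
    have p6 := pw 6 (by norm_num)
    have p7 := pw 7 (by norm_num)
    have p8 := pw 8 (by norm_num)
    have p0 : 0 < C ^ 10 := by positivity
    have a7 : (C ^ 7 + 2 * C ^ 6 + C ^ 8) * |ux * (l / b)| ≤ (10 * C ^ 10) * |ux * (l / b)| := by
      gcongr; linarith
    have a8 : C ^ 5 * |u| ≤ (10 * C ^ 10) * |u| := by gcongr; linarith
    linarith

theorem RF.toNF (h : RF U Ux Uxx Ut β βx βt p q C) (w : WF β W Wt L p q C)
    (z0 : ∀ t ∈ Ioo p q, U 0 t = 0) (z1 : ∀ t ∈ Ioo p q, U 1 t = 0) {θ : ℝ → ℝ} {S : ℝ}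
    (hS : 0 < S) (hθ : ∀ s ∈ Ioo 0 S, θ s ∈ Ioo p q ∧ HasDerivAt θ (L (θ s) ^ 2) s) :
    NF (fun y s => U (W y (θ s)) (θ s))
      (fun y s => Ux (W y (θ s)) (θ s) * (L (θ s) / β (W y (θ s)) (θ s)))
      (fun y s => Uxx (W y (θ s)) (θ s) * (L (θ s) / β (W y (θ s)) (θ s)) ^ 2 -
        Ux (W y (θ s)) (θ s) * (L (θ s) ^ 2 * βx (W y (θ s)) (θ s) / β (W y (θ s)) (θ s) ^ 3))
      (fun y s => (Ut (W y (θ s)) (θ s) + Ux (W y (θ s)) (θ s) * Wt y (θ s)) * L (θ s) ^ 2)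
      S (10 * C ^ 10) := by
  have C1 := h.C1
  have hC0 : 0 < C := by linarith
  have hCi : 0 < C⁻¹ := by positivity
  have hCC : ∀ n, n ≤ 10 → C ^ n ≤ 10 * C ^ 10 := fun n hn => by
    have := pow_le_pow_right₀ C1 hn
    have : 0 < C ^ 10 := by positivity
    linarith
  have B := fun s (hs : s ∈ Ioo 0 S) y (hy : y ∈ Ioo (0:ℝ) 1) =>
    let T := (hθ s hs).1
    let Y := w.int T hy
    let Y' := Ioo_subset_Icc_self Y
    nf_bounds C1 (h.b0 _ T _ Y') (h.b1 _ T _ Y') (h.b2 _ T _ Y) (h.bt _ T _ Y) (h.βl _ T _ Y')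
      (h.βxb _ T _ Y) (w.Ll _ T) (w.Lu _ T) (h.βu _ T _ Y') (w.Wtb _ T _ hy) (h.eq _ T _ Y)
  have hβ0 : ∀ t ∈ Ioo p q, ∀ x ∈ Icc (0:ℝ) 1, 0 < β x t := fun t ht x hx =>
    hCi.trans_le (h.βl t ht x hx)
  -- curve continuity
  have hcur : ∀ s ∈ Ioo 0 S, ∀ y ∈ Ioo (0:ℝ) 1,
      ContinuousAt (fun s => (W y (θ s), θ s)) s := by
    intro s hs y hy
    have hc := (hθ s hs).2.continuousAt
    exact (ContinuousAt.comp (f := θ) (g := fun t => W y t)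
      (w.Wdt _ (hθ s hs).1 y hy).continuousAt hc).prodMk hc
  have hLs : ∀ s ∈ Ioo 0 S, ContinuousAt (fun s => L (θ s)) s := fun s hs =>
    ContinuousAt.comp (f := θ) (g := L) (w.Lc _ (hθ s hs).1) (hθ s hs).2.continuousAt
  have hlift : ∀ (f : ℝ → ℝ → ℝ), ∀ s ∈ Ioo 0 S, ∀ y ∈ Ioo (0:ℝ) 1,
      ContinuousAt (fun p : ℝ × ℝ => f p.1 p.2) (W y (θ s), θ s) →
      ContinuousAt (fun s => f (W y (θ s)) (θ s)) s := by
    intro f s hs y hy hf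
    exact ContinuousAt.comp (f := fun s => (W y (θ s), θ s))
      (g := fun p : ℝ × ℝ => f p.1 p.2) hf (hcur s hs y hy)
  have hd1 : ∀ t ∈ Ioo p q, ∀ y ∈ Ioo (0:ℝ) 1, HasDerivAt (fun y => U (W y t) t)
      (Ux (W y t) t * (L t / β (W y t) t)) y := by
    intro t ht y hy
    exact (h.d1 t ht _ (w.int ht hy)).comp y (w.Wd t ht y hy)
  have hd2 : ∀ t ∈ Ioo p q, ∀ y ∈ Ioo (0:ℝ) 1, HasDerivAt (fun y => Ux (W y t) t * (L t / β (W y t) t))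
      (Uxx (W y t) t * (L t / β (W y t) t) ^ 2 -
        Ux (W y t) t * (L t ^ 2 * βx (W y t) t / β (W y t) t ^ 3)) y := by
    intro t ht y hy
    have a := (h.d2 t ht _ (w.int ht hy)).comp y (w.Wd t ht y hy)
    have b := (h.βd t ht _ (w.int ht hy)).comp y (w.Wd t ht y hy)
    have hb := hβ0 t ht _ (Ioo_subset_Icc_self (w.int ht hy))
    have c := a.mul ((hasDerivAt_const y (L t)).div b hb.ne')
    have e : Uxx (W y t) t * (L t / β (W y t) t) ^ 2 -
        Ux (W y t) t * (L t ^ 2 * βx (W y t) t / β (W y t) t ^ 3) =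
        Uxx (W y t) t * (L t / β (W y t) t) * (L t / β (W y t) t) + Ux (W y t) t *
        ((0 * β (W y t) t - L t * (βx (W y t) t * (L t / β (W y t) t))) / β (W y t) t ^ 2) := by
      field_simp
      ring
    rw [e]
    exact c
  have he2 : ∀ t ∈ Ioo p q, ∀ y ∈ Ioo (0:ℝ) 1, ContinuousAt (fun y =>
      Uxx (W y t) t * (L t / β (W y t) t) ^ 2 -
        Ux (W y t) t * (L t ^ 2 * βx (W y t) t / β (W y t) t ^ 3)) y := by
    intro t ht y hy
    have hw := w.int ht hy
    have hcu : ContinuousAt (fun y => (W y t, t)) y :=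
      (w.Wc t ht).continuousAt.prodMk continuousAt_const
    have l : ∀ f : ℝ → ℝ → ℝ, ContinuousAt (fun p : ℝ × ℝ => f p.1 p.2) (W y t, t) →
        ContinuousAt (fun y => f (W y t) t) y := fun f hf =>
      ContinuousAt.comp (f := fun y => (W y t, t)) (g := fun p : ℝ × ℝ => f p.1 p.2) hf hcu
    have hb := (hβ0 t ht _ (Ioo_subset_Icc_self hw)).ne'
    have lb := l _ (h.βe t ht _ hw)
    exact ((l _ (h.e2 t ht _ hw)).mul ((continuousAt_const.div lb hb).pow 2)).sub
      ((l _ (h.e1 t ht _ hw)).mul ((continuousAt_const.mul (l _ (h.βxe t ht _ hw))).div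
        (lb.pow 3) (pow_ne_zero 3 hb)))
  constructor
  · exact hS
  · linarith [hCC 0 (by norm_num), pow_zero C]
  · intro s hs
    exact (h.c0 _ (hθ s hs).1).comp (w.Wc _ (hθ s hs).1).continuousOn
      (fun y hy => w.icc (hθ s hs).1 hy)
  · intro s hs
    have m : MapsTo (fun y => W y (θ s)) (Icc 0 1) (Icc 0 1) := fun y hy => w.icc (hθ s hs).1 hy
    have c := (w.Wc _ (hθ s hs).1).continuousOn (s := Icc 0 1)
    exact ((h.c1 _ (hθ s hs).1).comp c m).mul (continuousOn_const.div
      ((h.βc _ (hθ s hs).1).comp c m) (fun y hy => (hβ0 _ (hθ s hs).1 _ (m hy)).ne'))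
  · intro s hs y hy
    exact (he2 _ (hθ s hs).1 y hy).continuousWithinAt
  · intro s hs y hy
    exact hd1 _ (hθ s hs).1 y hy
  · intro s hs y hy
    exact hd2 _ (hθ s hs).1 y hy
  · intro s hs y hy
    have ht := (hθ s hs).1
    have hw := w.int ht hy
    have c := chain2 (f := U) (fx := Ux) (γ := fun t => W y t) (t := θ s)
      (by
        have i1 : ∀ᶠ z : ℝ × ℝ in 𝓝 (W y (θ s), θ s), z.1 ∈ Ioo (0:ℝ) 1 :=
          continuousAt_fst.eventually (isOpen_Ioo.mem_nhds hw)
        have i2 : ∀ᶠ z : ℝ × ℝ in 𝓝 (W y (θ s), θ s), z.2 ∈ Ioo p q :=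
          continuousAt_snd.eventually (isOpen_Ioo.mem_nhds ht)
        filter_upwards [i1, i2] with z hz1 hz2
        exact h.d1 _ hz2 _ hz1)
      (h.e1 _ ht _ hw) (h.dt _ ht _ hw) (w.Wdt _ ht y hy)
    exact c.comp s (hθ s hs).2
  · intro s hs y hy
    have ht := (hθ s hs).1
    have hw := w.int ht hy
    exact (hlift Ux s hs y hy (h.e1 _ ht _ hw)).mul ((hLs s hs).div
      (hlift β s hs y hy (h.βe _ ht _ hw)) (hβ0 _ ht _ (Ioo_subset_Icc_self hw)).ne')
  · intro s hs y hy
    have ht := (hθ s hs).1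
    have hw := w.int ht hy
    have hb := (hβ0 _ ht _ (Ioo_subset_Icc_self hw)).ne'
    have lb := hlift β s hs y hy (h.βe _ ht _ hw)
    exact ((hlift Uxx s hs y hy (h.e2 _ ht _ hw)).mul (((hLs s hs).div lb hb).pow 2)).sub
      ((hlift Ux s hs y hy (h.e1 _ ht _ hw)).mul
      ((((hLs s hs).pow 2).mul (hlift βx s hs y hy (h.βxe _ ht _ hw))).div (lb.pow 3)
        (pow_ne_zero 3 hb)))
  · intro s hs y hy
    exact (h.b0 _ (hθ s hs).1 _ (w.icc (hθ s hs).1 hy)).trans (by simpa using hCC 1 (by norm_num))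
  · intro s hs y hy
    have ht := (hθ s hs).1
    have hw := w.icc ht hy
    have hb := hβ0 _ ht _ hw
    have hl := hCi.trans_le (w.Ll _ ht)
    have hbi : (β (W y (θ s)) (θ s))⁻¹ ≤ C := by
      rw [inv_le_comm₀ hb hC0]; exact h.βl _ ht _ hw
    have hlu := w.Lu _ ht
    rw [abs_mul, div_eq_mul_inv, abs_of_pos (by positivity : 0 < L (θ s) * (β (W y (θ s)) (θ s))⁻¹)]
    calc _ ≤ C * (C * C) := by
          have := h.b1 _ ht _ hw
          gcongr
      _ = C ^ 3 := by ring
      _ ≤ _ := hCC 3 (by norm_num)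
  · exact fun s hs y hy => (B s hs y hy).1
  · exact fun s hs y hy => (B s hs y hy).2.1
  · exact fun s hs y hy => (B s hs y hy).2.2
  · intro s hs
    rw [w.W0 _ (hθ s hs).1, z0 _ (hθ s hs).1]
  · intro s hs
    rw [w.W1 _ (hθ s hs).1, z1 _ (hθ s hs).1]
  · intro s hs
    have ht := (hθ s hs).1
    obtain ⟨x, hx, hne⟩ := h.nz _ ht
    have hx' : x ∈ Icc (W 0 (θ s)) (W 1 (θ s)) := by rw [w.W0 _ ht, w.W1 _ ht]; exact hx
    obtain ⟨y, hy, hyx⟩ := intermediate_value_Icc zero_le_one (w.Wc _ ht).continuousOn hx'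
    simp only at hyx
    refine ⟨y, ⟨lt_of_le_of_ne hy.1 ?_, lt_of_le_of_ne hy.2 ?_⟩, by rwa [hyx]⟩
    · rintro rfl
      rw [w.W0 _ ht] at hyx
      rw [← hyx, z0 _ ht] at hne; exact hne rfl
    · rintro rfl
      rw [w.W1 _ ht] at hyx
      rw [← hyx, z1 _ ht] at hne; exact hne rfl

theorem RF.fin (h : RF U Ux Uxx Ut β βx βt p q C)
    (z0 : ∀ t ∈ Ioo p q, U 0 t = 0) (z1 : ∀ t ∈ Ioo p q, U 1 t = 0) :
    ∃ t ∈ Ioo p q, {x ∈ Icc (0:ℝ) 1 | U x t = 0}.Finite := by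
  obtain ⟨W, Wt, L, w⟩ := exists_WF h.C1 h.βc h.βl h.βu h.βdt h.βe h.βtb
  obtain ⟨θ, S, hS, hθ⟩ := exists_theta h.C1 h.pq w.Ll w.Lu w.Lc
  obtain ⟨s, hs, hf⟩ := (h.toNF w z0 z1 hS hθ).main
  have ht := (hθ s hs).1
  refine ⟨θ s, ht, (hf.image (fun y => W y (θ s))).subset ?_⟩
  rintro x ⟨hx, hxz⟩
  have hx' : x ∈ Icc (W 0 (θ s)) (W 1 (θ s)) := by rw [w.W0 _ ht, w.W1 _ ht]; exact hx
  obtain ⟨y, hy, hyx⟩ := intermediate_value_Icc zero_le_one (w.Wc _ ht).continuousOn hx'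
  simp only at hyx
  exact ⟨y, ⟨hy, by rw [hyx]; exact hxz⟩, hyx⟩
end


theorem RF.lip {U Ux Uxx Ut β βx βt : ℝ → ℝ → ℝ} {p q C : ℝ} (h : RF U Ux Uxx Ut β βx βt p q C)
    {t : ℝ} (ht : t ∈ Ioo p q) {x y : ℝ} (hx : x ∈ Icc (0:ℝ) 1) (hy : y ∈ Icc (0:ℝ) 1) :
    |U y t - U x t| ≤ C * |y - x| := by
  have key : ∀ x y, x ∈ Icc (0:ℝ) 1 → y ∈ Icc (0:ℝ) 1 → x < y → |U y t - U x t| ≤ C * |y - x| := by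
    intro x y hx hy hxy
    obtain ⟨z, hz, e⟩ := exists_hasDerivAt_eq_slope (fun x => U x t) (fun x => Ux x t) hxy
      ((h.c0 t ht).mono (Icc_subset_Icc hx.1 hy.2))
      (fun z hz => h.d1 t ht z ⟨lt_of_le_of_lt hx.1 hz.1, lt_of_lt_of_le hz.2 hy.2⟩)
    have hne : y - x ≠ 0 := by linarith
    rw [eq_div_iff hne] at e
    rw [← e, abs_mul]
    exact mul_le_mul_of_nonneg_right
      (h.b1 t ht z ⟨hx.1.trans hz.1.le, hz.2.le.trans hy.2⟩) (abs_nonneg _)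
  rcases lt_trichotomy x y with hl | hl | hl
  · exact key x y hx hy hl
  · simp [hl]
  · rw [abs_sub_comm, abs_sub_comm y x]; exact key y x hy hx hl

theorem RF.e0 {U Ux Uxx Ut β βx βt : ℝ → ℝ → ℝ} {p q C : ℝ} (h : RF U Ux Uxx Ut β βx βt p q C) :
    ∀ t ∈ Ioo p q, ∀ x ∈ Ioo (0:ℝ) 1, ContinuousAt (fun p : ℝ × ℝ => U p.1 p.2) (x, t) := by
  intro t ht x hx
  have h2 : Tendsto (fun r : ℝ × ℝ => U x r.2) (𝓝 (x, t)) (𝓝 (U x t)) :=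
    ((h.dt t ht x hx).continuousAt.tendsto).comp continuous_snd.continuousAt.tendsto
  have h1 : Tendsto (fun r : ℝ × ℝ => U r.1 r.2 - U x r.2) (𝓝 (x, t)) (𝓝 0) := by
    have h3 : Tendsto (fun r : ℝ × ℝ => C * |r.1 - x|) (𝓝 (x, t)) (𝓝 0) := by
      have : Continuous (fun r : ℝ × ℝ => C * |r.1 - x|) := by fun_prop
      simpa using this.tendsto (x, t)
    refine squeeze_zero_norm' ?_ h3
    have hev : ∀ᶠ r : ℝ × ℝ in 𝓝 (x, t), r.1 ∈ Ioo (0:ℝ) 1 ∧ r.2 ∈ Ioo p q :=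
      (prod_mem_nhds (Ioo_mem_nhds hx.1 hx.2) (Ioo_mem_nhds ht.1 ht.2))
    filter_upwards [hev] with r hr
    exact h.lip hr.2 (Ioo_subset_Icc_self hx) (Ioo_subset_Icc_self hr.1)
  have := h1.add h2
  simpa [ContinuousAt] using this

theorem mul_arith {C m D N r A B : ℝ} (hC : 1 ≤ C) (hm : 0 < m) (hDm : D * m = 4 * C)
    (hD0 : 0 < D) (B0 : A ≤ C) (B1 : B ≤ C) (hd : r ≤ 1) (T3 : A ≤ N + r * B) (T4 : r * B ≤ N + A)
    (T5 : m ≤ A + C * r) (n1 : 0 ≤ r) (n2 : 0 ≤ A) (n3 : 0 ≤ B) (hN : 0 ≤ N) :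
    r * (C * (A + B)) + 2 * B ≤ (3 * C + 2 * C * D + 2 * D + 2 * D ^ 2) * (r * A + N) := by
  have hC0 : 0 < C := by linarith
  by_cases hr : 1 ≤ D * r
  · have F1 : A ≤ D * (r * A) := by
      calc A = 1 * A := by ring
        _ ≤ (D * r) * A := mul_le_mul_of_nonneg_right hr n2
        _ = _ := by ring
    have F2 : B ≤ D * N + D * A := by
      calc B = 1 * B := by ring
        _ ≤ (D * r) * B := mul_le_mul_of_nonneg_right hr n3
        _ = D * (r * B) := by ring
        _ ≤ D * (N + A) := mul_le_mul_of_nonneg_left T4 hD0.le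
        _ = _ := by ring
    have F3 : D * A ≤ D ^ 2 * (r * A) := by
      calc D * A ≤ D * (D * (r * A)) := mul_le_mul_of_nonneg_left F1 hD0.le
        _ = _ := by ring
    have hrA : 0 ≤ r * A := by positivity
    have G1 : C * (r * B) ≤ C * (N + D * (r * A)) :=
      mul_le_mul_of_nonneg_left (by linarith) (by linarith)
    have P : 0 ≤ 2 * (C * (r * A)) + 2 * (C * N) + C * (D * (r * A)) + 2 * (C * (D * N))
      + 2 * (D * (r * A)) + 2 * (D ^ 2 * N) := by positivity
    linarith
  · push Not at hr
    have F1 : 4 * C * r ≤ m := by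
      calc 4 * C * r = (D * r) * m := by rw [← hDm]; ring
        _ ≤ 1 * m := mul_le_mul_of_nonneg_right hr.le hm.le
        _ = m := one_mul m
    have F2 : r * B ≤ r * C := mul_le_mul_of_nonneg_left B1 n1
    have F3 : m ≤ 2 * N := by linarith
    have G1 : r * (C * (A + B)) ≤ 1 * (C * (2 * C)) := by
      have : C * (A + B) ≤ C * (2 * C) :=
        mul_le_mul_of_nonneg_left (by linarith) (by linarith)
      exact mul_le_mul hd this (by positivity) (by norm_num)
    have G2 : 2 * C ≤ D * N := by
      have : D * m ≤ D * (2 * N) := mul_le_mul_of_nonneg_left F3 hD0.le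
      linarith
    have G3 : C * (2 * C) ≤ C * (D * N) := mul_le_mul_of_nonneg_left G2 hC0.le
    have P0 : 0 ≤ (3 * C + 2 * C * D + 2 * D + 2 * D ^ 2) * (r * A) := by positivity
    have P1 : 0 ≤ (3 * C + C * D + D + 2 * D ^ 2) * N := by positivity
    linarith

theorem RF.mul {U Ux Uxx Ut β βx βt : ℝ → ℝ → ℝ} {p q C : ℝ} (h : RF U Ux Uxx Ut β βx βt p q C)
    {e m : ℝ} (he : e ∈ Icc (0:ℝ) 1) (hm : 0 < m) (hU : ∀ t ∈ Ioo p q, m ≤ |U e t|) :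
    ∃ C', RF (fun x t => (x - e) * U x t) (fun x t => (x - e) * Ux x t + U x t)
      (fun x t => (x - e) * Uxx x t + 2 * Ux x t) (fun x t => (x - e) * Ut x t) β βx βt p q C' := by
  have hC := h.C1
  set D : ℝ := 4 * C / m with hD
  have hD0 : 0 < D := by positivity
  have hDm : D * m = 4 * C := by rw [hD]; field_simp
  set C' : ℝ := 3 * C + 2 * C * D + 2 * D + 2 * D ^ 2 with hC'
  have hCC : 3 * C ≤ C' := by
    have : 0 ≤ 2 * C * D + 2 * D + 2 * D ^ 2 := by positivity
    rw [hC']; linarith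
  have hxe : ∀ x ∈ Icc (0:ℝ) 1, |x - e| ≤ 1 := fun x hx => by
    rw [abs_le]; constructor <;> linarith [hx.1, hx.2, he.1, he.2]
  have cx : ∀ x t : ℝ, ContinuousAt (fun p : ℝ × ℝ => p.1 - e) (x, t) := fun x t => by fun_prop
  have mulb : ∀ x ∈ Icc (0:ℝ) 1, ∀ A, |A| ≤ C → |(x - e) * A| ≤ C := fun x hx A hA => by
    rw [abs_mul]
    nlinarith [hxe x hx, abs_nonneg (x - e), abs_nonneg A]
  refine ⟨C', ?_⟩
  have dd : ∀ x, HasDerivAt (fun x : ℝ => x - e) 1 x := fun x => (hasDerivAt_id x).sub_const e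
  constructor
  · exact h.pq
  · linarith
  · intro t ht; exact (by fun_prop : ContinuousOn (fun x : ℝ => x - e) (Icc 0 1)).mul (h.c0 t ht)
  · intro t ht
    exact ((by fun_prop : ContinuousOn (fun x : ℝ => x - e) (Icc 0 1)).mul (h.c1 t ht)).add (h.c0 t ht)
  · intro t ht x hx
    exact ((dd x).mul (h.d1 t ht x hx)).congr_deriv (by ring)
  · intro t ht x hx
    exact (((dd x).mul (h.d2 t ht x hx)).add (h.d1 t ht x hx)).congr_deriv (by ring)
  · intro t ht x hx
    exact (h.dt t ht x hx).const_mul _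
  · intro t ht x hx
    exact ((cx x t).mul (h.e1 t ht x hx)).add (h.e0 t ht x hx)
  · intro t ht x hx
    exact ((cx x t).mul (h.e2 t ht x hx)).add ((h.e1 t ht x hx).const_mul 2)
  · intro t ht x hx
    linarith [mulb x hx _ (h.b0 t ht x hx)]
  · intro t ht x hx
    have := abs_add_le ((x - e) * Ux x t) (U x t)
    linarith [mulb x hx _ (h.b1 t ht x hx), h.b0 t ht x hx]
  · intro t ht x hx
    have h1 := Ioo_subset_Icc_self hx
    have := abs_add_le ((x - e) * Uxx x t) (2 * Ux x t)
    rw [abs_mul 2, abs_two] at this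
    linarith [mulb x h1 _ (h.b2 t ht x hx), h.b1 t ht x h1]
  · intro t ht x hx
    have h1 := Ioo_subset_Icc_self hx
    linarith [mulb x h1 _ (h.bt t ht x hx)]
  · intro t ht x hx
    have h1 := Ioo_subset_Icc_self hx
    have E := h.eq t ht x hx
    have B0 := h.b0 t ht x h1
    have B1 := h.b1 t ht x h1
    have L := h.lip ht he h1
    have hm' := hU t ht
    have hd := hxe x h1
    have rw1 : β x t ^ 2 * ((x - e) * Ut x t) - ((x - e) * Uxx x t + 2 * Ux x t)
      = (x - e) * (β x t ^ 2 * Ut x t - Uxx x t) - 2 * Ux x t := by ring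
    rw [rw1]
    have T1 := abs_sub ((x - e) * (β x t ^ 2 * Ut x t - Uxx x t)) (2 * Ux x t)
    rw [abs_mul, abs_mul 2, abs_two] at T1
    have T2 : |x - e| * |β x t ^ 2 * Ut x t - Uxx x t| ≤ |x - e| * (C * (|U x t| + |Ux x t|)) :=
      mul_le_mul_of_nonneg_left E (abs_nonneg _)
    refine (T1.trans (add_le_add_left T2 _)).trans ?_
    have T3 : |U x t| ≤ |(x - e) * Ux x t + U x t| + |x - e| * |Ux x t| := by
      have := abs_sub ((x - e) * Ux x t + U x t) ((x - e) * Ux x t)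
      rw [add_sub_cancel_left, abs_mul] at this
      exact this
    have T4 : |x - e| * |Ux x t| ≤ |(x - e) * Ux x t + U x t| + |U x t| := by
      have := abs_sub ((x - e) * Ux x t + U x t) (U x t)
      rw [add_sub_cancel_right, abs_mul] at this
      exact this
    have T5 : m ≤ |U x t| + C * |x - e| := by
      have := abs_sub (U x t) (U x t - U e t)
      rw [sub_sub_cancel] at this
      linarith
    rw [abs_mul (x - e) (U x t)]
    have hN := abs_nonneg ((x - e) * Ux x t + U x t)
    have n1 := abs_nonneg (x - e)
    have n2 := abs_nonneg (U x t)
    have n3 := abs_nonneg (Ux x t)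
    exact mul_arith hC hm hDm hD0 B0 B1 hd T3 T4 T5 n1 n2 n3 hN
  · intro t ht
    obtain ⟨x, hx, hne⟩ := h.nz t ht
    have : ∃ y ∈ Icc (0:ℝ) 1, y ≠ e ∧ U y t ≠ 0 := by
      set d := min (1/2) (m / (2 * C)) with hd
      have hd0 : 0 < d := by positivity
      have hd1 : d ≤ 1 / 2 := min_le_left _ _
      have hd2 : C * d < m := by
        have : d ≤ m / (2 * C) := min_le_right _ _
        rw [le_div_iff₀ (by positivity)] at this
        nlinarith
      have gen : ∀ y ∈ Icc (0:ℝ) 1, |y - e| = d → y ≠ e ∧ U y t ≠ 0 := by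
        intro y hy hyd
        constructor
        · rintro rfl; simp at hyd; linarith
        · intro h0
          have L := h.lip ht he hy
          rw [hyd, h0, zero_sub, abs_neg] at L
          linarith [hU t ht]
      by_cases hh : e ≤ 1 / 2
      · have hy : e + d ∈ Icc (0:ℝ) 1 := ⟨by linarith [he.1], by linarith⟩
        exact ⟨e + d, hy, gen _ hy (by simp [abs_of_pos hd0])⟩
      · have hy : e - d ∈ Icc (0:ℝ) 1 := ⟨by linarith, by linarith [he.2]⟩
        exact ⟨e - d, hy, gen _ hy (by simp [abs_of_pos hd0])⟩
    obtain ⟨y, hy, hye, h0⟩ := this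
    exact ⟨y, hy, mul_ne_zero (sub_ne_zero.2 hye) h0⟩
  · exact h.βc
  · intro t ht x hx
    refine le_trans ?_ (h.βl t ht x hx)
    exact inv_anti₀ (by linarith) (by linarith)
  · intro t ht x hx
    linarith [h.βu t ht x hx]
  · exact h.βd
  · exact h.βdt
  · exact h.βe
  · exact h.βxe
  · intro t ht x hx
    linarith [h.βxb t ht x hx]
  · intro t ht x hx
    linarith [h.βtb t ht x hx]

theorem RF.fin2 {U Ux Uxx Ut β βx βt : ℝ → ℝ → ℝ} {p q C : ℝ} (h : RF U Ux Uxx Ut β βx βt p q C)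
    (z0 : ∀ t ∈ Ioo p q, U 0 t = 0)
    (z1 : (∀ t ∈ Ioo p q, U 1 t = 0) ∨ ∃ m > 0, ∀ t ∈ Ioo p q, m ≤ |U 1 t|) :
    ∃ t ∈ Ioo p q, {x ∈ Icc (0:ℝ) 1 | U x t = 0}.Finite := by
  rcases z1 with z1 | ⟨m, hm, z1⟩
  · exact h.fin z0 z1
  · obtain ⟨C', h'⟩ := h.mul (e := 1) (by simp) hm z1
    obtain ⟨t, ht, hf⟩ := h'.fin (fun t ht => by simp [z0 t ht]) (fun t ht => by simp)
    exact ⟨t, ht, hf.subset fun x hx => ⟨hx.1, by simp [hx.2]⟩⟩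

theorem RF.fin3 {U Ux Uxx Ut β βx βt : ℝ → ℝ → ℝ} {p q C : ℝ} (h : RF U Ux Uxx Ut β βx βt p q C)
    (z0 : (∀ t ∈ Ioo p q, U 0 t = 0) ∨ ∃ m > 0, ∀ t ∈ Ioo p q, m ≤ |U 0 t|)
    (z1 : (∀ t ∈ Ioo p q, U 1 t = 0) ∨ ∃ m > 0, ∀ t ∈ Ioo p q, m ≤ |U 1 t|) :
    ∃ t ∈ Ioo p q, {x ∈ Icc (0:ℝ) 1 | U x t = 0}.Finite := by
  rcases z0 with z0 | ⟨m, hm, z0⟩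
  · exact h.fin2 z0 z1
  · obtain ⟨C', h'⟩ := h.mul (e := 0) (by simp) hm z0
    obtain ⟨t, ht, hf⟩ := h'.fin2 (fun t ht => by simp) (by simpa using z1)
    exact ⟨t, ht, hf.subset fun x hx => ⟨hx.1, by simp [hx.2]⟩⟩


theorem mkRF {u ux uxx ut A Ax At a b c : ℝ → ℝ → ℝ} {l r l' r' : ℝ → ℝ} {p q D : ℝ}
    (pq : p < q) (D1 : 1 ≤ D)
    (hl : ∀ t ∈ Ioo p q, HasDerivAt l (l' t) t) (hr : ∀ t ∈ Ioo p q, HasDerivAt r (r' t) t)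
    (bl : ∀ t ∈ Ioo p q, |l' t| ≤ D) (br : ∀ t ∈ Ioo p q, |r' t| ≤ D)
    (g1 : ∀ t ∈ Ioo p q, D⁻¹ ≤ r t - l t) (g2 : ∀ t ∈ Ioo p q, r t - l t ≤ D)
    (u0 : ∀ t ∈ Ioo p q, ∀ x ∈ Icc (l t) (r t), |u x t| ≤ D)
    (u1 : ∀ t ∈ Ioo p q, ∀ x ∈ Icc (l t) (r t), |ux x t| ≤ D)
    (u2 : ∀ t ∈ Ioo p q, ∀ x ∈ Icc (l t) (r t), |uxx x t| ≤ D)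
    (u3 : ∀ t ∈ Ioo p q, ∀ x ∈ Icc (l t) (r t), |ut x t| ≤ D)
    (d1 : ∀ t ∈ Ioo p q, ∀ x ∈ Icc (l t) (r t), HasDerivAt (fun x => u x t) (ux x t) x)
    (d2 : ∀ t ∈ Ioo p q, ∀ x ∈ Icc (l t) (r t), HasDerivAt (fun x => ux x t) (uxx x t) x)
    (d3 : ∀ t ∈ Ioo p q, ∀ x ∈ Icc (l t) (r t), HasDerivAt (fun t => u x t) (ut x t) t)
    (a1 : ∀ t ∈ Ioo p q, ∀ x ∈ Icc (l t) (r t), D⁻¹ ≤ A x t)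
    (a2 : ∀ t ∈ Ioo p q, ∀ x ∈ Icc (l t) (r t), A x t ≤ D)
    (a3 : ∀ t ∈ Ioo p q, ∀ x ∈ Icc (l t) (r t), |Ax x t| ≤ D)
    (a4 : ∀ t ∈ Ioo p q, ∀ x ∈ Icc (l t) (r t), |At x t| ≤ D)
    (a5 : ∀ t ∈ Ioo p q, ∀ x ∈ Icc (l t) (r t), HasDerivAt (fun x => A x t) (Ax x t) x)
    (a6 : ∀ t ∈ Ioo p q, ∀ x ∈ Icc (l t) (r t), HasDerivAt (fun t => A x t) (At x t) t)
    (a7 : ∀ t ∈ Ioo p q, ∀ x ∈ Icc (l t) (r t), A x t ^ 2 * a x t = 1)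
    (hb : ∀ t ∈ Ioo p q, ∀ x ∈ Icc (l t) (r t), |b x t| ≤ D)
    (hc : ∀ t ∈ Ioo p q, ∀ x ∈ Icc (l t) (r t), |c x t| ≤ D)
    (eqn : ∀ t ∈ Ioo p q, ∀ x ∈ Icc (l t) (r t),
      ut x t = a x t * uxx x t + b x t * ux x t + c x t * u x t)
    (k1 : ∀ t ∈ Ioo p q, ∀ x ∈ Ioo (l t) (r t), ContinuousAt (fun p : ℝ × ℝ => ux p.1 p.2) (x, t))
    (k2 : ∀ t ∈ Ioo p q, ∀ x ∈ Ioo (l t) (r t), ContinuousAt (fun p : ℝ × ℝ => uxx p.1 p.2) (x, t))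
    (k3 : ∀ t ∈ Ioo p q, ∀ x ∈ Ioo (l t) (r t), ContinuousAt (fun p : ℝ × ℝ => A p.1 p.2) (x, t))
    (k4 : ∀ t ∈ Ioo p q, ∀ x ∈ Ioo (l t) (r t), ContinuousAt (fun p : ℝ × ℝ => Ax p.1 p.2) (x, t))
    (nz : ∀ t ∈ Ioo p q, ∃ x ∈ Icc (l t) (r t), u x t ≠ 0) :
    RF (fun z t => u (l t + (r t - l t) * z) t)
      (fun z t => ux (l t + (r t - l t) * z) t * (r t - l t))
      (fun z t => uxx (l t + (r t - l t) * z) t * (r t - l t) ^ 2)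
      (fun z t => ut (l t + (r t - l t) * z) t
        + ux (l t + (r t - l t) * z) t * (l' t + (r' t - l' t) * z))
      (fun z t => (r t - l t) * A (l t + (r t - l t) * z) t)
      (fun z t => (r t - l t) * (Ax (l t + (r t - l t) * z) t * (r t - l t)))
      (fun z t => (r' t - l' t) * A (l t + (r t - l t) * z) t + (r t - l t) *
        (At (l t + (r t - l t) * z) t
        + Ax (l t + (r t - l t) * z) t * (l' t + (r' t - l' t) * z)))
      p q (8 * D ^ 6) := by
  have D0 : 0 < D := by linarith
  have gp : ∀ t ∈ Ioo p q, 0 < r t - l t := fun t ht => lt_of_lt_of_le (by positivity) (g1 t ht)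
  have ga : ∀ t ∈ Ioo p q, |r t - l t| ≤ D := fun t ht => by
    rw [abs_of_pos (gp t ht)]; exact g2 t ht
  have hI : ∀ t ∈ Ioo p q, ∀ z ∈ Icc (0:ℝ) 1, l t + (r t - l t) * z ∈ Icc (l t) (r t) := by
    intro t ht z hz
    have := gp t ht
    constructor
    · nlinarith [hz.1]
    · nlinarith [hz.2]
  have hO : ∀ t ∈ Ioo p q, ∀ z ∈ Ioo (0:ℝ) 1, l t + (r t - l t) * z ∈ Ioo (l t) (r t) := by
    intro t ht z hz
    have := gp t ht
    constructor
    · nlinarith [hz.1]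
    · nlinarith [hz.2]
  have hφz : ∀ t z, HasDerivAt (fun z => l t + (r t - l t) * z) (r t - l t) z := by
    intro t z
    exact (((hasDerivAt_id z).const_mul (r t - l t)).const_add (l t)).congr_deriv (by ring)
  have hφt : ∀ t ∈ Ioo p q, ∀ z,
      HasDerivAt (fun t => l t + (r t - l t) * z) (l' t + (r' t - l' t) * z) t := by
    intro t ht z
    exact (hl t ht).add (((hr t ht).sub (hl t ht)).mul_const z)
  have bφt : ∀ t ∈ Ioo p q, ∀ z ∈ Icc (0:ℝ) 1, |l' t + (r' t - l' t) * z| ≤ D := by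
    intro t ht z hz
    have h1 := abs_le.1 (bl t ht)
    have h2 := abs_le.1 (br t ht)
    rw [abs_le]
    constructor <;> nlinarith [hz.1, hz.2]
  have cg : ∀ t ∈ Ioo p q, ∀ z : ℝ, ContinuousAt (fun p : ℝ × ℝ => r p.2 - l p.2) (z, t) := by
    intro t ht z
    have h1 : ContinuousAt (fun t => r t - l t) t :=
      (hr t ht).continuousAt.sub (hl t ht).continuousAt
    exact ContinuousAt.comp (g := fun t => r t - l t) (f := fun p : ℝ × ℝ => p.2) (x := (z, t)) h1
      continuous_snd.continuousAt
  have cΦ : ∀ t ∈ Ioo p q, ∀ z : ℝ,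
      ContinuousAt (fun p : ℝ × ℝ => (l p.2 + (r p.2 - l p.2) * p.1, p.2)) (z, t) := by
    intro t ht z
    have h1 : ContinuousAt (fun p : ℝ × ℝ => l p.2) (z, t) :=
      ContinuousAt.comp (g := l) (f := fun p : ℝ × ℝ => p.2) (x := (z, t)) (hl t ht).continuousAt
        continuous_snd.continuousAt
    exact (h1.add ((cg t ht z).mul continuous_fst.continuousAt)).prodMk continuous_snd.continuousAt
  have cc : ∀ F : ℝ → ℝ → ℝ, (∀ t ∈ Ioo p q, ∀ x ∈ Ioo (l t) (r t),
      ContinuousAt (fun p : ℝ × ℝ => F p.1 p.2) (x, t)) → ∀ t ∈ Ioo p q, ∀ z ∈ Ioo (0:ℝ) 1,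
      ContinuousAt (fun p : ℝ × ℝ => F (l p.2 + (r p.2 - l p.2) * p.1) p.2) (z, t) := by
    intro F hF t ht z hz
    exact ContinuousAt.comp (g := fun p : ℝ × ℝ => F p.1 p.2)
      (f := fun p : ℝ × ℝ => (l p.2 + (r p.2 - l p.2) * p.1, p.2)) (x := (z, t))
      (hF t ht _ (hO t ht z hz)) (cΦ t ht z)
  have ev : ∀ t ∈ Ioo p q, ∀ x ∈ Ioo (l t) (r t), ∀ᶠ w : ℝ × ℝ in 𝓝 (x, t),
      w.2 ∈ Ioo p q ∧ w.1 ∈ Ioo (l w.2) (r w.2) := by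
    intro t ht x hx
    have s2 : ContinuousAt (fun p : ℝ × ℝ => p.2) (x, t) := continuous_snd.continuousAt
    have s1 : ContinuousAt (fun p : ℝ × ℝ => p.1) (x, t) := continuous_fst.continuousAt
    have h1 : ContinuousAt (fun p : ℝ × ℝ => l p.2) (x, t) :=
      ContinuousAt.comp (g := l) (f := fun p : ℝ × ℝ => p.2) (x := (x, t)) (hl t ht).continuousAt s2
    have h2 : ContinuousAt (fun p : ℝ × ℝ => r p.2) (x, t) :=
      ContinuousAt.comp (g := r) (f := fun p : ℝ × ℝ => p.2) (x := (x, t)) (hr t ht).continuousAt s2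
    filter_upwards [s2.eventually (Ioo_mem_nhds ht.1 ht.2), h1.eventually_lt s1 hx.1,
      s1.eventually_lt h2 hx.2] with w w1 w2 w3
    exact ⟨w1, w2, w3⟩
  have ch : ∀ F Fx Ft : ℝ → ℝ → ℝ,
      (∀ t ∈ Ioo p q, ∀ x ∈ Icc (l t) (r t), HasDerivAt (fun x => F x t) (Fx x t) x) →
      (∀ t ∈ Ioo p q, ∀ x ∈ Icc (l t) (r t), HasDerivAt (fun t => F x t) (Ft x t) t) →
      (∀ t ∈ Ioo p q, ∀ x ∈ Ioo (l t) (r t), ContinuousAt (fun p : ℝ × ℝ => Fx p.1 p.2) (x, t)) →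
      ∀ t ∈ Ioo p q, ∀ z ∈ Ioo (0:ℝ) 1, HasDerivAt (fun t => F (l t + (r t - l t) * z) t)
        (Ft (l t + (r t - l t) * z) t
        + Fx (l t + (r t - l t) * z) t * (l' t + (r' t - l' t) * z)) t := by
    intro F Fx Ft h1 h2 h3 t ht z hz
    refine chain2 (γ := fun t => l t + (r t - l t) * z) ?_ (h3 t ht _ (hO t ht z hz))
      (h2 t ht _ (hI t ht z (Ioo_subset_Icc_self hz))) (hφt t ht z)
    filter_upwards [ev t ht _ (hO t ht z hz)] with w hw
    exact h1 _ hw.1 _ (Ioo_subset_Icc_self hw.2)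
  have chx : ∀ F Fx : ℝ → ℝ → ℝ,
      (∀ t ∈ Ioo p q, ∀ x ∈ Icc (l t) (r t), HasDerivAt (fun x => F x t) (Fx x t) x) →
      ∀ t ∈ Ioo p q, ∀ z ∈ Icc (0:ℝ) 1, HasDerivAt (fun z => F (l t + (r t - l t) * z) t)
        (Fx (l t + (r t - l t) * z) t * (r t - l t)) z := by
    intro F Fx h1 t ht z hz
    exact HasDerivAt.comp (h₂ := fun x => F x t) z (h1 t ht _ (hI t ht z hz)) (hφz t z)
  have pw : ∀ k ≤ 6, D ^ k ≤ D ^ 6 := fun k hk => pow_le_pow_right₀ D1 hk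
  have p6 : 1 ≤ D ^ 6 := one_le_pow₀ D1
  have q1 := pw 1 (by norm_num)
  have q2 := pw 2 (by norm_num)
  have q3 := pw 3 (by norm_num)
  have q5 := pw 5 (by norm_num)
  rw [pow_one] at q1
  have mb : ∀ {x y X Y : ℝ}, |x| ≤ X → |y| ≤ Y → |x * y| ≤ X * Y := by
    intro x y X Y hx hy
    rw [abs_mul]
    exact mul_le_mul hx hy (abs_nonneg _) ((abs_nonneg _).trans hx)
  have ab : ∀ {x y X Y : ℝ}, |x| ≤ X → |y| ≤ Y → |x + y| ≤ X + Y := by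
    intro x y X Y hx hy
    exact (abs_add_le _ _).trans (add_le_add hx hy)
  have aA : ∀ t ∈ Ioo p q, ∀ x ∈ Icc (l t) (r t), |A x t| ≤ D := fun t ht x hx => by
    have : 0 < A x t := lt_of_lt_of_le (by positivity) (a1 t ht x hx)
    rw [abs_of_pos this]; exact a2 t ht x hx
  constructor
  · exact pq
  · linarith
  · intro t ht z hz
    exact (chx u ux d1 t ht z hz).continuousAt.continuousWithinAt
  · intro t ht z hz
    exact ((chx ux uxx d2 t ht z hz).mul_const _).continuousAt.continuousWithinAt
  · intro t ht z hz
    exact chx u ux d1 t ht z (Ioo_subset_Icc_self hz)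
  · intro t ht z hz
    exact ((chx ux uxx d2 t ht z (Ioo_subset_Icc_self hz)).mul_const _).congr_deriv (by ring)
  · intro t ht z hz
    exact ch u ux ut d1 d3 k1 t ht z hz
  · intro t ht z hz
    exact (cc ux k1 t ht z hz).mul (cg t ht z)
  · intro t ht z hz
    exact (cc uxx k2 t ht z hz).mul ((cg t ht z).pow 2)
  · intro t ht z hz
    linarith [u0 t ht _ (hI t ht z hz)]
  · intro t ht z hz
    have := mb (u1 t ht _ (hI t ht z hz)) (ga t ht)
    nlinarith
  · intro t ht z hz
    have := mb (mb (u2 t ht _ (hI t ht z (Ioo_subset_Icc_self hz))) (ga t ht)) (ga t ht)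
    rw [mul_assoc, ← pow_two] at this
    nlinarith
  · intro t ht z hz
    have hz' := Ioo_subset_Icc_self hz
    have := ab (u3 t ht _ (hI t ht z hz')) (mb (u1 t ht _ (hI t ht z hz')) (bφt t ht z hz'))
    nlinarith
  · intro t ht z hz
    have hz' := Ioo_subset_Icc_self hz
    have hx := hI t ht z hz'
    have B := bφt t ht z hz'
    have e := eqn t ht _ hx
    have e7 := a7 t ht _ hx
    have e0 := aA t ht _ hx
    have eb := hb t ht _ hx
    have ec := hc t ht _ hx
    have G := gp t ht
    have G1 := g1 t ht
    have G2 := ga t ht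
    generalize l t + (r t - l t) * z = x at *
    generalize l' t + (r' t - l' t) * z = w at *
    generalize r t - l t = g at *
    have id1 : (g * A x t) ^ 2 * (ut x t + ux x t * w) - uxx x t * g ^ 2
        = (g * g) * (A x t * A x t) * ((b x t + w) * ux x t + c x t * u x t) := by
      rw [e]
      linear_combination (g ^ 2 * uxx x t) * e7
    rw [id1]
    have hux : |ux x t| ≤ D * |ux x t * g| := by
      rw [abs_mul, abs_of_pos G]
      have : 1 ≤ D * g := by
        have := mul_le_mul_of_nonneg_left G1 D0.le
        rwa [mul_inv_cancel₀ D0.ne'] at this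
      nlinarith [abs_nonneg (ux x t)]
    have s1 := mb (mb (mb G2 G2) (mb e0 e0)) (ab (mb (ab eb B) hux) (mb ec le_rfl : |c x t * u x t| ≤ D * |u x t|))
    refine s1.trans ?_
    have n1 := abs_nonneg (u x t)
    have n2 := abs_nonneg (ux x t * g)
    have r1 : D ^ 5 * |u x t| ≤ D ^ 6 * |u x t| := mul_le_mul_of_nonneg_right q5 n1
    have r2 : 0 ≤ D ^ 6 * |ux x t * g| := by positivity
    have r3 : 0 ≤ D ^ 6 * |u x t| := by positivity
    linarith
  · intro t ht
    obtain ⟨x, hx, h0⟩ := nz t ht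
    have G := gp t ht
    refine ⟨(x - l t) / (r t - l t), ⟨div_nonneg (by linarith [hx.1]) G.le, ?_⟩, ?_⟩
    · rw [div_le_one G]; linarith [hx.2]
    · rw [mul_div_cancel₀ _ G.ne', add_sub_cancel]; exact h0
  · intro t ht z hz
    exact ((chx A Ax a5 t ht z hz).const_mul _).continuousAt.continuousWithinAt
  · intro t ht z hz
    have h1 := mul_le_mul (g1 t ht) (a1 t ht _ (hI t ht z hz)) (by positivity) (gp t ht).le
    refine le_trans ?_ h1
    rw [← mul_inv]
    apply inv_anti₀ (by positivity)
    nlinarith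
  · intro t ht z hz
    have := mul_le_mul (g2 t ht) (a2 t ht _ (hI t ht z hz))
      (le_trans (by positivity) (a1 t ht _ (hI t ht z hz))) D0.le
    nlinarith
  · intro t ht z hz
    exact (chx A Ax a5 t ht z (Ioo_subset_Icc_self hz)).const_mul _
  · intro t ht z hz
    exact ((hr t ht).sub (hl t ht)).mul (ch A Ax At a5 a6 k4 t ht z hz)
  · intro t ht z hz
    exact (cg t ht z).mul (cc A k3 t ht z hz)
  · intro t ht z hz
    exact (cg t ht z).mul ((cc Ax k4 t ht z hz).mul (cg t ht z))
  · intro t ht z hz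
    have := mb (ga t ht) (mb (a3 t ht _ (hI t ht z (Ioo_subset_Icc_self hz))) (ga t ht))
    nlinarith
  · intro t ht z hz
    have hz' := Ioo_subset_Icc_self hz
    have hx := hI t ht z hz'
    have h1 : |r' t - l' t| ≤ D + D := (abs_sub _ _).trans (add_le_add (br t ht) (bl t ht))
    have := ab (mb h1 (aA t ht _ hx)) (mb (ga t ht) (ab (a4 t ht _ hx) (mb (a3 t ht _ hx) (bφt t ht z hz'))))
    nlinarith

/-- the left boundary curve -/
theorem left_curve {u : ℝ → ℝ → ℝ} {ξ : ℝ → ℝ} {p q c : ℝ} (pq : p < q)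
    (hξ : ContinuousOn ξ (Icc p q)) (hc : ∀ t ∈ Icc p q, ξ t < c)
    (hu : ContinuousOn (fun w : ℝ × ℝ => u w.1 w.2) {w | w.2 ∈ Icc p q ∧ w.1 ∈ Icc (ξ w.2) c})
    (h1 : (∀ t ∈ Icc p q, u (ξ t) t = 0) → ContDiffOn ℝ 1 ξ (Icc p q)) :
    ∃ p' q', p ≤ p' ∧ p' < q' ∧ q' ≤ q ∧ ∃ (l l' : ℝ → ℝ) (K : ℝ),
      (∀ t ∈ Icc p' q', ξ t ≤ l t ∧ l t < c) ∧ ContinuousOn l (Icc p' q') ∧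
      (∀ t ∈ Ioo p' q', HasDerivAt l (l' t) t ∧ |l' t| ≤ K) ∧
      ((∀ t ∈ Icc p' q', l t = ξ t ∧ u (l t) t = 0) ∨
        ∃ m > 0, ∀ t ∈ Icc p' q', ∀ x ∈ Icc (ξ t) (l t), m ≤ |u x t|) := by
  by_cases hz : ∀ t ∈ Icc p q, u (ξ t) t = 0
  · have hd := h1 hz
    have hcd : ContinuousOn (derivWithin ξ (Icc p q)) (Icc p q) :=
      hd.continuousOn_derivWithin (uniqueDiffOn_Icc pq) le_rfl
    obtain ⟨K, hK⟩ := isCompact_Icc.exists_bound_of_continuousOn hcd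
    refine ⟨p, q, le_rfl, pq, le_rfl, ξ, derivWithin ξ (Icc p q), K, fun t ht => ⟨le_rfl, hc t ht⟩,
      hξ, fun t ht => ⟨?_, hK t (Ioo_subset_Icc_self ht)⟩, Or.inl fun t ht => ⟨rfl, hz t ht⟩⟩
    exact ((hd.differentiableOn one_ne_zero) t (Ioo_subset_Icc_self ht)).hasDerivWithinAt.hasDerivAt
      (Icc_mem_nhds ht.1 ht.2)
  · push Not at hz
    obtain ⟨s, hs, hne⟩ := hz
    have hv : 0 < |u (ξ s) s| := abs_pos.2 hne
    have hcs := hc s hs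
    have hcu := Metric.continuousWithinAt_iff.1 (hu (ξ s, s) ⟨hs, le_rfl, hcs.le⟩)
    obtain ⟨δ, hδ, h2⟩ := hcu (|u (ξ s) s| / 2) (by positivity)
    set η := min (δ / 2) ((c - ξ s) / 2) with hη
    have hη0 : 0 < η := lt_min (by linarith) (by linarith)
    have hη1 : η ≤ δ / 2 := min_le_left _ _
    have hη2 : η ≤ (c - ξ s) / 2 := min_le_right _ _
    obtain ⟨ρ, hρ, h3⟩ := Metric.continuousWithinAt_iff.1 (hξ s hs) η hη0
    set d := min δ ρ / 2 with hd
    have hd0 : 0 < d := half_pos (lt_min hδ hρ)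
    have hd1 : d < δ := lt_of_lt_of_le (half_lt_self (lt_min hδ hρ)) (min_le_left _ _)
    have hd2 : d < ρ := lt_of_lt_of_le (half_lt_self (lt_min hδ hρ)) (min_le_right _ _)
    have hsub : ∀ t ∈ Icc (max p (s - d)) (min q (s + d)), t ∈ Icc p q ∧ |t - s| ≤ d := by
      intro t ht
      have k1 := max_le_iff.1 ht.1
      have k2 := le_min_iff.1 ht.2
      exact ⟨⟨k1.1, k2.1⟩, abs_le.2 ⟨by linarith, by linarith⟩⟩
    have hξt : ∀ t ∈ Icc (max p (s - d)) (min q (s + d)), |ξ t - ξ s| < η := by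
      intro t ht
      obtain ⟨k1, k2⟩ := hsub t ht
      exact h3 k1 (by rw [Real.dist_eq]; linarith)
    refine ⟨max p (s - d), min q (s + d), le_max_left _ _, ?_, min_le_left _ _,
      fun _ => ξ s + η, fun _ => 0, 0, ?_, continuousOn_const,
      fun t ht => ⟨hasDerivAt_const _ _, by simp⟩, Or.inr ⟨|u (ξ s) s| / 2, by positivity, ?_⟩⟩
    · rw [max_lt_iff, lt_min_iff, lt_min_iff]
      exact ⟨⟨pq, by linarith [hs.1]⟩, by linarith [hs.2], by linarith⟩
    · intro t ht
      have := abs_lt.1 (hξt t ht)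
      constructor <;> linarith
    · intro t ht x hx
      have k := abs_lt.1 (hξt t ht)
      obtain ⟨k1, k2⟩ := hsub t ht
      have hx2 : |x - ξ s| < δ := by
        have := hx.1
        have := hx.2
        rw [abs_lt]; constructor <;> linarith
      have h4 : dist ((x, t) : ℝ × ℝ) (ξ s, s) < δ := by
        rw [Prod.dist_eq, max_lt_iff, Real.dist_eq, Real.dist_eq]
        exact ⟨hx2, by simp only; linarith⟩
      have h5 := h2 (x := (x, t)) ⟨k1, hx.1, by have := hx.2; simp only; linarith⟩ h4
      rw [Real.dist_eq] at h5
      simp only at h5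
      have h6 := abs_sub (u x t) (u x t - u (ξ s) s)
      rw [sub_sub_cancel] at h6
      linarith


theorem domLat_nhds {xi1 xi2 : ℝ → ℝ} {T : ℝ} (h1 : ContinuousOn xi1 (Icc 0 T))
    (h2 : ContinuousOn xi2 (Icc 0 T)) {x t : ℝ} (ht : t ∈ Ioo (0:ℝ) T)
    (hx : x ∈ Ioo (xi1 t) (xi2 t)) : domLat xi1 xi2 T ∈ 𝓝 (x, t) := by
  have c1 := h1.continuousAt (Icc_mem_nhds ht.1 ht.2)
  have c2 := h2.continuousAt (Icc_mem_nhds ht.1 ht.2)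
  have s2 : ContinuousAt (fun p : ℝ × ℝ => p.2) (x, t) := continuous_snd.continuousAt
  have s1 : ContinuousAt (fun p : ℝ × ℝ => p.1) (x, t) := continuous_fst.continuousAt
  have k1 : ContinuousAt (fun p : ℝ × ℝ => xi1 p.2) (x, t) :=
    ContinuousAt.comp (g := xi1) (f := fun p : ℝ × ℝ => p.2) (x := (x, t)) c1 s2
  have k2 : ContinuousAt (fun p : ℝ × ℝ => xi2 p.2) (x, t) :=
    ContinuousAt.comp (g := xi2) (f := fun p : ℝ × ℝ => p.2) (x := (x, t)) c2 s2
  filter_upwards [s2.eventually (Ioo_mem_nhds ht.1 ht.2), k1.eventually_lt s1 hx.1,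
      s1.eventually_lt k2 hx.2] with w w1 w2 w3
  exact ⟨⟨w1.1, w1.2.le⟩, w2.le, w3.le⟩

theorem compact_strip {l r : ℝ → ℝ} {p q : ℝ} (hl : ContinuousOn l (Icc p q))
    (hr : ContinuousOn r (Icc p q)) (hlr : ∀ t ∈ Icc p q, l t < r t) :
    IsCompact {w : ℝ × ℝ | w.2 ∈ Icc p q ∧ w.1 ∈ Icc (l w.2) (r w.2)} := by
  have hQ : IsCompact (Icc (0:ℝ) 1 ×ˢ Icc p q) := isCompact_Icc.prod isCompact_Icc
  have s2 : MapsTo (fun w : ℝ × ℝ => w.2) (Icc (0:ℝ) 1 ×ˢ Icc p q) (Icc p q) := fun w hw => hw.2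
  have l2 : ContinuousOn (fun w : ℝ × ℝ => l w.2) (Icc (0:ℝ) 1 ×ˢ Icc p q) :=
    hl.comp continuous_snd.continuousOn s2
  have r2 : ContinuousOn (fun w : ℝ × ℝ => r w.2) (Icc (0:ℝ) 1 ×ˢ Icc p q) :=
    hr.comp continuous_snd.continuousOn s2
  have hΦ : ContinuousOn (fun w : ℝ × ℝ => (l w.2 + (r w.2 - l w.2) * w.1, w.2))
      (Icc (0:ℝ) 1 ×ˢ Icc p q) :=
    (l2.add ((r2.sub l2).mul continuous_fst.continuousOn)).prodMk continuous_snd.continuousOn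
  convert hQ.image_of_continuousOn hΦ
  ext ⟨x, t⟩
  constructor
  · rintro ⟨ht, hx⟩
    simp only at ht hx
    have G : 0 < r t - l t := sub_pos.2 (hlr t ht)
    refine ⟨((x - l t) / (r t - l t), t), ⟨⟨div_nonneg (by linarith [hx.1]) G.le, ?_⟩, ht⟩, ?_⟩
    · simp only
      rw [div_le_one G]; linarith [hx.2]
    · simp only
      rw [mul_div_cancel₀ _ G.ne', add_sub_cancel]
  · rintro ⟨⟨z, s⟩, ⟨hz, hs⟩, e⟩
    simp only [Prod.mk.injEq] at e hz hs
    obtain ⟨e1, rfl⟩ := e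
    have G : 0 < r s - l s := sub_pos.2 (hlr s hs)
    refine ⟨hs, ?_⟩
    simp only [← e1]
    constructor
    · nlinarith [hz.1]
    · nlinarith [hz.2]

theorem sqrt_arith {y N : ℝ} (hy : 0 < y) (hN : 1 ≤ N) (h1 : y ≤ N) (h2 : y⁻¹ ≤ N) :
    N⁻¹ ≤ (√y)⁻¹ ∧ (√y)⁻¹ ≤ N := by
  have s0 : 0 < √y := Real.sqrt_pos.2 hy
  constructor
  · apply inv_anti₀ s0
    rw [Real.sqrt_le_iff]
    exact ⟨by linarith, by nlinarith⟩
  · rw [← Real.sqrt_inv, Real.sqrt_le_iff]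
    exact ⟨by linarith, by nlinarith⟩

theorem sqrt_deriv {f : ℝ → ℝ} {f' x : ℝ} (h : HasDerivAt f f' x) (hp : 0 < f x) :
    HasDerivAt (fun x => (√(f x))⁻¹) (-(f' / 2) * (√(f x))⁻¹ ^ 3) x := by
  have s0 : 0 < √(f x) := Real.sqrt_pos.2 hp
  exact ((h.sqrt hp.ne').inv s0.ne').congr_deriv (by field_simp)

theorem core_RF {T : ℝ} {xi1 xi2 : ℝ → ℝ} {a b c u : ℝ → ℝ → ℝ}
    (hxc1 : ContinuousOn xi1 (Icc 0 T)) (hxc2 : ContinuousOn xi2 (Icc 0 T))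
    (hsol : IsClassicalSolution a b c xi1 xi2 T u)
    (hreg : Reg12 a b c xi1 xi2 T) {p q K : ℝ} (hp : 0 < p) (pq : p < q) (hq : q ≤ T)
    {l r l' r' : ℝ → ℝ}
    (h1 : ∀ t ∈ Icc p q, xi1 t ≤ l t) (hlr : ∀ t ∈ Icc p q, l t < r t)
    (h2 : ∀ t ∈ Icc p q, r t ≤ xi2 t)
    (cl : ContinuousOn l (Icc p q)) (cr : ContinuousOn r (Icc p q))
    (dl : ∀ t ∈ Ioo p q, HasDerivAt l (l' t) t ∧ |l' t| ≤ K)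
    (dr : ∀ t ∈ Ioo p q, HasDerivAt r (r' t) t ∧ |r' t| ≤ K)
    (nz : ∀ t ∈ Ioo p q, ∃ x ∈ Icc (l t) (r t), u x t ≠ 0) :
    ∃ Ux Uxx Ut β βx βt C, RF (fun z t => u (l t + (r t - l t) * z) t) Ux Uxx Ut β βx βt p q C := by
  obtain ⟨M, hM⟩ := hreg
  have hS := compact_strip cl cr hlr
  set S := {w : ℝ × ℝ | w.2 ∈ Icc p q ∧ w.1 ∈ Icc (l w.2) (r w.2)} with hSdef
  have inD : ∀ t ∈ Icc p q, ∀ x ∈ Icc (l t) (r t), (x, t) ∈ domLat xi1 xi2 T := by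
    intro t ht x hx
    exact ⟨⟨hp.trans_le ht.1, ht.2.trans hq⟩, (h1 t ht).trans hx.1, hx.2.trans (h2 t ht)⟩
  have SD : S ⊆ domLat xi1 xi2 T := fun w hw => inD w.2 hw.1 w.1 hw.2
  have SC : S ⊆ domCl xi1 xi2 T := fun w hw => ⟨Ioc_subset_Icc_self (SD hw).1, (SD hw).2⟩
  obtain ⟨B0, hB0⟩ := hS.exists_bound_of_continuousOn (hsol.cont.mono SC)
  obtain ⟨B1, hB1⟩ := hS.exists_bound_of_continuousOn (hsol.cont_x.mono SD)
  obtain ⟨B2, hB2⟩ := hS.exists_bound_of_continuousOn (hsol.cont_xx.mono SD)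
  obtain ⟨B3, hB3⟩ := hS.exists_bound_of_continuousOn (hsol.cont_t.mono SD)
  obtain ⟨G0, hG0⟩ := isCompact_Icc.exists_bound_of_continuousOn (cr.sub cl)
  obtain ⟨G1, hG1⟩ := isCompact_Icc.exists_bound_of_continuousOn
    ((cr.sub cl).inv₀ (fun t ht => (sub_pos.2 (hlr t ht)).ne'))
  set N : ℝ := 1 + |M| with hN
  have N1 : 1 ≤ N := by linarith [abs_nonneg M]
  have MN : M ≤ N := by linarith [le_abs_self M]
  have N4 : N ≤ N ^ 4 := le_self_pow₀ N1 (by norm_num)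
  set D : ℝ := N ^ 4 + |K| + |B0| + |B1| + |B2| + |B3| + |G0| + |G1| with hD
  have e0 := abs_nonneg K
  have e1 := abs_nonneg B0
  have e2 := abs_nonneg B1
  have e3 := abs_nonneg B2
  have e4 := abs_nonneg B3
  have e5 := abs_nonneg G0
  have e6 := abs_nonneg G1
  have f0 := le_abs_self K
  have f1 := le_abs_self B0
  have f2 := le_abs_self B1
  have f3 := le_abs_self B2
  have f4 := le_abs_self B3
  have f5 := le_abs_self G0
  have f6 := le_abs_self G1
  have ND : N ^ 4 ≤ D := by linarith
  have D1 : 1 ≤ D := by linarith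
  have sq := @Ioo_subset_Icc_self ℝ _ p q
  have nb : ∀ t ∈ Ioo p q, ∀ x ∈ Ioo (l t) (r t), domLat xi1 xi2 T ∈ 𝓝 (x, t) := by
    intro t ht x hx
    exact domLat_nhds hxc1 hxc2 ⟨hp.trans ht.1, ht.2.trans_le hq⟩
      ⟨(h1 t (sq ht)).trans_lt hx.1, hx.2.trans_le (h2 t (sq ht))⟩
  have aint : ∀ t ∈ Ioo p q, ∀ x ∈ Ioo (l t) (r t),
      ContinuousAt (fun w : ℝ × ℝ => a w.1 w.2) (x, t) ∧
      ContinuousAt (fun w : ℝ × ℝ => pdx a w.1 w.2) (x, t) := by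
    intro t ht x hx
    obtain ⟨ρ, hρ, hr'⟩ := rect_of_ev (P := fun w => w ∈ domLat xi1 xi2 T) (nb t ht x hx)
    refine interp (a := a) (ax := pdx a) (axx := pdxx a) (at' := pdt a) (M := M) hρ ?_ ?_ ?_ ?_ ?_ ?_
    · intro y s hy hs; exact (hM _ (hr' y s hy hs)).2.1.hasDerivAt
    · intro y s hy hs; exact (hM _ (hr' y s hy hs)).2.2.1.hasDerivAt
    · intro y s hy hs; exact (hM _ (hr' y s hy hs)).2.2.2.1.hasDerivAt
    · intro y s hy hs; exact (hM _ (hr' y s hy hs)).2.2.2.2.2.2.2.2.2.1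
    · intro y s hy hs; exact (hM _ (hr' y s hy hs)).2.2.2.2.2.2.2.2.2.2.1
    · intro y s hy hs; exact (hM _ (hr' y s hy hs)).2.2.2.2.2.2.2.2.1
  have Ab : ∀ t ∈ Ioo p q, ∀ x ∈ Icc (l t) (r t), N⁻¹ ≤ (√(a x t))⁻¹ ∧ (√(a x t))⁻¹ ≤ N := by
    intro t ht x hx
    have := hM _ (inD t (sq ht) x hx)
    obtain ⟨m0, -, -, -, -, -, m1, m2, -⟩ := this
    exact sqrt_arith m0 N1 ((le_abs_self _).trans (m1.trans MN)) ((le_abs_self _).trans (m2.trans MN))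
  have A3 : ∀ t ∈ Ioo p q, ∀ x ∈ Icc (l t) (r t), ∀ g, |g| ≤ M →
      |-(g / 2) * (√(a x t))⁻¹ ^ 3| ≤ D := by
    intro t ht x hx g hg
    have hA := Ab t ht x hx
    have hA0 : 0 ≤ (√(a x t))⁻¹ := by positivity
    rw [abs_mul, abs_neg, abs_div, abs_two, abs_of_nonneg (pow_nonneg hA0 3)]
    have k1 : |g| / 2 ≤ N := by linarith [abs_nonneg g]
    have k2 : (√(a x t))⁻¹ ^ 3 ≤ N ^ 3 := pow_le_pow_left₀ hA0 hA.2 3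
    calc _ ≤ N * N ^ 3 := mul_le_mul k1 k2 (by positivity) (by linarith)
      _ = N ^ 4 := by ring
      _ ≤ D := ND
  refine ⟨_, _, _, _, _, _, _, mkRF (u := u) (ux := pdx u) (uxx := pdxx u) (ut := pdt u)
    (A := fun x t => (√(a x t))⁻¹) (Ax := fun x t => -(pdx a x t / 2) * (√(a x t))⁻¹ ^ 3)
    (At := fun x t => -(pdt a x t / 2) * (√(a x t))⁻¹ ^ 3) (a := a) (b := b) (c := c)
    (l := l) (r := r) (l' := l') (r' := r') (D := D) pq D1 (fun t ht => (dl t ht).1)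
    (fun t ht => (dr t ht).1) (fun t ht => by linarith [(dl t ht).2])
    (fun t ht => by linarith [(dr t ht).2]) ?_ ?_ ?_ ?_ ?_ ?_ ?_ ?_ ?_ ?_ ?_ ?_ ?_ ?_ ?_ ?_ ?_ ?_ ?_
    ?_ ?_ ?_ ?_ nz⟩
  · intro t ht
    have h := hG1 t (sq ht)
    have G : 0 < r t - l t := sub_pos.2 (hlr t (sq ht))
    simp only [Pi.inv_apply, Pi.sub_apply, norm_inv, Real.norm_eq_abs, abs_of_pos G] at h
    rw [inv_le_comm₀ (by linarith) G]
    linarith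
  · intro t ht
    have h := hG0 t (sq ht)
    have := le_abs_self (r t - l t)
    simp only [Pi.sub_apply, Real.norm_eq_abs] at h
    linarith
  · intro t ht x hx
    have h := hB0 (x, t) ⟨sq ht, hx⟩
    rw [Real.norm_eq_abs] at h
    exact h.trans (by linarith)
  · intro t ht x hx
    have h := hB1 (x, t) ⟨sq ht, hx⟩
    rw [Real.norm_eq_abs] at h
    exact h.trans (by linarith)
  · intro t ht x hx
    have h := hB2 (x, t) ⟨sq ht, hx⟩
    rw [Real.norm_eq_abs] at h
    exact h.trans (by linarith)
  · intro t ht x hx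
    have h := hB3 (x, t) ⟨sq ht, hx⟩
    rw [Real.norm_eq_abs] at h
    exact h.trans (by linarith)
  · intro t ht x hx
    exact (hsol.diff_x _ (inD t (sq ht) x hx)).hasDerivAt
  · intro t ht x hx
    exact (hsol.diff_xx _ (inD t (sq ht) x hx)).hasDerivAt
  · intro t ht x hx
    exact (hsol.diff_t _ (inD t (sq ht) x hx)).hasDerivAt
  · intro t ht x hx
    refine le_trans ?_ (Ab t ht x hx).1
    exact inv_anti₀ (by linarith) (by linarith)
  · intro t ht x hx
    exact (Ab t ht x hx).2.trans (by linarith)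
  · intro t ht x hx
    obtain ⟨-, -, -, -, -, -, -, -, -, m1, -⟩ := hM _ (inD t (sq ht) x hx)
    exact A3 t ht x hx _ m1
  · intro t ht x hx
    obtain ⟨-, -, -, -, -, -, -, -, m1, -⟩ := hM _ (inD t (sq ht) x hx)
    exact A3 t ht x hx _ m1
  · intro t ht x hx
    obtain ⟨m0, m1, -⟩ := hM _ (inD t (sq ht) x hx)
    exact sqrt_deriv m1.hasDerivAt m0
  · intro t ht x hx
    obtain ⟨m0, -, -, m1, -⟩ := hM _ (inD t (sq ht) x hx)
    exact sqrt_deriv m1.hasDerivAt m0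
  · intro t ht x hx
    have m0 := (hM _ (inD t (sq ht) x hx)).1
    simp only at m0
    rw [inv_pow, Real.sq_sqrt m0.le, inv_mul_cancel₀ m0.ne']
  · intro t ht x hx
    obtain ⟨-, -, -, -, -, -, -, -, -, -, -, m1, -⟩ := hM _ (inD t (sq ht) x hx)
    exact m1.trans (by linarith)
  · intro t ht x hx
    obtain ⟨-, -, -, -, -, -, -, -, -, -, -, -, -, -, m1⟩ := hM _ (inD t (sq ht) x hx)
    exact m1.trans (by linarith)
  · intro t ht x hx
    exact hsol.eqn _ (inD t (sq ht) x hx)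
  · intro t ht x hx
    exact hsol.cont_x.continuousAt (nb t ht x hx)
  · intro t ht x hx
    exact hsol.cont_xx.continuousAt (nb t ht x hx)
  · intro t ht x hx
    have m0 := (hM _ (inD t (sq ht) x (Ioo_subset_Icc_self hx))).1
    exact (aint t ht x hx).1.sqrt.inv₀ (Real.sqrt_pos.2 m0).ne'
  · intro t ht x hx
    have m0 := (hM _ (inD t (sq ht) x (Ioo_subset_Icc_self hx))).1
    exact ((aint t ht x hx).2.div_const 2).neg.mul
      (((aint t ht x hx).1.sqrt.inv₀ (Real.sqrt_pos.2 m0).ne').pow 3)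


theorem exists_fin_zero {T : ℝ} {xi1 xi2 : ℝ → ℝ} {a b c u : ℝ → ℝ → ℝ}
    (hxc1 : ContinuousOn xi1 (Icc 0 T)) (hxc2 : ContinuousOn xi2 (Icc 0 T))
    (hxlt : ∀ t ∈ Icc (0:ℝ) T, xi1 t < xi2 t)
    (hsol : IsClassicalSolution a b c xi1 xi2 T u)
    (hreg : Reg12 a b c xi1 xi2 T)
    (hnz : ∀ t ∈ Icc (0:ℝ) T, ∃ x ∈ Icc (xi1 t) (xi2 t), u x t ≠ 0)
    (hH1a : H1cond (bdryTrace u xi1) xi1 T) (hH1b : H1cond (bdryTrace u xi2) xi2 T)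
    {p q : ℝ} (hp : 0 < p) (pq : p < q) (hq : q ≤ T) :
    ∃ t ∈ Ioo p q, (zeroSet u xi1 xi2 t).Finite := by
  have hpT : p ∈ Ioo 0 T := ⟨hp, pq.trans_le hq⟩
  have hlt := hxlt p (Ioo_subset_Icc_self hpT)
  set d := (xi1 p + xi2 p) / 2 with hd
  have c1 := hxc1.continuousAt (Icc_mem_nhds hpT.1 hpT.2)
  have c2 := hxc2.continuousAt (Icc_mem_nhds hpT.1 hpT.2)
  have ev1 := c1.eventually_lt (continuousAt_const (y := d)) (by linarith)
  have ev2 := (continuousAt_const (y := d)).eventually_lt c2 (by linarith)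
  obtain ⟨ε, hε, hev⟩ := Metric.eventually_nhds_iff.1 (ev1.and ev2)
  set q1 := min q (p + ε / 2) with hq1
  have pq1 : p < q1 := lt_min pq (by linarith)
  have q1q : q1 ≤ q := min_le_left _ _
  have mid : ∀ t ∈ Icc p q1, xi1 t < d ∧ d < xi2 t := by
    intro t ht
    apply hev
    have : q1 ≤ p + ε / 2 := min_le_right _ _
    have h1 := ht.1
    have h2 := ht.2
    rw [Real.dist_eq, abs_of_nonneg (by linarith)]
    linarith
  have sub1 : Icc p q1 ⊆ Icc 0 T := Icc_subset_Icc hp.le (q1q.trans hq)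
  obtain ⟨p2, q2, hp2, pq2, hq2, l, l', K1, L1, L2, L3, L4⟩ :=
    left_curve (u := u) (ξ := xi1) (c := d) pq1 (hxc1.mono sub1) (fun t ht => (mid t ht).1)
      (hsol.cont.mono (fun w hw => ⟨sub1 hw.1, hw.2.1, hw.2.2.trans (mid w.2 hw.1).2.le⟩))
      (fun h => hH1a p q1 hp.le pq1 (q1q.trans hq) h)
  have sub2 : Icc p2 q2 ⊆ Icc p q1 := Icc_subset_Icc hp2 hq2
  have cu : ContinuousOn (fun w : ℝ × ℝ => u (-w.1) w.2)
      {w | w.2 ∈ Icc p2 q2 ∧ w.1 ∈ Icc (-xi2 w.2) (-d)} := by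
    refine ContinuousOn.comp (g := fun w : ℝ × ℝ => u w.1 w.2) (f := fun w : ℝ × ℝ => (-w.1, w.2))
      hsol.cont (by fun_prop) ?_
    intro w hw
    have h3 := (mid w.2 (sub2 hw.1)).1
    have h4 := hw.2.1
    have h5 := hw.2.2
    exact ⟨sub1 (sub2 hw.1), by simp only; linarith, by simp only; linarith⟩
  obtain ⟨p3, q3, hp3, pq3, hq3, n, n', K2, N1, N2, N3, N4⟩ :=
    left_curve (u := fun x t => u (-x) t) (ξ := fun t => -xi2 t) (c := -d) pq2
      ((hxc2.mono (sub2.trans sub1)).neg) (fun t ht => neg_lt_neg (mid t (sub2 ht)).2) cu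
      (fun h => by
        have := hH1b p2 q2 (hp.le.trans hp2) pq2 (hq2.trans (q1q.trans hq))
          (fun t ht => by simpa [bdryTrace] using h t ht)
        exact this.neg)
  have sub3 : Icc p3 q3 ⊆ Icc p2 q2 := Icc_subset_Icc hp3 hq3
  have so3 : Ioo p3 q3 ⊆ Ioo p2 q2 := Ioo_subset_Ioo hp3 hq3
  have sq := @Ioo_subset_Icc_self ℝ _ p3 q3
  -- location of points outside
  have outL : ∀ t ∈ Icc p3 q3, ∀ x, xi1 t ≤ x → x < l t → u x t ≠ 0 ∧ u (l t) t ≠ 0 := by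
    intro t ht x hx hxl
    rcases L4 with L4 | ⟨m, hm, L4⟩
    · have := (L4 t (sub3 ht)).1
      linarith
    · have k1 := L4 t (sub3 ht) x ⟨hx, hxl.le⟩
      have k2 := L4 t (sub3 ht) (l t) ⟨hx.trans hxl.le, le_rfl⟩
      exact ⟨abs_pos.1 (hm.trans_le k1), abs_pos.1 (hm.trans_le k2)⟩
  have outR : ∀ t ∈ Icc p3 q3, ∀ x, x ≤ xi2 t → -n t < x → u x t ≠ 0 ∧ u (-n t) t ≠ 0 := by
    intro t ht x hx hxl
    rcases N4 with N4 | ⟨m, hm, N4⟩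
    · have := (N4 t ht).1
      linarith
    · have k1 := N4 t ht (-x) ⟨by linarith, by linarith⟩
      have k2 := N4 t ht (n t) ⟨by linarith, le_rfl⟩
      rw [neg_neg] at k1
      exact ⟨abs_pos.1 (hm.trans_le k1), abs_pos.1 (hm.trans_le k2)⟩
  have hlr : ∀ t ∈ Icc p3 q3, l t < -n t := fun t ht => by
    linarith [(L1 t (sub3 ht)).2, (N1 t ht).2]
  obtain ⟨Ux, Uxx, Ut, β, βx, βt, C, h⟩ := core_RF (l := l) (r := fun t => -n t) (l' := l')
    (r' := fun t => -n' t) (K := max K1 K2) hxc1 hxc2 hsol hreg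
    (hp.trans_le (hp2.trans hp3)) pq3 ((hq3.trans hq2).trans (q1q.trans hq))
    (fun t ht => (L1 t (sub3 ht)).1) hlr (fun t ht => by linarith [(N1 t ht).1])
    (L2.mono sub3) N2.neg
    (fun t ht => ⟨(L3 t (so3 ht)).1, (L3 t (so3 ht)).2.trans (le_max_left _ _)⟩)
    (fun t ht => ⟨(N3 t ht).1.neg, by rw [abs_neg]; exact (N3 t ht).2.trans (le_max_right _ _)⟩)
    (by
      intro t ht
      have ht' := sq ht
      have G := hlr t ht'
      obtain ⟨x, hx, h0⟩ := hnz t (sub1 (sub2 (sub3 ht')))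
      by_cases hxl : x < l t
      · exact ⟨l t, ⟨le_rfl, G.le⟩, (outL t ht' x hx.1 hxl).2⟩
      · by_cases hxr : -n t < x
        · exact ⟨-n t, ⟨G.le, le_rfl⟩, (outR t ht' x hx.2 hxr).2⟩
        · exact ⟨x, ⟨not_lt.1 hxl, not_lt.1 hxr⟩, h0⟩)
  obtain ⟨t, ht, hf⟩ := h.fin3
    (by
      rcases L4 with L4 | ⟨m, hm, L4⟩
      · left; intro t ht
        simpa using (L4 t (sub3 (sq ht))).2
      · right; refine ⟨m, hm, fun t ht => ?_⟩
        simpa using L4 t (sub3 (sq ht)) (l t) ⟨(L1 t (sub3 (sq ht))).1, le_rfl⟩)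
    (by
      rcases N4 with N4 | ⟨m, hm, N4⟩
      · left; intro t ht
        simpa using (N4 t (sq ht)).2
      · right; refine ⟨m, hm, fun t ht => ?_⟩
        simpa using N4 t (sq ht) (n t) ⟨(N1 t (sq ht)).1, le_rfl⟩)
  have ht' := sq ht
  refine ⟨t, Ioo_subset_Ioo (hp2.trans hp3) ((hq3.trans hq2).trans q1q) ht, ?_⟩
  refine (hf.image (fun z => l t + (-n t - l t) * z)).subset ?_
  rintro x ⟨hx, h0⟩
  have G : 0 < -n t - l t := sub_pos.2 (hlr t ht')
  have k1 : l t ≤ x := by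
    by_contra hh
    exact (outL t ht' x hx.1 (not_le.1 hh)).1 h0
  have k2 : x ≤ -n t := by
    by_contra hh
    exact (outR t ht' x hx.2 (not_le.1 hh)).1 h0
  have e : l t + (-n t - l t) * ((x - l t) / (-n t - l t)) = x := by
    rw [mul_div_cancel₀ _ G.ne', add_sub_cancel]
  refine ⟨(x - l t) / (-n t - l t), ⟨⟨div_nonneg (by linarith) G.le, ?_⟩, ?_⟩, e⟩
  · rw [div_le_one G]; linarith
  · rw [e]; exact h0

theorem exists_seq_zero {T : ℝ} (hT : 0 < T) {P : ℝ → Prop}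
    (h : ∀ p q, 0 < p → p < q → q ≤ T → ∃ t ∈ Ioo p q, P t) :
    ∃ τ : ℕ → ℝ, StrictAnti τ ∧ Tendsto τ atTop (𝓝 0) ∧ ∀ j, τ j ∈ Ioo 0 T ∧ P (τ j) := by
  have h' : ∀ j : ℕ, ∃ t ∈ Ioo (T / (j + 2)) (T / (j + 1)), P t := by
    intro j
    apply h
    · positivity
    · apply div_lt_div_of_pos_left hT (by positivity); linarith
    · apply div_le_self hT.le
      have : (0:ℝ) ≤ j := by positivity
      linarith
  choose τ h1 h2 using h'
  have hpos : ∀ j, 0 < τ j := fun j => lt_trans (by positivity) (h1 j).1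
  refine ⟨τ, strictAnti_nat_of_succ_lt fun j => ?_, ?_, fun j => ⟨⟨hpos j, ?_⟩, h2 j⟩⟩
  · have k1 := (h1 (j + 1)).2
    have k2 := (h1 j).1
    push_cast at k1
    rw [show (j:ℝ) + 1 + 1 = j + 2 by ring] at k1
    exact k1.trans k2
  · refine squeeze_zero (fun j => (hpos j).le) (fun j => (h1 j).2.le) ?_
    have := (tendsto_one_div_add_atTop_nhds_zero_nat (𝕜 := ℝ)).const_mul T
    simpa [div_eq_mul_inv] using this
  · refine (h1 j).2.trans_le (div_le_self hT.le ?_)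
    have : (0:ℝ) ≤ j := by positivity
    linarith



end Aux

/-- Lemma 2.3: there exists a sequence `τ_j ↓ 0` along which the number of zeroes of
`u(·, τ_j)` in `[ξ₁(τ_j), ξ₂(τ_j)]` is finite. -/
theorem finite_zero_number_from_the_beginning
    (T : ℝ) (xi1 xi2 : ℝ → ℝ) (a b c u : ℝ → ℝ → ℝ)
    (hT : 0 < T)
    (hxc1 : ContinuousOn xi1 (Icc 0 T)) (hxc2 : ContinuousOn xi2 (Icc 0 T))
    (hxlt : ∀ t ∈ Icc (0:ℝ) T, xi1 t < xi2 t)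
    (hsol : IsClassicalSolution a b c xi1 xi2 T u)
    (hreg : Reg12 a b c xi1 xi2 T)
    (hnz : ∀ t ∈ Icc (0:ℝ) T, ∃ x ∈ Icc (xi1 t) (xi2 t), u x t ≠ 0)
    (hH1a : H1cond (bdryTrace u xi1) xi1 T) (hH1b : H1cond (bdryTrace u xi2) xi2 T) :
    ∃ τ : ℕ → ℝ, StrictAnti τ ∧ Filter.Tendsto τ Filter.atTop (nhds 0) ∧
      ∀ j : ℕ, τ j ∈ Ioo (0:ℝ) T ∧ Znum u xi1 xi2 (τ j) < ⊤ := by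
  exact exists_seq_zero hT (P := fun t => Znum u xi1 xi2 t < ⊤) fun p q hp pq hq => by
    obtain ⟨t, ht, hf⟩ := exists_fin_zero hxc1 hxc2 hxlt hsol hreg hnz hH1a hH1b hp pq hq
    exact ⟨t, ht, Set.encard_lt_top_iff.2 hf⟩
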